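/- Suppose condition (C1) holds, and let λ_2 ≥ λ_1 > 0. Let ũ_0, ṽ_0 ∈ L¹_loc(ℝ^n) satisfy f_{λ_1}(|y|) ≤ ũ_0(y), ṽ_0(y) ≤ f_{λ_2}(|y|) on ℝ^n, and suppose ∫_{ℝ^n} |ũ_0 − ṽ_0| 𝒞^{p_0} dy < ∞. Let ũ and ṽ be positive classical solutions of the rescaled equation v_τ = Δ(v^m) + α v + β y·∇v in ℝ^n × (0,∞), continuous down to τ = 0 with initial values ũ_0, ṽ_0 respectively, and satisfying f_{λ_1}(|y|) ≤ ũ(y,τ), ṽ(y,τ) ≤ f_{λ_2}(|y|) on ℝ^n × (0,∞). Then: (i) for every τ > 0, ∫_{ℝ^n} |ũ(y,τ) − ṽ(y,τ)| 𝒞(y)^{p_0} dy + a_* ∫_0^τ ∫_{ℝ^n} |ũ(y,s) − ṽ(y,s)| · | (𝒞(y)/f_{λ_2}(|y|))^{1−m} − 1 | 𝒞(y)^{p_0} dy ds ≤ ∫_{ℝ^n} |ũ_0(y) − ṽ_0(y)| 𝒞(y)^{p_0} dy, where a_* = (2 m p_0/(C_*(1−m)))(γ_1 + 2m/(1−m))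 > 0; and (ii) if ũ_0 − ṽ_0 is not identically zero, then the first inequality is strict for every τ > 0: ∫_{ℝ^n} |ũ(y,τ) − ṽ(y,τ)| 𝒞(y)^{p_0} dy < ∫_{ℝ^n} |ũ_0(y) − ṽ_0(y)| 𝒞(y)^{p_0} dy. -/

import Mathlib

open Real Filter MeasureTheory Set Topology

noncomputable section

def Cstar (n : ℕ) (m : ℝ) : ℝ := 2 * m * ((n : ℝ) - 2 - n * m) / (1 - m)

def beta1 (n : ℕ) (m : ℝ) : ℝ := 1 / ((n : ℝ) - 2 - n * m)

def betaE (n : ℕ) (m : ℝ) : ℝ := m / ((n : ℝ) - 2 - n * m)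

def beta2 (n : ℕ) (m : ℝ) : ℝ :=
  Real.sqrt (2 * (1 - m) / ((n : ℝ) - 2 - n * m)) +
    (((n : ℝ) + 2) * m - ((n : ℝ) - 2)) / (2 * ((n : ℝ) - 2 - n * m))

def beta0 (n : ℕ) (m : ℝ) : ℝ := max (beta2 n m) (betaE n m)

def A0 (n : ℕ) (m β : ℝ) : ℝ :=
  (n : ℝ) - 2 - ((n : ℝ) + 2) * m + 2 * β * ((n : ℝ) - 2 - n * m)

def gamma1 (n : ℕ) (m β : ℝ) : ℝ :=
  (A0 n m β - Real.sqrt ((A0 n m β) ^ 2 - 8 * ((n : ℝ) - 2 - n * m) * (1 - m))) / (2 * (1 - m))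

def gamma2 (n : ℕ) (m β : ℝ) : ℝ :=
  (A0 n m β + Real.sqrt ((A0 n m β) ^ 2 - 8 * ((n : ℝ) - 2 - n * m) * (1 - m))) / (2 * (1 - m))

def Acoef1 (n : ℕ) (m β : ℝ) : ℝ := 1 / (1 - m) - β * gamma1 n m β

def Acoef2 (n : ℕ) (m β : ℝ) : ℝ := 1 / (1 - m) - β * gamma2 n m β

/-- Condition (C1). -/
def CondC1 (n : ℕ) (m β : ℝ) : Prop :=
  beta1 n m < β ∨
    (4 < n ∧ 0 < m ∧ m < ((n : ℝ) - 4) / ((n : ℝ) - 2) ∧ beta0 n m < β ∧ β ≤ beta1 n m)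

/-- Condition (C2). -/
def CondC2 (n : ℕ) (m β : ℝ) : Prop :=
  beta0 n m < β ∧ β < beta1 n m ∧
    (n ≤ 4 ∨ (4 < n ∧ ((n : ℝ) - 4) / ((n : ℝ) - 2) < m ∧ m < ((n : ℝ) - 2) / n))

/-- Condition (C3). -/
def CondC3 (n : ℕ) (m β : ℝ) : Prop :=
  β = beta1 n m ∧
    (n ≤ 4 ∨ (4 < n ∧ ((n : ℝ) - 4) / ((n : ℝ) - 2) < m ∧ m < ((n : ℝ) - 2) / n))

/-- A self-similar profile `f = f_lam`. -/
structure IsProfile (n : ℕ) (m β α lam : ℝ) (f : ℝ → ℝ) : Prop where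
  pos : ∀ r, 0 ≤ r → 0 < f r
  smooth : ContDiffOn ℝ 2 f (Set.Ici 0)
  ode : ∀ r, 0 < r →
    deriv (deriv (fun s => f s ^ m)) r + (((n : ℝ) - 1) / r) * deriv (fun s => f s ^ m) r +
      α * f r + β * r * deriv f r = 0
  init : f 0 = lam ^ (2 / (1 - m))
  init' : deriv f 0 = 0
  asymp : Tendsto (fun r => r ^ 2 * f r ^ (1 - m)) atTop (nhds (Cstar n m))

/-- The Laplacian of `f : ℝ^n → ℝ`. -/
def lap (n : ℕ) (f : EuclideanSpace ℝ (Fin n) → ℝ) (x : EuclideanSpace ℝ (Fin n)) : ℝ :=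
  ∑ i : Fin n,
    fderiv ℝ (fun y => fderiv ℝ f y (EuclideanSpace.single i (1 : ℝ))) x
      (EuclideanSpace.single i (1 : ℝ))

/-- The self-similar solution `U_lam(x,t) = (T-t)^α f_lam((T-t)^β |x|)`. -/
def Uself (n : ℕ) (β α T : ℝ) (f : ℝ → ℝ) (x : EuclideanSpace ℝ (Fin n)) (t : ℝ) : ℝ :=
  (T - t) ^ α * f ((T - t) ^ β * ‖x‖)

/-- A (positive smooth) solution of the Cauchy problem `u_t = Δ(u^m)` on `ℝ^n × (0,T)` with
initial value `u0` taken in `L¹_loc`. -/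
structure IsCauchySolution (n : ℕ) (m T : ℝ) (u0 : EuclideanSpace ℝ (Fin n) → ℝ)
    (u : EuclideanSpace ℝ (Fin n) → ℝ → ℝ) : Prop where
  pos : ∀ x, ∀ t ∈ Set.Ioo 0 T, 0 < u x t
  smooth : ContDiffOn ℝ (⊤ : ℕ∞) (fun p : EuclideanSpace ℝ (Fin n) × ℝ => u p.1 p.2)
    ((Set.univ : Set (EuclideanSpace ℝ (Fin n))) ×ˢ Set.Ioo 0 T)
  pde : ∀ x, ∀ t ∈ Set.Ioo 0 T, deriv (u x) t = lap n (fun y => u y t ^ m) x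
  init : ∀ K : Set (EuclideanSpace ℝ (Fin n)), IsCompact K →
    Tendsto (fun t => ∫ x in K, |u x t - u0 x|) (nhdsWithin 0 (Set.Ioi 0)) (nhds 0)

/-- The rescaled solution `ũ(y,τ)`. -/
def resc (n : ℕ) (β α T : ℝ) (u : EuclideanSpace ℝ (Fin n) → ℝ → ℝ)
    (y : EuclideanSpace ℝ (Fin n)) (τ : ℝ) : ℝ :=
  (T * Real.exp (-τ)) ^ (-α) * u (((T * Real.exp (-τ)) ^ (-β)) • y) (T * (1 - Real.exp (-τ)))

/-- The singular profile `𝒞(y) = (C_*/|y|²)^{1/(1-m)}`. -/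
def singC (n : ℕ) (m : ℝ) (y : EuclideanSpace ℝ (Fin n)) : ℝ :=
  (Cstar n m / ‖y‖ ^ 2) ^ (1 / (1 - m))

/-- The weight exponent `p₀`. -/
def pZero (n : ℕ) (m β : ℝ) : ℝ := ((1 - m) / 2) * ((n : ℝ) - 2 / (1 - m) - gamma1 n m β)

/-- The constant `a_*`. -/
def aStar (n : ℕ) (m β : ℝ) : ℝ :=
  2 * m * pZero n m β / (Cstar n m * (1 - m)) * (gamma1 n m β + 2 * m / (1 - m))

/-- `Φ(s) = (1+w(s))^{1/m} − 1 − w(s)/m`. -/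
def Phi (m : ℝ) (w : ℝ → ℝ) (s : ℝ) : ℝ := (1 + w s) ^ (1 / m) - 1 - w s / m

end

/-- A classical positive solution of the rescaled fast diffusion equation
`v_τ = Δ(v^m) + α v + β y·∇v` on `ℝ^n × (0,∞)`, continuous down to `τ = 0` with initial value
`v0`, and trapped between the profiles `f_{λ₁}` and `f_{λ₂}`. -/
structure IsRescaledSolution (n : ℕ) (m β α : ℝ) (flam1 flam2 : ℝ → ℝ)
    (v0 : EuclideanSpace ℝ (Fin n) → ℝ) (v : EuclideanSpace ℝ (Fin n) → ℝ → ℝ) : Prop where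
  cont : ContinuousOn (fun p : EuclideanSpace ℝ (Fin n) × ℝ => v p.1 p.2)
    ((Set.univ : Set (EuclideanSpace ℝ (Fin n))) ×ˢ Set.Ici 0)
  smooth : ContDiffOn ℝ 2 (fun p : EuclideanSpace ℝ (Fin n) × ℝ => v p.1 p.2)
    ((Set.univ : Set (EuclideanSpace ℝ (Fin n))) ×ˢ Set.Ioi 0)
  pde : ∀ y, ∀ τ : ℝ, 0 < τ →
    deriv (v y) τ =
      lap n (fun z => v z τ ^ m) y + α * v y τ + fderiv ℝ (fun z => v z τ) y (β • y)
  init : ∀ y, v y 0 = v0 y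
  sandwich : ∀ y, ∀ τ : ℝ, 0 < τ → flam1 ‖y‖ ≤ v y τ ∧ v y τ ≤ flam2 ‖y‖

theorem exponent_gap_pos {n : ℕ} {m : ℝ} (hn : 3 ≤ n) (hm1 : m < ((n : ℝ) - 2) / n) :
    0 < (n : ℝ) - 2 - n * m := by
  have hn' : (3 : ℝ) ≤ n := by exact_mod_cast hn
  rw [lt_div_iff₀ (by linarith)] at hm1
  linarith

theorem exponent_lt_one {n : ℕ} {m : ℝ} (hn : 3 ≤ n) (hm1 : m < ((n : ℝ) - 2) / n) : m < 1 := by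
  have hn' : (3 : ℝ) ≤ n := by exact_mod_cast hn
  refine hm1.trans ?_
  rw [div_lt_one (by linarith)]
  linarith

theorem CondC1.beta_pos {n : ℕ} {m β : ℝ} (hn : 3 ≤ n) (hm0 : 0 < m)
    (hm1 : m < ((n : ℝ) - 2) / n) (h : CondC1 n m β) : 0 < β := by
  have hN := exponent_gap_pos hn hm1
  rcases h with h | ⟨-, -, -, h, -⟩
  · exact lt_trans (by unfold beta1; positivity) h
  · refine lt_trans ?_ (lt_of_le_of_lt (le_max_right _ _) h)
    unfold betaE; positivity

theorem CondC1.sqrt_le_A0 {n : ℕ} {m β : ℝ} (hn : 3 ≤ n)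
    (hm1 : m < ((n : ℝ) - 2) / n) (h : CondC1 n m β) :
    √(8 * ((n : ℝ) - 2 - n * m) * (1 - m)) ≤ A0 n m β := by
  have hN := exponent_gap_pos hn hm1
  have hm := exponent_lt_one hn hm1
  unfold A0
  set N := (n : ℝ) - 2 - n * m with hNdef
  rcases h with h | ⟨-, -, -, h, -⟩
  · unfold beta1 at h
    rw [← hNdef, div_lt_iff₀ hN] at h
    apply Real.sqrt_le_iff.2
    constructor
    · nlinarith
    · have : N + 2 * (1 - m) ≤ (n : ℝ) - 2 - (n + 2) * m + 2 * β * N := by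
        rw [hNdef] at h ⊢; nlinarith
      have h2 : (N + 2 * (1 - m)) ^ 2 ≤ ((n : ℝ) - 2 - (n + 2) * m + 2 * β * N) ^ 2 := by
        apply pow_le_pow_left₀ _ this; nlinarith
      nlinarith [sq_nonneg (N - 2 * (1 - m))]
  · have h := lt_of_le_of_lt (le_max_left _ _) h
    unfold beta2 at h
    rw [← hNdef] at h
    have e : √(8 * N * (1 - m)) = 2 * N * √(2 * (1 - m) / N) := by
      rw [Real.sqrt_eq_iff_mul_self_eq (by nlinarith) (by positivity)]
      have := Real.mul_self_sqrt (show 0 ≤ 2 * (1 - m) / N by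
        apply div_nonneg <;> linarith)
      symm
      calc _ = 4 * N ^ 2 * (√(2 * (1 - m) / N) * √(2 * (1 - m) / N)) := by ring
        _ = _ := by rw [this]; field_simp; ring
    rw [e]
    have h3 := mul_lt_mul_of_pos_left h (show 0 < 2 * N by linarith)
    have e2 : 2 * N * (√(2 * (1 - m) / N) + ((↑n + 2) * m - (↑n - 2)) / (2 * N)) =
      2 * N * √(2 * (1 - m) / N) + ((↑n + 2) * m - (↑n - 2)) := by
      field_simp
    rw [e2] at h3
    linarith

theorem CondC1.A0_facts {n : ℕ} {m β : ℝ} (hn : 3 ≤ n)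
    (hm1 : m < ((n : ℝ) - 2) / n) (h : CondC1 n m β) :
    0 < A0 n m β ∧ 0 ≤ (A0 n m β) ^ 2 - 8 * ((n : ℝ) - 2 - n * m) * (1 - m) := by
  have hN := exponent_gap_pos hn hm1
  have hm : 0 < 1 - m := by linarith [exponent_lt_one hn hm1]
  have h1 := h.sqrt_le_A0 hn hm1
  have h2 : 0 < √(8 * ((n : ℝ) - 2 - n * m) * (1 - m)) := by
    apply Real.sqrt_pos.2; positivity
  refine ⟨by linarith, ?_⟩
  have := (Real.sqrt_le_iff.1 h1).2
  linarith

theorem CondC1.gamma1_root {n : ℕ} {m β : ℝ} (hn : 3 ≤ n)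
    (hm1 : m < ((n : ℝ) - 2) / n) (h : CondC1 n m β) :
    (1 - m) * (gamma1 n m β) ^ 2 - A0 n m β * gamma1 n m β + 2 * ((n : ℝ) - 2 - n * m) = 0 := by
  have hm : 0 < 1 - m := by linarith [exponent_lt_one hn hm1]
  have hS := Real.sq_sqrt (h.A0_facts hn hm1).2
  unfold gamma1
  generalize √((A0 n m β) ^ 2 - 8 * ((n : ℝ) - 2 - n * m) * (1 - m)) = S at hS ⊢
  field_simp
  linear_combination hS

theorem CondC1.gamma1_pos {n : ℕ} {m β : ℝ} (hn : 3 ≤ n)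
    (hm1 : m < ((n : ℝ) - 2) / n) (h : CondC1 n m β) : 0 < gamma1 n m β := by
  have hN := exponent_gap_pos hn hm1
  have hm : 0 < 1 - m := by linarith [exponent_lt_one hn hm1]
  obtain ⟨hA, hD⟩ := h.A0_facts hn hm1
  unfold gamma1
  apply div_pos _ (by linarith)
  rw [sub_pos, Real.sqrt_lt' hA]
  have : 0 < 8 * ((n : ℝ) - 2 - n * m) * (1 - m) := by positivity
  linarith

theorem CondC1.gamma1_lt {n : ℕ} {m β : ℝ} (hn : 3 ≤ n)
    (hm1 : m < ((n : ℝ) - 2) / n) (h : CondC1 n m β) :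
    (1 - m) * gamma1 n m β < (n : ℝ) - 2 - n * m := by
  have hN := exponent_gap_pos hn hm1
  have hm : 0 < 1 - m := by linarith [exponent_lt_one hn hm1]
  obtain ⟨hA, hD⟩ := h.A0_facts hn hm1
  have key : A0 n m β - √((A0 n m β) ^ 2 - 8 * ((n : ℝ) - 2 - n * m) * (1 - m)) <
      2 * ((n : ℝ) - 2 - n * m) := by
    rcases h with h | ⟨hn4, -, hm2, -, h⟩
    · unfold beta1 at h
      rw [div_lt_iff₀ hN] at h
      have : A0 n m β - 2 * ((n : ℝ) - 2 - n * m) <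
          √((A0 n m β) ^ 2 - 8 * ((n : ℝ) - 2 - n * m) * (1 - m)) := by
        apply Real.lt_sqrt_of_sq_lt
        have : (A0 n m β - 2 * ((n : ℝ) - 2 - n * m)) ^ 2 -
          ((A0 n m β) ^ 2 - 8 * ((n : ℝ) - 2 - n * m) * (1 - m)) =
          8 * ((n : ℝ) - 2 - n * m) * (1 - β * ((n : ℝ) - 2 - n * m)) := by
            unfold A0; ring
        nlinarith
      linarith
    · unfold beta1 at h
      rw [le_div_iff₀ hN] at h
      have hn4' : (4 : ℝ) < n := by exact_mod_cast hn4
      rw [lt_div_iff₀ (by linarith)] at hm2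
      have : A0 n m β < 2 * ((n : ℝ) - 2 - n * m) := by unfold A0; nlinarith
      have := Real.sqrt_nonneg ((A0 n m β) ^ 2 - 8 * ((n : ℝ) - 2 - n * m) * (1 - m))
      linarith
  unfold gamma1
  rw [← mul_div_assoc, div_lt_iff₀ (by linarith)]
  nlinarith

theorem CondC1.exists_barrier {n : ℕ} {m β : ℝ} (hn : 3 ≤ n)
    (hm1 : m < ((n : ℝ) - 2) / n) (h : CondC1 n m β) :
    ∃ g : ℝ, 2 ≤ g ∧ (1 - m) * g ^ 2 - A0 n m β * g + 2 * ((n : ℝ) - 2 - n * m) ≤ 0 := by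
  have hN := exponent_gap_pos hn hm1
  have hm : 0 < 1 - m := by linarith [exponent_lt_one hn hm1]
  have hr := h.gamma1_root hn hm1
  have hs := h.sqrt_le_A0 hn hm1
  rcases h with h | ⟨hn4, -, hm2, -, h⟩
  · refine ⟨2, le_rfl, ?_⟩
    unfold beta1 at h
    rw [div_lt_iff₀ hN] at h
    unfold A0
    nlinarith
  · refine ⟨gamma1 n m β, ?_, hr.le⟩
    unfold beta1 at h
    rw [le_div_iff₀ hN] at h
    have hn4' : (4 : ℝ) < n := by exact_mod_cast hn4
    rw [lt_div_iff₀ (by linarith)] at hm2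
    have h4 : 4 * (1 - m) ≤ A0 n m β := by
      refine le_trans (Real.le_sqrt_of_sq_le ?_) hs
      nlinarith
    unfold gamma1
    rw [le_div_iff₀ (by linarith)]
    have : √((A0 n m β) ^ 2 - 8 * ((n : ℝ) - 2 - n * m) * (1 - m)) ≤ A0 n m β - 4 * (1 - m) := by
      rw [Real.sqrt_le_left (by linarith)]
      have : A0 n m β ≤ ((n : ℝ) - 2 - n * m) + 2 * (1 - m) := by unfold A0; nlinarith
      nlinarith
    linarith

theorem Cstar_pos {n : ℕ} {m : ℝ} (hn : 3 ≤ n) (hm0 : 0 < m) (hm1 : m < ((n : ℝ) - 2) / n) :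
    0 < Cstar n m := by
  have hN := exponent_gap_pos hn hm1
  have hm : 0 < 1 - m := by linarith [exponent_lt_one hn hm1]
  unfold Cstar; positivity

/-- Algebraic identity behind the monotonicity of the barrier functional: with `q = r² f^(1-m) / C_*`
the zeroth order remainder is nonpositive on `0 ≤ q ≤ 1`. -/
theorem barrier_remainder_nonpos {n : ℕ} {m β α g q : ℝ} (hn : 3 ≤ n) (hm0 : 0 < m)
    (hm1 : m < ((n : ℝ) - 2) / n) (hα : α = (2 * β + 1) / (1 - m)) (hg2 : 2 ≤ g)
    (hg : (1 - m) * g ^ 2 - A0 n m β * g + 2 * ((n : ℝ) - 2 - n * m) ≤ 0)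
    (hq0 : 0 ≤ q) (hq1 : q ≤ 1) :
    -(((2 * m / (1 - m)) - g * m / (1 - m) + 2 - n) +
        q / m * (g * m / (1 - m) - β * Cstar n m)) *
        ((2 * m / (1 - m)) - g * m / (1 - m) + g * m / (1 - m) * q) +
      q * (2 * (g * m / (1 - m)) - α * Cstar n m) ≤ 0 := by
  have hm : 0 < 1 - m := by linarith [exponent_lt_one hn hm1]
  have hn' : (3 : ℝ) ≤ n := by exact_mod_cast hn
  have e : -(((2 * m / (1 - m)) - g * m / (1 - m) + 2 - n) +
        q / m * (g * m / (1 - m) - β * Cstar n m)) *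
        ((2 * m / (1 - m)) - g * m / (1 - m) + g * m / (1 - m) * q) +
      q * (2 * (g * m / (1 - m)) - α * Cstar n m) =
      (1 - q) * ((1 - q) * (-((g - 2) * m / (1 - m)) * (n - 2 + (g - 2) * m / (1 - m))) +
        q * (m / (1 - m) ^ 2 *
          ((1 - m) * g ^ 2 - A0 n m β * g + 2 * ((n : ℝ) - 2 - n * m)))) := by
    rw [hα]; unfold Cstar A0
    field_simp
    ring
  rw [e]
  apply mul_nonpos_of_nonneg_of_nonpos (by linarith)
  have h1 : 0 ≤ (g - 2) * m / (1 - m) := by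
    apply div_nonneg _ hm.le; nlinarith
  have h2 : 0 ≤ m / (1 - m) ^ 2 := by positivity
  have h3 : 0 ≤ ((g - 2) * m / (1 - m)) * (n - 2 + (g - 2) * m / (1 - m)) := by
    apply mul_nonneg h1; linarith
  have h4 := mul_nonpos_of_nonneg_of_nonpos hq0 (mul_nonpos_of_nonneg_of_nonpos h2 hg)
  nlinarith

theorem barrier_deriv_identity {n m β α κ θ C x X e Fm Fi G D fx q : ℝ} (hm : m ≠ 0) (hx : x ≠ 0)
    (hC : C ≠ 0) (h1 : fx = Fm * Fi) (h2 : G * Fi = 1) (h3 : q = x ^ 2 * Fi / C) :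
    ((n - 2 + θ - κ) * X * e + X * x * (e * ((β * C - θ) / m * (q / x)))) *
        (x * (m * G * D) + (κ - θ) * Fm + θ * (x ^ 2 * fx / C)) +
      X * x * e * ((1 * (m * G * D) + x * (-((n - 1) / x) * (m * G * D) - α * fx -
        β * x * D)) + (κ - θ) * (m * G * D) + θ * ((2 * x * fx + x ^ 2 * D) / C)) =
      X * e * Fm * (-(κ - θ + 2 - n + q / m * (θ - β * C)) * (κ - θ + θ * q) +
        q * (2 * θ - α * C)) := by
  have hFi : Fi ≠ 0 := right_ne_zero_of_mul_eq_one h2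
  have hG : G = 1 / Fi := by field_simp; linarith
  rw [h1, h3, hG]
  field_simp
  ring

namespace IsProfile

variable {n : ℕ} {m β α lam : ℝ} {f : ℝ → ℝ}

theorem continuousOn (hf : IsProfile n m β α lam f) : ContinuousOn f (Ici 0) :=
  hf.smooth.continuousOn

theorem contDiffAt (hf : IsProfile n m β α lam f) {r : ℝ} (hr : 0 < r) : ContDiffAt ℝ 2 f r :=
  hf.smooth.contDiffAt (Ici_mem_nhds hr)

theorem continuous_abs (hf : IsProfile n m β α lam f) : Continuous (fun r => f |r|) :=
  hf.continuousOn.comp_continuous _root_.continuous_abs (fun r => abs_nonneg r)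

theorem continuousOn_derivWithin (hf : IsProfile n m β α lam f) :
    ContinuousOn (derivWithin f (Ici 0)) (Ici 0) :=
  hf.smooth.continuousOn_derivWithin (uniqueDiffOn_Ici 0) (by norm_num)

theorem hasDerivAt (hf : IsProfile n m β α lam f) {r : ℝ} (hr : 0 < r) :
    HasDerivAt f (derivWithin f (Ici 0) r) r := by
  rw [derivWithin_of_mem_nhds (Ici_mem_nhds hr)]
  exact ((hf.contDiffAt hr).differentiableAt (by norm_num)).hasDerivAt

theorem hasDerivAt_rpow (hf : IsProfile n m β α lam f) {r : ℝ} (hr : 0 < r) :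
    HasDerivAt (fun s => f s ^ m) (m * f r ^ (m - 1) * derivWithin f (Ici 0) r) r := by
  have := (hf.hasDerivAt hr).rpow_const (p := m) (Or.inl (hf.pos r hr.le).ne')
  convert this using 1; ring

theorem hasDerivAt_deriv_rpow (hf : IsProfile n m β α lam f) {r : ℝ} (hr : 0 < r) :
    HasDerivAt (fun s => m * f s ^ (m - 1) * derivWithin f (Ici 0) s)
      (-(((n : ℝ) - 1) / r) * (m * f r ^ (m - 1) * derivWithin f (Ici 0) r) - α * f r -
        β * r * derivWithin f (Ici 0) r) r := by
  have h1 : ContDiffAt ℝ 2 (fun s => f s ^ m) r :=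
    (hf.contDiffAt hr).rpow_const_of_ne (hf.pos r hr.le).ne'
  have h2 : DifferentiableAt ℝ (deriv (fun s => f s ^ m)) r := by
    simpa using ((h1.fderiv_right (m := 1) (by norm_num)).differentiableAt
      (by norm_num)).clm_apply (differentiableAt_const (1 : ℝ))
  have h3 := hf.ode r hr
  have h4 : deriv (fun s => f s ^ m) =ᶠ[𝓝 r]
      (fun s => m * f s ^ (m - 1) * derivWithin f (Ici 0) s) := by
    filter_upwards [Ioi_mem_nhds hr] with s hs using (hf.hasDerivAt_rpow hs).deriv
  have h5 := h2.hasDerivAt.congr_of_eventuallyEq h4.symm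
  rw [(hf.hasDerivAt_rpow hr).deriv, (hf.hasDerivAt hr).deriv] at h3
  have h6 : deriv (deriv fun s => f s ^ m) r =
      -(((n : ℝ) - 1) / r) * (m * f r ^ (m - 1) * derivWithin f (Ici 0) r) - α * f r -
        β * r * derivWithin f (Ici 0) r := by linear_combination h3
  rwa [h6] at h5

/-- As long as `r² f^(1-m) ≤ C_*`, the logarithmic slope of `f^m` lies below the barrier. -/
theorem barrier (hf : IsProfile n m β α lam f) (hn : 3 ≤ n) (hm0 : 0 < m)
    (hm1 : m < ((n : ℝ) - 2) / n) (hα : α = (2 * β + 1) / (1 - m)) {g : ℝ} (hg2 : 2 ≤ g)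
    (hg : (1 - m) * g ^ 2 - A0 n m β * g + 2 * ((n : ℝ) - 2 - n * m) ≤ 0) {R : ℝ} (hR : 0 < R)
    (hq : ∀ r ∈ Icc 0 R, r ^ 2 * f r ^ (1 - m) ≤ Cstar n m) {r : ℝ} (hr : r ∈ Ioc 0 R) :
    r * (m * f r ^ (m - 1) * derivWithin f (Ici 0) r) +
      (2 * m / (1 - m) - g * m / (1 - m)) * f r ^ m +
      g * m / (1 - m) * (r ^ 2 * f r / Cstar n m) ≤ 0 := by
  have hm : 0 < 1 - m := by linarith [exponent_lt_one hn hm1]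
  have hn' : (3 : ℝ) ≤ n := by exact_mod_cast hn
  have hC := Cstar_pos hn hm0 hm1
  set C := Cstar n m with hCdef
  set d := derivWithin f (Ici 0) with hd
  set κ := 2 * m / (1 - m) with hκ
  set θ := g * m / (1 - m) with hθ
  have hθκ : κ ≤ θ := by
    rw [hκ, hθ]; gcongr
  let E : ℝ → ℝ := fun r => r * (m * f r ^ (m - 1) * d r) + (κ - θ) * f r ^ m +
    θ * (r ^ 2 * f r / C)
  let h : ℝ → ℝ := fun r => r * f |r| ^ (1 - m) / C
  have hcont : Continuous h := by
    have h1 : Continuous fun r => f |r| ^ (1 - m) :=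
      hf.continuous_abs.rpow_const fun x => Or.inl (hf.pos _ (abs_nonneg x)).ne'
    fun_prop
  let Q : ℝ → ℝ := fun r => ∫ s in (0 : ℝ)..r, h s
  have hQ : ∀ r, HasDerivAt Q (h r) r := fun r =>
    (hcont.integral_hasStrictDerivAt 0 r).hasDerivAt
  let p : ℝ := n - 2 + θ - κ
  have hp : 0 < p := by simp only [p]; linarith
  let c : ℝ := (β * C - θ) / m
  let M : ℝ → ℝ := fun r => r ^ p * Real.exp (c * Q r) * E r
  have hfm : ∀ e : ℝ, ContinuousOn (fun r => f r ^ e) (Ici 0) := fun e =>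
    hf.continuousOn.rpow_const fun x hx => Or.inl (hf.pos _ hx).ne'
  have hMc : ContinuousOn M (Icc 0 R) := by
    have hsub : Icc 0 R ⊆ Ici (0 : ℝ) := Icc_subset_Ici_self
    have hEc : ContinuousOn E (Ici 0) := by
      have a1 := hfm (m - 1)
      have a2 := hfm m
      have a3 := hf.continuousOn_derivWithin
      have a4 := hf.continuousOn
      fun_prop
    have hQc : Continuous Q := continuous_iff_continuousAt.2 fun r => (hQ r).continuousAt
    have : Continuous fun r : ℝ => r ^ p * Real.exp (c * Q r) := by
      have : Continuous fun r : ℝ => r ^ p := Real.continuous_rpow_const hp.le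
      fun_prop
    exact this.continuousOn.mul (hEc.mono hsub)
  have hanti : AntitoneOn M (Icc 0 R) := by
    apply antitoneOn_of_deriv_nonpos (convex_Icc 0 R) hMc
    · intro x hx
      rw [interior_Icc] at hx
      have hx0 := hx.1
      have b1 := hf.hasDerivAt_rpow hx0
      have b2 := hf.hasDerivAt_deriv_rpow hx0
      have b3 := hf.hasDerivAt hx0
      have b4 := hQ x
      have b5 : HasDerivAt (fun r : ℝ => r ^ p) (p * x ^ (p - 1)) x :=
        Real.hasDerivAt_rpow_const (Or.inl hx0.ne')
      exact ((b5.mul (b4.const_mul c).exp).mul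
        ((((hasDerivAt_id x).mul b2).add (b1.const_mul (κ - θ))).add
          (((((hasDerivAt_id x).pow 2).mul b3).div_const C).const_mul θ))).differentiableAt.differentiableWithinAt
    · intro x hx
      rw [interior_Icc] at hx
      have hx0 := hx.1
      have b1 := hf.hasDerivAt_rpow hx0
      have b2 := hf.hasDerivAt_deriv_rpow hx0
      have b3 := hf.hasDerivAt hx0
      have b4 := hQ x
      have b5 : HasDerivAt (fun r : ℝ => r ^ p) (p * x ^ (p - 1)) x :=
        Real.hasDerivAt_rpow_const (Or.inl hx0.ne')
      have hall := ((b5.mul (b4.const_mul c).exp).mul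
        ((((hasDerivAt_id x).mul b2).add (b1.const_mul (κ - θ))).add
          (((((hasDerivAt_id x).pow 2).mul b3).div_const C).const_mul θ)))
      have hMd : deriv M x = _ := hall.deriv
      rw [hMd]
      set q : ℝ := x ^ 2 * f x ^ (1 - m) / C with hqdef
      have hfx := hf.pos x hx0.le
      have hq0 : 0 ≤ q := by positivity
      have hq1 : q ≤ 1 := (div_le_one hC).2 (hq x ⟨hx0.le, hx.2.le⟩)
      have hrem := barrier_remainder_nonpos hn hm0 hm1 hα hg2 hg hq0 hq1
      have hF : 0 < f x ^ m := by positivity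
      have e1 : f x = f x ^ m * f x ^ (1 - m) := by
        rw [← Real.rpow_add hfx]; simp
      have e2 : f x ^ (m - 1) * f x ^ (1 - m) = 1 := by
        rw [← Real.rpow_add hfx]; simp
      have e3 : x ^ p = x ^ (p - 1) * x := by
        rw [Real.rpow_sub_one hx0.ne']; field_simp
      have e4 : h x = q / x := by
        simp only [h, hqdef, abs_of_pos hx0]; field_simp
      have := barrier_deriv_identity (n := (n : ℝ)) (β := β) (α := α) (κ := κ) (θ := θ)
        (X := x ^ (p - 1)) (e := Real.exp (c * Q x)) (D := d x) hm0.ne' hx0.ne' hC.ne' e1 e2 hqdef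
      have h0 : x ^ (p - 1) * Real.exp (c * Q x) * f x ^ m *
        (-(κ - θ + 2 - ↑n + q / m * (θ - β * C)) * (κ - θ + θ * q) +
            q * (2 * θ - α * C)) ≤ 0 :=
        mul_nonpos_of_nonneg_of_nonpos (by positivity) hrem
      rw [← this] at h0
      refine le_of_eq_of_le ?_ h0
      rw [e4, e3]
      simp only [Pi.mul_apply, Pi.add_apply, Pi.pow_apply, id, e3, p, c, d]
      push_cast
      ring
  have hM0 : M 0 = 0 := by simp [M, Real.zero_rpow hp.ne']
  have hMr := hanti (left_mem_Icc.2 hR.le) (Ioc_subset_Icc_self hr) hr.1.le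
  rw [hM0] at hMr
  have hpos : 0 < r ^ p * Real.exp (c * Q r) := mul_pos (Real.rpow_pos_of_pos hr.1 _) (Real.exp_pos _)
  by_contra! hcon
  have : 0 < M r := mul_pos hpos hcon
  linarith

end IsProfile

namespace IsProfile

variable {n : ℕ} {m β α lam : ℝ} {f : ℝ → ℝ}

/-- In the regime (C1) every profile lies strictly below the singular profile. -/
theorem sq_mul_rpow_lt (hf : IsProfile n m β α lam f) (hn : 3 ≤ n) (hm0 : 0 < m)
    (hm1 : m < ((n : ℝ) - 2) / n) (hα : α = (2 * β + 1) / (1 - m)) (hC1 : CondC1 n m β)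
    {r : ℝ} (hr : 0 ≤ r) : r ^ 2 * f r ^ (1 - m) < Cstar n m := by
  have hm : 0 < 1 - m := by linarith [exponent_lt_one hn hm1]
  have hC := Cstar_pos hn hm0 hm1
  obtain ⟨g, hg2, hg⟩ := hC1.exists_barrier hn hm1
  by_contra! hcon
  let P : ℝ → ℝ := fun r => r ^ 2 * f r ^ (1 - m)
  have hPc : ContinuousOn P (Ici 0) := by
    have : ContinuousOn (fun r => f r ^ (1 - m)) (Ici 0) :=
      hf.continuousOn.rpow_const fun x hx => Or.inl (hf.pos _ hx).ne'
    exact (continuous_pow 2).continuousOn.mul this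
  have hsub : Icc 0 r ⊆ Ici (0 : ℝ) := Icc_subset_Ici_self
  let S : Set ℝ := Icc 0 r ∩ P ⁻¹' {Cstar n m}
  have hScompact : IsCompact S :=
    isCompact_Icc.of_isClosed_subset
      ((hPc.mono hsub).preimage_isClosed_of_isClosed isClosed_Icc isClosed_singleton)
      inter_subset_left
  have hSne : S.Nonempty := by
    have h0 : P 0 ≤ Cstar n m := by simp [P, hC.le]
    obtain ⟨x, hx, hxe⟩ := intermediate_value_Icc hr (hPc.mono hsub) ⟨h0, hcon⟩
    exact ⟨x, hx, hxe⟩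
  obtain ⟨R, ⟨hRmem, hRe⟩, hRleast⟩ := hScompact.exists_isLeast hSne
  have hRe : P R = Cstar n m := hRe
  have hRpos : 0 < R := by
    rcases hRmem.1.eq_or_lt with h | h
    · rw [← h] at hRe; simp [P] at hRe; linarith
    · exact h
  have hlt : ∀ x ∈ Ico 0 R, P x < Cstar n m := by
    intro x hx
    by_contra! hge
    have h0 : P 0 ≤ Cstar n m := by simp [P, hC.le]
    obtain ⟨y, hy, hye⟩ := intermediate_value_Icc hx.1
      (hPc.mono Icc_subset_Ici_self) ⟨h0, hge⟩
    have : R ≤ y := hRleast ⟨⟨hy.1, hy.2.trans (hx.2.le.trans hRmem.2)⟩, hye⟩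
    linarith [hy.2, hx.2]
  have hle : ∀ x ∈ Icc 0 R, x ^ 2 * f x ^ (1 - m) ≤ Cstar n m := by
    intro x hx
    rcases hx.2.eq_or_lt with h | h
    · rw [h]; exact hRe.le
    · exact (hlt x ⟨hx.1, h⟩).le
  let d := derivWithin f (Ici 0)
  let K : ℝ := g / (R / 2)
  let G : ℝ → ℝ := fun x => (Cstar n m - P x) * Real.exp (K * x)
  have hGd : ∀ x, 0 < x → HasDerivAt G (-(2 * x * f x ^ (1 - m) +
      x ^ 2 * (d x * (1 - m) * f x ^ (1 - m - 1))) * Real.exp (K * x) +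
      (Cstar n m - P x) * (Real.exp (K * x) * K)) x := by
    intro x hx
    have h1 := (hf.hasDerivAt hx).rpow_const (p := 1 - m) (Or.inl (hf.pos _ hx.le).ne')
    have h2 : HasDerivAt P (2 * x * f x ^ (1 - m) +
      x ^ 2 * (d x * (1 - m) * f x ^ (1 - m - 1))) x := by
      have := ((hasDerivAt_id x).pow 2).mul h1
      refine this.congr_deriv ?_
      simp [d]
    have h3 : HasDerivAt (fun x => Real.exp (K * x)) (Real.exp (K * x) * K) x := by
      simpa using ((hasDerivAt_id x).const_mul K).exp
    exact (h2.const_sub _).mul h3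
  have hmono : MonotoneOn G (Icc (R / 2) R) := by
    apply monotoneOn_of_deriv_nonneg (convex_Icc _ _)
    · intro x hx
      exact (hGd x (by linarith [hx.1])).continuousAt.continuousWithinAt
    · intro x hx
      rw [interior_Icc] at hx
      exact (hGd x (by linarith [hx.1])).differentiableAt.differentiableWithinAt
    · intro x hx
      rw [interior_Icc] at hx
      have hx0 : 0 < x := by linarith [hx.1]
      rw [(hGd x hx0).deriv]
      have hfx := hf.pos x hx0.le
      have hb := hf.barrier hn hm0 hm1 hα hg2 hg hRpos hle ⟨hx0, hx.2.le⟩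
      have hPx := hlt x ⟨hx0.le, hx.2⟩
      have e1 : f x ^ m = f x ^ (m - 1) * f x := by
        rw [Real.rpow_sub_one hfx.ne']; field_simp
      have e2 : f x ^ (1 - m - 1) = f x ^ (1 - m) / f x := Real.rpow_sub_one hfx.ne' _
      have e3 : f x ^ (m - 1) * f x ^ (1 - m) = 1 := by
        rw [← Real.rpow_add hfx]; simp
      have key : 2 * x * f x ^ (1 - m) + x ^ 2 * (d x * (1 - m) * f x ^ (1 - m - 1)) ≤
          g / x * (P x / Cstar n m) * (Cstar n m - P x) := by
        have h4 := mul_le_mul_of_nonneg_left hb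
          (show 0 ≤ (1 - m) / m * (x * f x ^ (1 - m) * f x ^ (1 - m) / f x) by positivity)
        rw [mul_zero] at h4
        have : 2 * x * f x ^ (1 - m) + x ^ 2 * (d x * (1 - m) * f x ^ (1 - m - 1)) -
          g / x * (P x / Cstar n m) * (Cstar n m - P x) =
          (1 - m) / m * (x * f x ^ (1 - m) * f x ^ (1 - m) / f x) *
            (x * (m * f x ^ (m - 1) * derivWithin f (Ici 0) x) +
      (2 * m / (1 - m) - g * m / (1 - m)) * f x ^ m +
      g * m / (1 - m) * (x ^ 2 * f x / Cstar n m)) := by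
          rw [e1, e2]
          simp only [P, d]
          generalize f x ^ (1 - m) = A at *
          have hA : A ≠ 0 := right_ne_zero_of_mul_eq_one e3
          have hG : f x ^ (m - 1) = 1 / A := by field_simp; linarith
          rw [hG]
          field_simp
          ring
        linarith
      have hP0 : 0 ≤ P x := by positivity
      have h5 : g / x * (P x / Cstar n m) ≤ K := by
        have : P x / Cstar n m ≤ 1 := (div_le_one hC).2 hPx.le
        have h6 : g / x ≤ K := by
          simp only [K]
          gcongr
          exact hx.1.le
        calc _ ≤ g / x * 1 := by gcongr
          _ ≤ K := by linarith
      have h7 : g / x * (P x / Cstar n m) * (Cstar n m - P x) ≤ K * (Cstar n m - P x) :=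
        mul_le_mul_of_nonneg_right h5 (by linarith)
      have := Real.exp_pos (K * x)
      nlinarith
  have h8 := hmono (left_mem_Icc.2 (by linarith)) (right_mem_Icc.2 (by linarith))
    (by linarith : R / 2 ≤ R)
  have h9 : 0 < G (R / 2) :=
    mul_pos (sub_pos.2 (hlt _ ⟨by linarith, by linarith⟩)) (Real.exp_pos _)
  have h10 : G R = 0 := by simp [G, hRe]
  linarith

theorem exists_upper (hf : IsProfile n m β α lam f) (hn : 3 ≤ n) (hm0 : 0 < m)
    (hm1 : m < ((n : ℝ) - 2) / n) (hα : α = (2 * β + 1) / (1 - m)) (hC1 : CondC1 n m β) :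
    ∃ F : ℝ, 0 < F ∧ ∀ r, 0 ≤ r → f r ≤ F := by
  have hm : 0 < 1 - m := by linarith [exponent_lt_one hn hm1]
  have hC := Cstar_pos hn hm0 hm1
  obtain ⟨B, hB⟩ := (isCompact_Icc (a := (0 : ℝ)) (b := 1)).exists_bound_of_continuousOn
    (hf.continuousOn.mono Icc_subset_Ici_self)
  refine ⟨max B (Cstar n m ^ (1 / (1 - m))), lt_max_of_lt_right (by positivity), fun r hr => ?_⟩
  rcases le_total r 1 with h | h
  · exact le_max_of_le_left ((le_abs_self _).trans (hB r ⟨hr, h⟩))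
  · apply le_max_of_le_right
    have h1 := hf.sq_mul_rpow_lt hn hm0 hm1 hα hC1 hr
    have hfr := hf.pos r hr
    have h2 : f r ^ (1 - m) ≤ Cstar n m := by
      have h3 : 0 < f r ^ (1 - m) := by positivity
      have h4 : 1 ≤ r ^ 2 := one_le_pow₀ h
      nlinarith
    calc f r = (f r ^ (1 - m)) ^ (1 / (1 - m)) := by
          rw [← Real.rpow_mul hfr.le]; field_simp; simp
      _ ≤ _ := by gcongr

theorem exists_lower (hf : IsProfile n m β α lam f) (hn : 3 ≤ n) (hm0 : 0 < m)
    (hm1 : m < ((n : ℝ) - 2) / n) :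
    ∃ A : ℝ, 0 < A ∧ ∀ r, 0 ≤ r → m * f r ^ (m - 1) ≤ A * (1 + r ^ 2) := by
  have hm : 0 < 1 - m := by linarith [exponent_lt_one hn hm1]
  have hC := Cstar_pos hn hm0 hm1
  have h1 : ∀ᶠ r in atTop, Cstar n m / 2 < r ^ 2 * f r ^ (1 - m) :=
    hf.asymp.eventually (lt_mem_nhds (by linarith))
  obtain ⟨R, hR⟩ := eventually_atTop.1 h1
  have hcont : ContinuousOn (fun r => f r ^ (m - 1)) (Ici 0) :=
    hf.continuousOn.rpow_const fun x hx => Or.inl (hf.pos _ hx).ne'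
  obtain ⟨B, hB⟩ := (isCompact_Icc (a := (0 : ℝ)) (b := R)).exists_bound_of_continuousOn
    (hcont.mono Icc_subset_Ici_self)
  refine ⟨max (m * B) (m * (2 / Cstar n m)), lt_max_of_lt_right (by positivity), fun r hr => ?_⟩
  have hfr := hf.pos r hr
  rcases le_total r R with h | h
  · have h2 := (le_abs_self _).trans (hB r ⟨hr, h⟩)
    calc m * f r ^ (m - 1) ≤ m * B := by gcongr
      _ ≤ max (m * B) (m * (2 / Cstar n m)) := le_max_left _ _
      _ ≤ max (m * B) (m * (2 / Cstar n m)) * (1 + r ^ 2) := by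
        apply le_mul_of_one_le_right
        · exact le_max_of_le_right (by positivity)
        · nlinarith
  · have h2 := hR r h
    have e : f r ^ (m - 1) = (f r ^ (1 - m))⁻¹ := by
      rw [← Real.rpow_neg hfr.le]; ring_nf
    have hpos : 0 < f r ^ (1 - m) := by positivity
    calc m * f r ^ (m - 1) ≤ m * (2 / Cstar n m * r ^ 2) := by
          gcongr
          rw [e, inv_le_iff_one_le_mul₀ hpos]
          rw [div_lt_iff₀ (by norm_num)] at h2
          rw [div_mul_eq_mul_div, div_mul_eq_mul_div, le_div_iff₀ hC]
          nlinarith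
      _ ≤ (m * (2 / Cstar n m)) * (1 + r ^ 2) := by
          have : 0 < m * (2 / Cstar n m) := by positivity
          nlinarith
      _ ≤ _ := by
          gcongr
          exact le_max_right _ _

end IsProfile

/-- A smooth approximation of the absolute value. -/
noncomputable def softAbs (e x : ℝ) : ℝ := √(x ^ 2 + e ^ 2)

/-- The derivative of `softAbs`, a smooth approximation of the sign function. -/
noncomputable def softSign (e x : ℝ) : ℝ := x / √(x ^ 2 + e ^ 2)

theorem softAbs_pos {e : ℝ} (he : 0 < e) (x : ℝ) : 0 < √(x ^ 2 + e ^ 2) :=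
  Real.sqrt_pos.2 (by positivity)

theorem hasDerivAt_softAbs {e : ℝ} (he : 0 < e) (x : ℝ) :
    HasDerivAt (softAbs e) (softSign e x) x := by
  have h : HasDerivAt (fun x : ℝ => x ^ 2 + e ^ 2) (2 * x) x := by
    simpa using ((hasDerivAt_id x).pow 2).add_const (e ^ 2)
  have h2 := h.sqrt (by positivity)
  refine h2.congr_deriv ?_
  unfold softSign
  have := softAbs_pos he x
  field_simp

theorem hasDerivAt_softSign {e : ℝ} (he : 0 < e) (x : ℝ) :
    HasDerivAt (softSign e) (e ^ 2 / √(x ^ 2 + e ^ 2) ^ 3) x := by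
  have h := (hasDerivAt_id x).div (hasDerivAt_softAbs he x) (softAbs_pos he x).ne'
  refine h.congr_deriv ?_
  have h2 := Real.sq_sqrt (show 0 ≤ x ^ 2 + e ^ 2 by positivity)
  have := softAbs_pos he x
  unfold softSign softAbs
  simp only [id]
  field_simp
  linear_combination h2

theorem contDiff_softAbs {e : ℝ} (he : 0 < e) {k : WithTop ℕ∞} : ContDiff ℝ k (softAbs e) := by
  unfold softAbs
  exact ContDiff.sqrt (by fun_prop) fun x => by positivity

theorem continuous_softSign {e : ℝ} (he : 0 < e) : Continuous (softSign e) :=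
  continuous_iff_continuousAt.2 fun x => (hasDerivAt_softSign he x).continuousAt

theorem abs_softSign_le {e : ℝ} (he : 0 < e) (x : ℝ) : |softSign e x| ≤ 1 := by
  unfold softSign
  have := softAbs_pos he x
  rw [abs_div, abs_of_pos this, div_le_one this]
  apply Real.abs_le_sqrt; nlinarith

theorem softAbs_nonneg (e x : ℝ) : 0 ≤ softAbs e x := Real.sqrt_nonneg _

theorem softAbs_le {e : ℝ} (he : 0 < e) (x : ℝ) : softAbs e x ≤ |x| + e := by
  unfold softAbs
  rw [Real.sqrt_le_left (by positivity)]
  nlinarith [sq_abs x, abs_nonneg x]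

theorem tendsto_softAbs (x : ℝ) : Tendsto (fun e => softAbs e x) (𝓝[>] 0) (𝓝 |x|) := by
  have : Continuous fun e => softAbs e x := by unfold softAbs; fun_prop
  have h := this.tendsto 0
  simp only [softAbs] at h ⊢
  simp only [ne_eq, OfNat.ofNat_ne_zero, not_false_eq_true, zero_pow, add_zero,
    Real.sqrt_sq_eq_abs] at h
  exact h.mono_left nhdsWithin_le_nhds

theorem tendsto_softSign (x : ℝ) :
    Tendsto (fun e => softSign e x) (𝓝[>] 0) (𝓝 (x / |x|)) := by
  rcases eq_or_ne x 0 with rfl | hx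
  · simp [softSign]
  · exact tendsto_const_nhds.div (tendsto_softAbs x) (abs_ne_zero.2 hx)

section Laplacian

variable {n : ℕ}

theorem integral_mul_fderiv_of_hasCompactSupport {g ψ : EuclideanSpace ℝ (Fin n) → ℝ}
    (hg : ContDiff ℝ 1 g) (hψ : ContDiff ℝ 1 ψ) (hc : HasCompactSupport ψ)
    (e : EuclideanSpace ℝ (Fin n)) :
    ∫ y, g y * fderiv ℝ ψ y e = -∫ y, fderiv ℝ g y e * ψ y := by
  have hg' : Continuous fun y => fderiv ℝ g y e :=
    (hg.continuous_fderiv (by norm_num)).clm_apply continuous_const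
  have hψ' : Continuous fun y => fderiv ℝ ψ y e :=
    (hψ.continuous_fderiv (by norm_num)).clm_apply continuous_const
  apply integral_mul_fderiv_eq_neg_fderiv_mul_of_integrable
  · exact (hg'.mul hψ.continuous).integrable_of_hasCompactSupport hc.mul_left
  · exact (hg.continuous.mul hψ').integrable_of_hasCompactSupport (hc.fderiv_apply ℝ e).mul_left
  · exact (hg.continuous.mul hψ.continuous).integrable_of_hasCompactSupport hc.mul_left
  · exact fun x _ => hg.differentiable (by norm_num) x
  · exact fun x _ => hψ.differentiable (by norm_num) x

theorem contDiff_fderiv_apply {g : EuclideanSpace ℝ (Fin n) → ℝ} (hg : ContDiff ℝ 2 g)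
    (e : EuclideanSpace ℝ (Fin n)) : ContDiff ℝ 1 fun y => fderiv ℝ g y e :=
  (hg.fderiv_right (m := 1) (by norm_num)).clm_apply contDiff_const

theorem continuous_lap {g : EuclideanSpace ℝ (Fin n) → ℝ} (hg : ContDiff ℝ 2 g) :
    Continuous (lap n g) := by
  unfold lap
  refine continuous_finsetSum _ fun i _ => ?_
  exact ((contDiff_fderiv_apply hg _).continuous_fderiv (by norm_num)).clm_apply continuous_const

theorem lap_eq_zero_of_notMem_tsupport {ψ : EuclideanSpace ℝ (Fin n) → ℝ}
    {y : EuclideanSpace ℝ (Fin n)} (hy : y ∉ tsupport ψ) : lap n ψ y = 0 := by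
  unfold lap
  refine Finset.sum_eq_zero fun i _ => ?_
  have h1 : ψ =ᶠ[𝓝 y] 0 := notMem_tsupport_iff_eventuallyEq.1 hy
  have h2 : (fun z => fderiv ℝ ψ z (EuclideanSpace.single i (1 : ℝ))) =ᶠ[𝓝 y] fun _ => 0 := by
    filter_upwards [h1.fderiv (𝕜 := ℝ)] with z hz
    rw [hz]; simp
  rw [h2.fderiv_eq]; simp

theorem hasCompactSupport_lap {ψ : EuclideanSpace ℝ (Fin n) → ℝ} (hc : HasCompactSupport ψ) :
    HasCompactSupport (lap n ψ) :=
  HasCompactSupport.intro hc fun _ hy => lap_eq_zero_of_notMem_tsupport hy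

/-- Green's identity against a compactly supported test function. -/
theorem integral_lap_mul {g ψ : EuclideanSpace ℝ (Fin n) → ℝ}
    (hg : ContDiff ℝ 2 g) (hψ : ContDiff ℝ 2 ψ) (hc : HasCompactSupport ψ) :
    ∫ y, lap n g y * ψ y = ∫ y, g y * lap n ψ y := by
  unfold lap
  simp only [Finset.sum_mul, Finset.mul_sum]
  rw [integral_finsetSum, integral_finsetSum]
  · refine Finset.sum_congr rfl fun i _ => ?_
    set e := EuclideanSpace.single i (1 : ℝ)
    have h1 := integral_mul_fderiv_of_hasCompactSupport (contDiff_fderiv_apply hg e)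
      (hψ.of_le (by norm_num)) hc e
    have h2 := integral_mul_fderiv_of_hasCompactSupport (hg.of_le (by norm_num))
      (contDiff_fderiv_apply hψ e) (hc.fderiv_apply ℝ e) e
    linarith
  · intro i _
    set e := EuclideanSpace.single i (1 : ℝ)
    exact (hg.continuous.mul (((contDiff_fderiv_apply hψ e).continuous_fderiv
      (by norm_num)).clm_apply continuous_const)).integrable_of_hasCompactSupport
      ((hc.fderiv_apply ℝ e).fderiv_apply ℝ e).mul_left
  · intro i _
    set e := EuclideanSpace.single i (1 : ℝ)
    exact ((((contDiff_fderiv_apply hg e).continuous_fderiv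
      (by norm_num)).clm_apply continuous_const).mul hψ.continuous).integrable_of_hasCompactSupport
      hc.mul_left

theorem softSign_mul_lap_le {W : EuclideanSpace ℝ (Fin n) → ℝ} (hW : ContDiff ℝ 2 W) {e : ℝ}
    (he : 0 < e) (y : EuclideanSpace ℝ (Fin n)) :
    softSign e (W y) * lap n W y ≤ lap n (fun z => softAbs e (W z)) y := by
  unfold lap
  rw [Finset.mul_sum]
  refine Finset.sum_le_sum fun i _ => ?_
  set v := EuclideanSpace.single i (1 : ℝ)
  have hWd : ∀ z, HasFDerivAt W (fderiv ℝ W z) z := fun z =>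
    (hW.differentiable (by norm_num) z).hasFDerivAt
  have h1 : (fun z => fderiv ℝ (fun z => softAbs e (W z)) z v) =
      fun z => softSign e (W z) * fderiv ℝ W z v := by
    funext z
    have := (hasDerivAt_softAbs he (W z)).comp_hasFDerivAt z (hWd z)
    rw [show (fun z => softAbs e (W z)) = softAbs e ∘ W from rfl, this.fderiv]
    simp
  rw [h1]
  have h2 : HasFDerivAt (fun z => fderiv ℝ W z v) (fderiv ℝ (fun z => fderiv ℝ W z v) y) y :=
    ((contDiff_fderiv_apply hW v).differentiable (by norm_num) y).hasFDerivAt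
  have h3 := (hasDerivAt_softSign he (W y)).comp_hasFDerivAt y (hWd y)
  have h4 := (h3.mul h2).fderiv
  have h5 : fderiv ℝ (fun z => softSign e (W z) * fderiv ℝ W z v) y v =
    softSign e (W y) * fderiv ℝ (fun z => fderiv ℝ W z v) y v +
      fderiv ℝ W y v * (e ^ 2 / √(W y ^ 2 + e ^ 2) ^ 3 * fderiv ℝ W y v) := by
    rw [show (fun z => softSign e (W z) * fderiv ℝ W z v) =
      (softSign e ∘ W) * (fun z => fderiv ℝ W z v) from rfl, h4]
    simp
  rw [h5]
  have : 0 ≤ e ^ 2 / √(W y ^ 2 + e ^ 2) ^ 3 := by positivity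
  nlinarith [mul_nonneg this (sq_nonneg (fderiv ℝ W y v))]

/-- Smooth form of Kato's inequality. -/
theorem integral_softSign_mul_lap_mul_le {W ψ : EuclideanSpace ℝ (Fin n) → ℝ}
    (hW : ContDiff ℝ 2 W) (hψ : ContDiff ℝ 2 ψ) (hc : HasCompactSupport ψ) (hψ0 : ∀ y, 0 ≤ ψ y)
    {e : ℝ} (he : 0 < e) :
    ∫ y, softSign e (W y) * lap n W y * ψ y ≤ ∫ y, softAbs e (W y) * lap n ψ y := by
  have hA : ContDiff ℝ 2 fun z => softAbs e (W z) := (contDiff_softAbs he).comp hW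
  rw [← integral_lap_mul hA hψ hc]
  apply integral_mono
  · exact ((((continuous_softSign he).comp hW.continuous).mul (continuous_lap hW)).mul
      hψ.continuous).integrable_of_hasCompactSupport hc.mul_left
  · exact ((continuous_lap hA).mul hψ.continuous).integrable_of_hasCompactSupport hc.mul_left
  · intro y
    exact mul_le_mul_of_nonneg_right (softSign_mul_lap_le hW he y) (hψ0 y)

theorem fderiv_apply_eq_sum (h : EuclideanSpace ℝ (Fin n) → ℝ) (y z : EuclideanSpace ℝ (Fin n)) :
    fderiv ℝ h y z = ∑ i, z i * fderiv ℝ h y (EuclideanSpace.single i (1 : ℝ)) := by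
  conv_lhs => rw [← (EuclideanSpace.basisFun (Fin n) ℝ).sum_repr z]
  simp only [map_sum, map_smul, smul_eq_mul, EuclideanSpace.basisFun_repr,
    EuclideanSpace.basisFun_apply]

theorem contDiff_coord (i : Fin n) : ContDiff ℝ 1 fun y : EuclideanSpace ℝ (Fin n) => y i :=
  (EuclideanSpace.proj (𝕜 := ℝ) i : EuclideanSpace ℝ (Fin n) →L[ℝ] ℝ).contDiff

theorem fderiv_coord_mul {ψ : EuclideanSpace ℝ (Fin n) → ℝ} (hψ : ContDiff ℝ 1 ψ) (i : Fin n)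
    (y : EuclideanSpace ℝ (Fin n)) :
    fderiv ℝ (fun y : EuclideanSpace ℝ (Fin n) => y i * ψ y) y (EuclideanSpace.single i (1 : ℝ)) =
      ψ y + y i * fderiv ℝ ψ y (EuclideanSpace.single i (1 : ℝ)) := by
  have h1 : HasFDerivAt (fun y : EuclideanSpace ℝ (Fin n) => y i)
    (EuclideanSpace.proj (𝕜 := ℝ) i : EuclideanSpace ℝ (Fin n) →L[ℝ] ℝ) y :=
    (EuclideanSpace.proj (𝕜 := ℝ) i : EuclideanSpace ℝ (Fin n) →L[ℝ] ℝ).hasFDerivAt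
  have h2 := (hψ.differentiable (by norm_num) y).hasFDerivAt
  rw [show (fun y : EuclideanSpace ℝ (Fin n) => y i * ψ y) =
    (fun y : EuclideanSpace ℝ (Fin n) => y i) * ψ from rfl, (h1.mul h2).fderiv]
  simp
  ring

/-- Integration by parts for the Euler vector field. -/
theorem integral_euler_mul {g ψ : EuclideanSpace ℝ (Fin n) → ℝ}
    (hg : ContDiff ℝ 1 g) (hψ : ContDiff ℝ 1 ψ) (hc : HasCompactSupport ψ) :
    ∫ y, fderiv ℝ g y y * ψ y = -∫ y, g y * (n * ψ y + fderiv ℝ ψ y y) := by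
  have hstep : ∀ i : Fin n, ∫ y, fderiv ℝ g y (EuclideanSpace.single i (1 : ℝ)) * (y i * ψ y) =
      -∫ y, g y * (ψ y + y i * fderiv ℝ ψ y (EuclideanSpace.single i (1 : ℝ))) := by
    intro i
    rw [eq_neg_iff_add_eq_zero, add_comm, ← eq_neg_iff_add_eq_zero]
    have := integral_mul_fderiv_of_hasCompactSupport hg ((contDiff_coord i).mul hψ)
      (hc.mul_left (f := fun y : EuclideanSpace ℝ (Fin n) => y i)) (EuclideanSpace.single i (1 : ℝ))
    simpa only [fderiv_coord_mul hψ] using this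
  have hd : ∀ {h : EuclideanSpace ℝ (Fin n) → ℝ}, ContDiff ℝ 1 h → ∀ i,
      Continuous fun y => fderiv ℝ h y (EuclideanSpace.single i (1 : ℝ)) := fun hh i =>
    (hh.continuous_fderiv (by norm_num)).clm_apply continuous_const
  have e1 : ∀ y, fderiv ℝ g y y * ψ y =
      ∑ i, fderiv ℝ g y (EuclideanSpace.single i (1 : ℝ)) * (y i * ψ y) := fun y => by
    rw [fderiv_apply_eq_sum, Finset.sum_mul]
    exact Finset.sum_congr rfl fun i _ => by ring
  have e2 : ∀ y, g y * (n * ψ y + fderiv ℝ ψ y y) =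
      ∑ i, g y * (ψ y + y i * fderiv ℝ ψ y (EuclideanSpace.single i (1 : ℝ))) := fun y => by
    rw [fderiv_apply_eq_sum ψ, ← Finset.mul_sum, Finset.sum_add_distrib]
    simp
  simp only [e1, e2]
  rw [integral_finsetSum, integral_finsetSum, ← Finset.sum_neg_distrib]
  · exact Finset.sum_congr rfl fun i _ => hstep i
  · intro i _
    refine (hg.continuous.mul (hψ.continuous.add ((contDiff_coord i).continuous.mul
      (hd hψ i)))).integrable_of_hasCompactSupport ?_
    exact (hc.add (hc.fderiv_apply ℝ _).mul_left).mul_left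
  · intro i _
    exact ((hd hg i).mul ((contDiff_coord i).continuous.mul
      hψ.continuous)).integrable_of_hasCompactSupport hc.mul_left.mul_left

end Laplacian

/-- Lebesgue measure on the space-time slab `(s, t] × ℝⁿ`. -/
noncomputable abbrev slab (n : ℕ) (s t : ℝ) : Measure (ℝ × EuclideanSpace ℝ (Fin n)) :=
  (volume.restrict (Ioc s t)).prod volume

theorem slab_eq_restrict (n : ℕ) (s t : ℝ) :
    slab n s t = (volume : Measure (ℝ × EuclideanSpace ℝ (Fin n))).restrict (Ioc s t ×ˢ univ) := by
  rw [Measure.volume_eq_prod, ← Measure.prod_restrict, Measure.restrict_univ]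

theorem integrable_slab_of_continuousOn {n : ℕ} {s t : ℝ} {g : ℝ × EuclideanSpace ℝ (Fin n) → ℝ}
    {K : Set (EuclideanSpace ℝ (Fin n))} (hK : IsCompact K)
    (hg : ContinuousOn g (Icc s t ×ˢ univ)) (h0 : ∀ p, p.2 ∉ K → g p = 0) :
    Integrable g (slab n s t) := by
  rw [slab_eq_restrict]
  have h1 : IntegrableOn g (Icc s t ×ˢ K) :=
    (hg.mono (prod_mono_right (subset_univ K))).integrableOn_compact (isCompact_Icc.prod hK)
  have h2 : IntegrableOn g (Icc s t ×ˢ univ) := by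
    refine h1.of_forall_sdiff_eq_zero (measurableSet_Icc.prod MeasurableSet.univ) ?_
    rintro ⟨τ, y⟩ hp
    refine h0 _ fun hy => hp.2 ⟨hp.1.1, hy⟩
  exact h2.mono_set (prod_mono_left Ioc_subset_Icc_self)

theorem integral_add_add_const_mul_add {X : Type*} [MeasurableSpace X] {μ : Measure X}
    {a b c d : X → ℝ} (ha : Integrable a μ) (hb : Integrable b μ) (hc : Integrable c μ)
    (hd : Integrable d μ) (r : ℝ) :
    ∫ x, (a x + b x + r * c x + d x) ∂μ =
      (∫ x, a x ∂μ) + (∫ x, b x ∂μ) + r * (∫ x, c x ∂μ) + ∫ x, d x ∂μ := by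
  rw [integral_add (f := fun x => a x + b x + r * c x) ((ha.add hb).add (hc.const_mul r)) hd,
    integral_add (f := fun x => a x + b x) (ha.add hb) (hc.const_mul r), integral_add ha hb,
    integral_const_mul]

/-- A difference `w` of two solutions of the rescaled equation, together with the difference `W` of
their `m`-th powers. -/
structure IsDifferencePair (n : ℕ) (α β : ℝ) (w W : ℝ → EuclideanSpace ℝ (Fin n) → ℝ) : Prop where
  continuous_left : Continuous fun p : ℝ × EuclideanSpace ℝ (Fin n) => w p.1 p.2
  continuous_right : Continuous fun p : ℝ × EuclideanSpace ℝ (Fin n) => W p.1 p.2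
  contDiff_left : ∀ τ, 0 < τ → ContDiff ℝ 1 (w τ)
  contDiff_right : ∀ τ, 0 < τ → ContDiff ℝ 2 (W τ)
  hasDerivAt : ∀ y τ, 0 < τ → HasDerivAt (fun τ => w τ y)
    (lap n (W τ) y + α * w τ y + β * fderiv ℝ (w τ) y y) τ
  continuousOn_lap : ContinuousOn (fun p : ℝ × EuclideanSpace ℝ (Fin n) => lap n (W p.1) p.2)
    (Ioi 0 ×ˢ univ)
  continuousOn_euler :
    ContinuousOn (fun p : ℝ × EuclideanSpace ℝ (Fin n) => fderiv ℝ (w p.1) p.2 p.2)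
      (Ioi 0 ×ˢ univ)
  sign_eq : ∀ τ y, w τ y / |w τ y| = W τ y / |W τ y|

namespace IsDifferencePair

variable {n : ℕ} {α β : ℝ} {w W : ℝ → EuclideanSpace ℝ (Fin n) → ℝ}

theorem continuous_slice (h : IsDifferencePair n α β w W) (τ : ℝ) : Continuous (w τ) :=
  h.continuous_left.comp (Continuous.prodMk_right τ)

theorem continuous_slice_right (h : IsDifferencePair n α β w W) (τ : ℝ) : Continuous (W τ) :=
  h.continuous_right.comp (Continuous.prodMk_right τ)

theorem continuous_time (h : IsDifferencePair n α β w W) (y : EuclideanSpace ℝ (Fin n)) :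
    Continuous fun τ => w τ y :=
  h.continuous_left.comp (Continuous.prodMk_left y)

/-- The time increment of the regularised weighted norm, as a space-time integral. -/
theorem integral_softAbs_sub (h : IsDifferencePair n α β w W)
    {ψ : EuclideanSpace ℝ (Fin n) → ℝ} (hψ : Continuous ψ) (hc : HasCompactSupport ψ)
    {e : ℝ} (he : 0 < e) {s t : ℝ} (hs : 0 < s) (hst : s ≤ t) :
    (∫ y, softAbs e (w t y) * ψ y) - ∫ y, softAbs e (w s y) * ψ y =
      ∫ p, softSign e (w p.1 p.2) *
        (lap n (W p.1) p.2 + α * w p.1 p.2 + β * fderiv ℝ (w p.1) p.2 p.2) * ψ p.2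
        ∂slab n s t := by
  have hcw : ContinuousOn (fun p : ℝ × EuclideanSpace ℝ (Fin n) => softSign e (w p.1 p.2) *
        (lap n (W p.1) p.2 + α * w p.1 p.2 + β * fderiv ℝ (w p.1) p.2 p.2)) (Ioi 0 ×ˢ univ) :=
    ((continuous_softSign he).comp h.continuous_left).continuousOn.mul
      ((h.continuousOn_lap.add (continuousOn_const.mul h.continuous_left.continuousOn)).add
        (continuousOn_const.mul h.continuousOn_euler))
  have hsub : Icc s t ⊆ Ioi 0 := fun x hx => lt_of_lt_of_le hs hx.1
  have hint := integrable_slab_of_continuousOn (s := s) (t := t) (g := fun p =>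
    softSign e (w p.1 p.2) *
        (lap n (W p.1) p.2 + α * w p.1 p.2 + β * fderiv ℝ (w p.1) p.2 p.2) * ψ p.2) hc
    ((hcw.mono (prod_mono_left hsub)).mul (hψ.comp continuous_snd).continuousOn)
    (fun p hp => by simp [image_eq_zero_of_notMem_tsupport hp])
  have hA : ∀ τ, Integrable fun y => softAbs e (w τ y) * ψ y := fun τ =>
    (((contDiff_softAbs he (k := 0)).continuous.comp (h.continuous_slice τ)).mul
      hψ).integrable_of_hasCompactSupport hc.mul_left
  rw [integral_prod_symm _ hint, ← integral_sub (hA t) (hA s)]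
  congr 1
  funext y
  rw [← sub_mul]
  refine Eq.trans ?_ (integral_mul_const (ψ y) fun τ => softSign e (w τ y) *
    (lap n (W τ) y + α * w τ y + β * fderiv ℝ (w τ) y y)).symm
  congr 1
  rw [← intervalIntegral.integral_of_le hst]
  symm
  refine intervalIntegral.integral_eq_sub_of_hasDerivAt (f := fun τ => softAbs e (w τ y)) ?_ ?_
  · intro τ hτ
    rw [uIcc_of_le hst] at hτ
    exact HasDerivAt.comp (h₂ := softAbs e) τ (hasDerivAt_softAbs he (w τ y))
      (h.hasDerivAt y τ (hsub hτ))
  · apply ContinuousOn.intervalIntegrable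
    rw [uIcc_of_le hst]
    exact hcw.comp (Continuous.prodMk_left y).continuousOn fun τ hτ => ⟨hsub hτ, mem_univ _⟩

/-- The regularised space-time density bounding the increment of the weighted norm. -/
noncomputable def density (n : ℕ) (α β : ℝ) (w W : ℝ → EuclideanSpace ℝ (Fin n) → ℝ)
    (ψ : EuclideanSpace ℝ (Fin n) → ℝ) (e : ℝ) (p : ℝ × EuclideanSpace ℝ (Fin n)) : ℝ :=
  softAbs e (W p.1 p.2) * lap n ψ p.2 + α * softSign e (w p.1 p.2) * w p.1 p.2 * ψ p.2 -
    β * softAbs e (w p.1 p.2) * (n * ψ p.2 + fderiv ℝ ψ p.2 p.2) +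
    (softSign e (w p.1 p.2) - softSign e (W p.1 p.2)) * lap n (W p.1) p.2 * ψ p.2

theorem continuous_euler {ψ : EuclideanSpace ℝ (Fin n) → ℝ} (hψ : ContDiff ℝ 2 ψ) :
    Continuous fun y => fderiv ℝ ψ y y :=
  (hψ.continuous_fderiv (by norm_num)).clm_apply continuous_id

theorem euler_eq_zero {ψ : EuclideanSpace ℝ (Fin n) → ℝ} {y : EuclideanSpace ℝ (Fin n)}
    (hy : y ∉ tsupport ψ) : fderiv ℝ ψ y y = 0 := by
  rw [(notMem_tsupport_iff_eventuallyEq.1 hy).fderiv_eq]; simp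

theorem continuousOn_density (h : IsDifferencePair n α β w W)
    {ψ : EuclideanSpace ℝ (Fin n) → ℝ} (hψ : ContDiff ℝ 2 ψ) {e : ℝ} (he : 0 < e) :
    ContinuousOn (density n α β w W ψ e) (Ioi 0 ×ˢ univ) := by
  have h1 := (contDiff_softAbs he (k := 0)).continuous.comp h.continuous_right
  have h2 := (contDiff_softAbs he (k := 0)).continuous.comp h.continuous_left
  have h3 := (continuous_softSign he).comp h.continuous_right
  have h4 := (continuous_softSign he).comp h.continuous_left
  have h5 := (continuous_lap hψ).comp (continuous_snd (X := ℝ))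
  have h6 := (continuous_euler hψ).comp (continuous_snd (X := ℝ))
  have h7 := hψ.continuous.comp (continuous_snd (X := ℝ))
  refine ContinuousOn.add (Continuous.continuousOn ?_)
    (((h4.sub h3).continuousOn.mul h.continuousOn_lap).mul h7.continuousOn)
  exact ((h1.mul h5).add (((continuous_const.mul h4).mul h.continuous_left).mul h7)).sub
    ((continuous_const.mul h2).mul ((continuous_const.mul h7).add h6))

theorem integral_softAbs_sub_le (h : IsDifferencePair n α β w W)
    {ψ : EuclideanSpace ℝ (Fin n) → ℝ} (hψ : ContDiff ℝ 2 ψ) (hc : HasCompactSupport ψ)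
    (hψ0 : ∀ y, 0 ≤ ψ y) {e : ℝ} (he : 0 < e) {s t : ℝ} (hs : 0 < s) (hst : s ≤ t) :
    (∫ y, softAbs e (w t y) * ψ y) - ∫ y, softAbs e (w s y) * ψ y ≤
      ∫ p, density n α β w W ψ e p ∂slab n s t := by
  have hsub : Icc s t ⊆ Ioi 0 := fun x hx => lt_of_lt_of_le hs hx.1
  have hcw : ContinuousOn (fun p : ℝ × EuclideanSpace ℝ (Fin n) => softSign e (w p.1 p.2) *
        (lap n (W p.1) p.2 + α * w p.1 p.2 + β * fderiv ℝ (w p.1) p.2 p.2)) (Ioi 0 ×ˢ univ) :=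
    ((continuous_softSign he).comp h.continuous_left).continuousOn.mul
      ((h.continuousOn_lap.add (continuousOn_const.mul h.continuous_left.continuousOn)).add
        (continuousOn_const.mul h.continuousOn_euler))
  have hint := integrable_slab_of_continuousOn (s := s) (t := t) (g := fun p =>
    softSign e (w p.1 p.2) *
        (lap n (W p.1) p.2 + α * w p.1 p.2 + β * fderiv ℝ (w p.1) p.2 p.2) * ψ p.2) hc
    ((hcw.mono (prod_mono_left hsub)).mul (hψ.continuous.comp continuous_snd).continuousOn)
    (fun p hp => by simp [image_eq_zero_of_notMem_tsupport hp])
  have hdint := integrable_slab_of_continuousOn (s := s) (t := t) hc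
    ((h.continuousOn_density hψ he).mono (prod_mono_left hsub)) (fun p hp => by
      simp [density, image_eq_zero_of_notMem_tsupport hp, euler_eq_zero hp,
        lap_eq_zero_of_notMem_tsupport hp])
  rw [h.integral_softAbs_sub hψ.continuous hc he hs hst, integral_prod _ hint, integral_prod _ hdint]
  refine integral_mono_ae hint.integral_prod_left hdint.integral_prod_left ?_
  filter_upwards [ae_restrict_mem measurableSet_Ioc] with τ hτ
  have hτ0 : 0 < τ := hsub (Ioc_subset_Icc_self hτ)
  have cw := h.continuous_slice τ
  have cW := h.continuous_slice_right τ
  have cL := continuous_lap (h.contDiff_right τ hτ0)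
  have csw := (continuous_softSign he).comp cw
  have csW := (continuous_softSign he).comp cW
  have caw := (contDiff_softAbs he (k := 0)).continuous.comp cw
  have caW := (contDiff_softAbs he (k := 0)).continuous.comp cW
  have cD : Continuous fun y => fderiv ℝ (w τ) y y :=
    ((h.contDiff_left τ hτ0).continuous_fderiv (by norm_num)).clm_apply continuous_id
  have i1 : Integrable fun y => softSign e (W τ y) * lap n (W τ) y * ψ y :=
    ((csW.mul cL).mul hψ.continuous).integrable_of_hasCompactSupport hc.mul_left
  have i2 : Integrable fun y => α * softSign e (w τ y) * w τ y * ψ y :=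
    (((continuous_const.mul csw).mul cw).mul hψ.continuous).integrable_of_hasCompactSupport
      hc.mul_left
  have i3 : Integrable fun y => softSign e (w τ y) * fderiv ℝ (w τ) y y * ψ y :=
    ((csw.mul cD).mul hψ.continuous).integrable_of_hasCompactSupport hc.mul_left
  have i4 : Integrable fun y =>
      (softSign e (w τ y) - softSign e (W τ y)) * lap n (W τ) y * ψ y :=
    (((csw.sub csW).mul cL).mul hψ.continuous).integrable_of_hasCompactSupport hc.mul_left
  have i5 : Integrable fun y => softAbs e (W τ y) * lap n ψ y :=
    (caW.mul (continuous_lap hψ)).integrable_of_hasCompactSupport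
      (hasCompactSupport_lap hc).mul_left
  have i6 : Integrable fun y => softAbs e (w τ y) * (n * ψ y + fderiv ℝ ψ y y) :=
    (caw.mul ((continuous_const.mul hψ.continuous).add
      (continuous_euler hψ))).integrable_of_hasCompactSupport
      (HasCompactSupport.intro hc fun y hy => by
        simp [image_eq_zero_of_notMem_tsupport hy, euler_eq_zero hy])
  have k1 := integral_softSign_mul_lap_mul_le (h.contDiff_right τ hτ0) hψ hc hψ0 he
  have k2 : ∫ y, softSign e (w τ y) * fderiv ℝ (w τ) y y * ψ y =
      -∫ y, softAbs e (w τ y) * (n * ψ y + fderiv ℝ ψ y y) := by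
    refine Eq.trans ?_ (integral_euler_mul ((contDiff_softAbs he).comp (h.contDiff_left τ hτ0))
      (hψ.of_le (by norm_num)) hc)
    congr 1
    funext y
    have := (hasDerivAt_softAbs he (w τ y)).comp_hasFDerivAt y
      ((h.contDiff_left τ hτ0).differentiable (by norm_num) y).hasFDerivAt
    rw [show fderiv ℝ (fun y => softAbs e (w τ y)) y = _ from this.fderiv]
    simp
  have e1 : ∫ y, softSign e (w τ y) *
        (lap n (W τ) y + α * w τ y + β * fderiv ℝ (w τ) y y) * ψ y =
      (∫ y, softSign e (W τ y) * lap n (W τ) y * ψ y) +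
      (∫ y, α * softSign e (w τ y) * w τ y * ψ y) +
      β * (∫ y, softSign e (w τ y) * fderiv ℝ (w τ) y y * ψ y) +
      ∫ y, (softSign e (w τ y) - softSign e (W τ y)) * lap n (W τ) y * ψ y := by
    rw [← integral_add_add_const_mul_add i1 i2 i3 i4]
    congr 1
    funext y
    ring
  have e2 : ∫ y, density n α β w W ψ e (τ, y) =
      (∫ y, softAbs e (W τ y) * lap n ψ y) + (∫ y, α * softSign e (w τ y) * w τ y * ψ y) -
      β * (∫ y, softAbs e (w τ y) * (n * ψ y + fderiv ℝ ψ y y)) +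
      ∫ y, (softSign e (w τ y) - softSign e (W τ y)) * lap n (W τ) y * ψ y := by
    rw [sub_eq_add_neg, ← neg_mul, ← integral_add_add_const_mul_add i5 i2 i6 i4]
    congr 1
    funext y
    simp only [density]
    ring
  rw [e1, e2, k2]
  linarith

/-- The space-time density in the weighted Kato inequality. -/
noncomputable def katoDensity (n : ℕ) (α β : ℝ) (w W : ℝ → EuclideanSpace ℝ (Fin n) → ℝ)
    (ψ : EuclideanSpace ℝ (Fin n) → ℝ) (p : ℝ × EuclideanSpace ℝ (Fin n)) : ℝ :=
  |W p.1 p.2| * lap n ψ p.2 + |w p.1 p.2| * ((α - n * β) * ψ p.2 - β * fderiv ℝ ψ p.2 p.2)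

theorem tendsto_density (h : IsDifferencePair n α β w W)
    (ψ : EuclideanSpace ℝ (Fin n) → ℝ) (p : ℝ × EuclideanSpace ℝ (Fin n)) :
    Tendsto (fun e => density n α β w W ψ e p) (𝓝[>] 0) (𝓝 (katoDensity n α β w W ψ p)) := by
  have h1 := tendsto_softAbs (W p.1 p.2)
  have h2 := tendsto_softAbs (w p.1 p.2)
  have h3 := tendsto_softSign (W p.1 p.2)
  have h4 := tendsto_softSign (w p.1 p.2)
  have h5 := (((h1.mul_const (lap n ψ p.2)).add (((h4.const_mul α).mul_const (w p.1 p.2)).mul_const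
    (ψ p.2))).sub ((h2.const_mul β).mul_const (n * ψ p.2 + fderiv ℝ ψ p.2 p.2))).add
    (((h4.sub h3).mul_const (lap n (W p.1) p.2)).mul_const (ψ p.2))
  have : w p.1 p.2 / |w p.1 p.2| * w p.1 p.2 = |w p.1 p.2| := by
    rcases eq_or_ne (w p.1 p.2) 0 with h0 | h0
    · simp [h0]
    · rw [div_mul_eq_mul_div, div_eq_iff (abs_ne_zero.2 h0), abs_mul_abs_self]
  rw [show katoDensity n α β w W ψ p =
    |W p.1 p.2| * lap n ψ p.2 + α * (w p.1 p.2 / |w p.1 p.2|) * w p.1 p.2 * ψ p.2 -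
      β * |w p.1 p.2| * (↑n * ψ p.2 + (fderiv ℝ ψ p.2) p.2) +
      (w p.1 p.2 / |w p.1 p.2| - W p.1 p.2 / |W p.1 p.2|) * lap n (W p.1) p.2 * ψ p.2 by
    rw [← h.sign_eq, sub_self]
    unfold katoDensity
    linear_combination (-α * ψ p.2) * this]
  exact h5

theorem abs_density_le {ψ : EuclideanSpace ℝ (Fin n) → ℝ} {e : ℝ} (he : 0 < e) (he1 : e ≤ 1)
    (p : ℝ × EuclideanSpace ℝ (Fin n)) :
    |density n α β w W ψ e p| ≤ (|W p.1 p.2| + 1) * |lap n ψ p.2| +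
      |α| * |w p.1 p.2| * |ψ p.2| +
      |β| * (|w p.1 p.2| + 1) * |n * ψ p.2 + fderiv ℝ ψ p.2 p.2| +
      2 * |lap n (W p.1) p.2| * |ψ p.2| := by
  have h1 : |softAbs e (W p.1 p.2)| ≤ |W p.1 p.2| + 1 := by
    rw [abs_of_nonneg (softAbs_nonneg _ _)]
    linarith [softAbs_le he (W p.1 p.2)]
  have h2 : |softAbs e (w p.1 p.2)| ≤ |w p.1 p.2| + 1 := by
    rw [abs_of_nonneg (softAbs_nonneg _ _)]
    linarith [softAbs_le he (w p.1 p.2)]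
  have h3 : |softSign e (w p.1 p.2) - softSign e (W p.1 p.2)| ≤ 2 := by
    refine (abs_sub _ _).trans ?_
    linarith [abs_softSign_le he (w p.1 p.2), abs_softSign_le he (W p.1 p.2)]
  have h4 := abs_softSign_le he (w p.1 p.2)
  unfold density
  refine (abs_add_le _ _).trans (add_le_add ((abs_sub _ _).trans (add_le_add
    ((abs_add_le _ _).trans (add_le_add ?_ ?_)) ?_)) ?_)
  · rw [abs_mul]; gcongr
  · rw [abs_mul, abs_mul, abs_mul]
    have : |α| * |softSign e (w p.1 p.2)| ≤ |α| := mul_le_of_le_one_right (abs_nonneg _) h4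
    gcongr
  · rw [abs_mul, abs_mul]; gcongr
  · rw [abs_mul, abs_mul]; gcongr

theorem continuous_katoDensity (h : IsDifferencePair n α β w W)
    {ψ : EuclideanSpace ℝ (Fin n) → ℝ} (hψ : ContDiff ℝ 2 ψ) :
    Continuous (katoDensity n α β w W ψ) := by
  have h5 := (continuous_lap hψ).comp (continuous_snd (X := ℝ))
  have h6 := (continuous_euler hψ).comp (continuous_snd (X := ℝ))
  have h7 := hψ.continuous.comp (continuous_snd (X := ℝ))
  exact (h.continuous_right.abs.mul h5).add (h.continuous_left.abs.mul
    ((continuous_const.mul h7).sub (continuous_const.mul h6)))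

theorem katoDensity_eq_zero {ψ : EuclideanSpace ℝ (Fin n) → ℝ}
    (p : ℝ × EuclideanSpace ℝ (Fin n)) (hp : p.2 ∉ tsupport ψ) :
    katoDensity n α β w W ψ p = 0 := by
  simp [katoDensity, image_eq_zero_of_notMem_tsupport hp, euler_eq_zero hp,
        lap_eq_zero_of_notMem_tsupport hp]

theorem tendsto_integral_softAbs_mul {g ψ : EuclideanSpace ℝ (Fin n) → ℝ} (hg : Continuous g)
    (hψ : Continuous ψ) (hc : HasCompactSupport ψ) :
    Tendsto (fun e => ∫ y, softAbs e (g y) * ψ y) (𝓝[>] 0) (𝓝 (∫ y, |g y| * ψ y)) := by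
  refine tendsto_integral_filter_of_dominated_convergence (fun y => (|g y| + 1) * |ψ y|) ?_ ?_ ?_ ?_
  · filter_upwards [self_mem_nhdsWithin] with e he
    exact (((contDiff_softAbs he (k := 0)).continuous.comp hg).mul hψ).aestronglyMeasurable
  · filter_upwards [Ioc_mem_nhdsGT (zero_lt_one' ℝ)] with e he
    refine Eventually.of_forall fun y => ?_
    rw [Real.norm_eq_abs, abs_mul, abs_of_nonneg (softAbs_nonneg _ _)]
    gcongr
    exact (softAbs_le he.1 _).trans (by linarith [he.2])
  · exact ((hg.abs.add continuous_const).mul hψ.abs).integrable_of_hasCompactSupport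
      hc.abs.mul_left
  · exact Eventually.of_forall fun y => (tendsto_softAbs (g y)).mul_const _

theorem integral_abs_mul_sub_le_of_pos (h : IsDifferencePair n α β w W)
    {ψ : EuclideanSpace ℝ (Fin n) → ℝ} (hψ : ContDiff ℝ 2 ψ) (hc : HasCompactSupport ψ)
    (hψ0 : ∀ y, 0 ≤ ψ y) {s t : ℝ} (hs : 0 < s) (hst : s ≤ t) :
    (∫ y, |w t y| * ψ y) - ∫ y, |w s y| * ψ y ≤
      ∫ p, katoDensity n α β w W ψ p ∂slab n s t := by
  have hsub : Icc s t ⊆ Ioi 0 := fun x hx => lt_of_lt_of_le hs hx.1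
  have hlim := (tendsto_integral_softAbs_mul (h.continuous_slice t) hψ.continuous hc).sub
    (tendsto_integral_softAbs_mul (h.continuous_slice s) hψ.continuous hc)
  have hdint : ∀ e, 0 < e → Integrable (density n α β w W ψ e) (slab n s t) := fun e he =>
    integrable_slab_of_continuousOn (s := s) (t := t) hc
    ((h.continuousOn_density hψ he).mono (prod_mono_left hsub)) (fun p hp => by
      simp [density, image_eq_zero_of_notMem_tsupport hp, euler_eq_zero hp,
        lap_eq_zero_of_notMem_tsupport hp])
  have hlim2 : Tendsto (fun e => ∫ p, density n α β w W ψ e p ∂slab n s t) (𝓝[>] 0)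
      (𝓝 (∫ p, katoDensity n α β w W ψ p ∂slab n s t)) := by
    refine tendsto_integral_filter_of_dominated_convergence (fun p =>
      (|W p.1 p.2| + 1) * |lap n ψ p.2| + |α| * |w p.1 p.2| * |ψ p.2| +
      |β| * (|w p.1 p.2| + 1) * |n * ψ p.2 + fderiv ℝ ψ p.2 p.2| +
      2 * |lap n (W p.1) p.2| * |ψ p.2|) ?_ ?_ ?_ ?_
    · filter_upwards [self_mem_nhdsWithin] with e he
      exact (hdint e he).aestronglyMeasurable
    · filter_upwards [Ioc_mem_nhdsGT (zero_lt_one' ℝ)] with e he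
      exact Eventually.of_forall fun p => abs_density_le he.1 he.2 p
    · have h5 := (continuous_lap hψ).comp (continuous_snd (X := ℝ))
      have h6 := (continuous_euler hψ).comp (continuous_snd (X := ℝ))
      have h7 := hψ.continuous.comp (continuous_snd (X := ℝ))
      refine integrable_slab_of_continuousOn hc ?_ fun p hp => by
        simp [image_eq_zero_of_notMem_tsupport hp, euler_eq_zero hp,
          lap_eq_zero_of_notMem_tsupport hp]
      refine ContinuousOn.add (Continuous.continuousOn ?_) ((continuousOn_const.mul
        (h.continuousOn_lap.mono (prod_mono_left hsub)).abs).mul h7.abs.continuousOn)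
      exact (((h.continuous_right.abs.add continuous_const).mul h5.abs).add
        ((continuous_const.mul h.continuous_left.abs).mul h7.abs)).add
        ((continuous_const.mul (h.continuous_left.abs.add continuous_const)).mul
          ((continuous_const.mul h7).add h6).abs)
    · exact Eventually.of_forall fun p => h.tendsto_density ψ p
  refine le_of_tendsto_of_tendsto hlim hlim2 ?_
  filter_upwards [self_mem_nhdsWithin] with e he
  exact h.integral_softAbs_sub_le hψ hc hψ0 he hs hst

/-- Weighted Kato inequality for the difference of two solutions. -/
theorem integral_abs_mul_sub_le (h : IsDifferencePair n α β w W)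
    {ψ : EuclideanSpace ℝ (Fin n) → ℝ} (hψ : ContDiff ℝ 2 ψ) (hc : HasCompactSupport ψ)
    (hψ0 : ∀ y, 0 ≤ ψ y) {s t : ℝ} (hs : 0 ≤ s) (hst : s ≤ t) :
    (∫ y, |w t y| * ψ y) - ∫ y, |w s y| * ψ y ≤
      ∫ p, katoDensity n α β w W ψ p ∂slab n s t := by
  have hk : Continuous fun τ => ∫ y, katoDensity n α β w W ψ (τ, y) := by
    rw [← continuousOn_univ]
    exact continuousOn_integral_of_compact_support (k := tsupport ψ) hc
      (h.continuous_katoDensity hψ).continuousOn fun τ y _ hy => katoDensity_eq_zero (τ, y) hy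
  have hΦ : Continuous fun τ => ∫ y, |w τ y| * ψ y := by
    rw [← continuousOn_univ]
    refine continuousOn_integral_of_compact_support (k := tsupport ψ) hc
      (Continuous.continuousOn ?_) fun τ y _ hy => by simp [image_eq_zero_of_notMem_tsupport hy]
    exact h.continuous_left.abs.mul (hψ.continuous.comp continuous_snd)
  have hprod : ∀ s ≤ t, ∫ p, katoDensity n α β w W ψ p ∂slab n s t =
      ∫ τ in s..t, ∫ y, katoDensity n α β w W ψ (τ, y) := fun s hst => by
    rw [integral_prod _ (integrable_slab_of_continuousOn hc
      (h.continuous_katoDensity hψ).continuousOn katoDensity_eq_zero),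
      intervalIntegral.integral_of_le hst]
  rcases hst.eq_or_lt with rfl | hlt
  · rw [hprod s le_rfl]
    simp
  rw [hprod s hst]
  have hP : Continuous fun s => ∫ τ in s..t, ∫ y, katoDensity n α β w W ψ (τ, y) := by
    simp_rw [intervalIntegral.integral_symm t]
    exact (intervalIntegral.continuous_primitive (fun a b => hk.intervalIntegrable a b) t).neg
  have l1 : Tendsto (fun s => (∫ y, |w t y| * ψ y) - ∫ y, |w s y| * ψ y) (𝓝[>] s) _ :=
    ((continuous_const.sub hΦ).tendsto s).mono_left nhdsWithin_le_nhds
  have l2 := (hP.tendsto s).mono_left (nhdsWithin_le_nhds (s := Ioi s))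
  refine le_of_tendsto_of_tendsto l1 l2 ?_
  filter_upwards [Ioo_mem_nhdsGT hlt] with s' hs'
  rw [← hprod s' hs'.2.le]
  exact h.integral_abs_mul_sub_le_of_pos hψ hc hψ0 (hs.trans_lt hs'.1) hs'.2.le

end IsDifferencePair

section Radial

variable {n : ℕ} {G G1 G2 : ℝ → ℝ}

theorem hasFDerivAt_radial (hG : ∀ s, 0 ≤ s → HasDerivAt G (G1 s) s)
    (y : EuclideanSpace ℝ (Fin n)) :
    HasFDerivAt (fun z : EuclideanSpace ℝ (Fin n) => G (‖z‖ ^ 2))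
      (G1 (‖y‖ ^ 2) • (2 • innerSL ℝ y)) y :=
  HasDerivAt.comp_hasFDerivAt (h₂ := G) y (hG _ (sq_nonneg _)) (hasStrictFDerivAt_norm_sq y).hasFDerivAt

theorem fderiv_radial (hG : ∀ s, 0 ≤ s → HasDerivAt G (G1 s) s)
    (y z : EuclideanSpace ℝ (Fin n)) :
    fderiv ℝ (fun z : EuclideanSpace ℝ (Fin n) => G (‖z‖ ^ 2)) y z =
      2 * G1 (‖y‖ ^ 2) * inner ℝ y z := by
  rw [(hasFDerivAt_radial hG y).fderiv]
  simp
  ring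

theorem lap_radial (hG : ∀ s, 0 ≤ s → HasDerivAt G (G1 s) s)
    (hG1 : ∀ s, 0 ≤ s → HasDerivAt G1 (G2 s) s) (y : EuclideanSpace ℝ (Fin n)) :
    lap n (fun z => G (‖z‖ ^ 2)) y = 4 * ‖y‖ ^ 2 * G2 (‖y‖ ^ 2) + 2 * n * G1 (‖y‖ ^ 2) := by
  unfold lap
  simp only [fderiv_radial hG, EuclideanSpace.inner_single_right]
  have h : ∀ i : Fin n, fderiv ℝ (fun z : EuclideanSpace ℝ (Fin n) =>
      2 * G1 (‖z‖ ^ 2) * (1 * z i)) y (EuclideanSpace.single i (1 : ℝ)) =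
      4 * G2 (‖y‖ ^ 2) * y i ^ 2 + 2 * G1 (‖y‖ ^ 2) := by
    intro i
    have h1 : HasFDerivAt (fun y : EuclideanSpace ℝ (Fin n) => y i)
      (EuclideanSpace.proj (𝕜 := ℝ) i : EuclideanSpace ℝ (Fin n) →L[ℝ] ℝ) y :=
      (EuclideanSpace.proj (𝕜 := ℝ) i : EuclideanSpace ℝ (Fin n) →L[ℝ] ℝ).hasFDerivAt
    have h2 := ((hasFDerivAt_radial hG1 y).const_mul 2).mul (h1.const_mul 1)
    rw [show fderiv ℝ (fun z : EuclideanSpace ℝ (Fin n) =>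
      2 * G1 (‖z‖ ^ 2) * (1 * z i)) y = _ from h2.fderiv]
    simp [EuclideanSpace.inner_single_right]
    ring
  simp only [conj_trivial, h]
  rw [Finset.sum_add_distrib, ← Finset.mul_sum, EuclideanSpace.real_norm_sq_eq]
  simp
  ring

end Radial

/-- A smooth cutoff equal to `1` on `(-∞, 1]` and to `0` on `[2, ∞)`. -/
noncomputable def cutoff (s : ℝ) : ℝ := Real.smoothTransition (2 - s)

theorem contDiff_cutoff : ContDiff ℝ 2 cutoff :=
  Real.smoothTransition.contDiff.comp (contDiff_const.sub contDiff_id)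

theorem cutoff_nonneg (s : ℝ) : 0 ≤ cutoff s := Real.smoothTransition.nonneg _

theorem cutoff_le_one (s : ℝ) : cutoff s ≤ 1 := Real.smoothTransition.le_one _

theorem cutoff_eq_one {s : ℝ} (hs : s ≤ 1) : cutoff s = 1 :=
  Real.smoothTransition.one_of_one_le (by linarith)

theorem cutoff_eq_zero {s : ℝ} (hs : 2 ≤ s) : cutoff s = 0 :=
  Real.smoothTransition.zero_of_nonpos (by linarith)

theorem deriv_cutoff_eq_zero {s : ℝ} (hs : s ∉ Icc (1 : ℝ) 2) : deriv cutoff s = 0 := by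
  rcases not_and_or.1 hs with h | h
  · have : cutoff =ᶠ[𝓝 s] fun _ => 1 := by
      filter_upwards [gt_mem_nhds (not_le.1 h)] with x hx using cutoff_eq_one hx.le
    rw [this.deriv_eq, deriv_const]
  · have : cutoff =ᶠ[𝓝 s] fun _ => 0 := by
      filter_upwards [lt_mem_nhds (not_le.1 h)] with x hx using cutoff_eq_zero hx.le
    rw [this.deriv_eq, deriv_const]

theorem deriv_deriv_cutoff_eq_zero {s : ℝ} (hs : s ∉ Icc (1 : ℝ) 2) :
    deriv (deriv cutoff) s = 0 := by
  have : deriv cutoff =ᶠ[𝓝 s] fun _ => 0 := by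
    filter_upwards [isClosed_Icc.isOpen_compl.mem_nhds hs] with x hx using deriv_cutoff_eq_zero hx
  rw [this.deriv_eq, deriv_const]

theorem contDiff_deriv_cutoff : ContDiff ℝ 1 (deriv cutoff) :=
  (contDiff_succ_iff_deriv (n := 1).1 (by norm_num; exact contDiff_cutoff)).2.2

theorem exists_cutoff_bound :
    ∃ c : ℝ, 0 ≤ c ∧ ∀ s, |deriv cutoff s| ≤ c ∧ |deriv (deriv cutoff) s| ≤ c := by
  obtain ⟨a, ha⟩ := (isCompact_Icc (a := (1 : ℝ)) (b := 2)).exists_bound_of_continuousOn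
    contDiff_deriv_cutoff.continuous.continuousOn
  obtain ⟨b, hb⟩ := (isCompact_Icc (a := (1 : ℝ)) (b := 2)).exists_bound_of_continuousOn
    (contDiff_deriv_cutoff.continuous_deriv (by norm_num)).continuousOn
  refine ⟨max 0 (max a b), le_max_left _ _, fun s => ?_⟩
  by_cases hs : s ∈ Icc (1 : ℝ) 2
  · exact ⟨(ha s hs).trans ((le_max_left _ _).trans (le_max_right _ _)),
      (hb s hs).trans ((le_max_right _ _).trans (le_max_right _ _))⟩
  · rw [deriv_cutoff_eq_zero hs, deriv_deriv_cutoff_eq_zero hs]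
    simp

theorem hasDerivAt_rescaled_cutoff (R s : ℝ) :
    HasDerivAt (fun s => cutoff (s / R ^ 2)) (deriv cutoff (s / R ^ 2) / R ^ 2) s := by
  have h := (contDiff_cutoff.differentiable (by norm_num) (s / R ^ 2)).hasDerivAt
  have h2 := HasDerivAt.comp (h₂ := cutoff) s h ((hasDerivAt_id s).div_const (R ^ 2))
  refine h2.congr_deriv ?_
  ring

theorem hasDerivAt_deriv_rescaled_cutoff (R s : ℝ) :
    HasDerivAt (fun s => deriv cutoff (s / R ^ 2) / R ^ 2)
      (deriv (deriv cutoff) (s / R ^ 2) / R ^ 4) s := by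
  have h := (contDiff_deriv_cutoff.differentiable (by norm_num) (s / R ^ 2)).hasDerivAt
  have h2 := (HasDerivAt.comp (h₂ := deriv cutoff) s h
    ((hasDerivAt_id s).div_const (R ^ 2))).div_const (R ^ 2)
  refine h2.congr_deriv ?_
  ring

theorem hasDerivAt_shift_rpow {d p s : ℝ} (hs : 0 < s + d) :
    HasDerivAt (fun s => (s + d) ^ p) (p * (s + d) ^ (p - 1)) s := by
  have := ((hasDerivAt_id s).add_const d).rpow_const (p := p) (Or.inl hs.ne')
  simpa using this

theorem kato_main_le {N κ α β g m C a s d x ω P Q P2 X : ℝ} (hκ : 0 < κ) (hN : 0 < N - 2 - 2 * κ)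
    (hβ : 0 < β) (hs : 0 ≤ s) (hd : 0 < d) (hQ : Q = (s + d) * P2) (hP : P = (s + d) * Q)
    (hP2 : 0 < P2) (hX : 0 ≤ X) (hx : 0 ≤ x) (hω' : 0 ≤ ω)
    (hω : m * g * x ≤ ω)     (ha1 : a * C = 2 * κ * (N - 2 - 2 * κ) * m) (ha2 : a = α - N * β + 2 * κ * β) :
    ω * (X * (4 * s * (κ * (κ + 1) * P2) - 2 * N * (κ * Q))) +
      x * (X * ((α - N * β) * P + 2 * β * s * (κ * Q))) ≤
    -(a * (X * (x * (P * (C * g / (s + d) - 1))))) := by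
  have hsd : 0 < s + d := by linarith
  have hQ0 : 0 < Q := by rw [hQ]; positivity
  have h1 : 4 * s * (κ * (κ + 1) * P2) - 2 * N * (κ * Q) ≤ -(2 * κ * (N - 2 - 2 * κ)) * Q := by
    rw [hQ]
    have : 0 ≤ κ * (κ + 1) * P2 * d := by positivity
    nlinarith
  have hω0 : m * g * x * Q ≤ ω * Q := mul_le_mul_of_nonneg_right hω hQ0.le
  have h2 : P * (C * g / (s + d) - 1) = C * g * Q - P := by rw [hP]; field_simp
  rw [h2]
  have h3 : ω * (4 * s * (κ * (κ + 1) * P2) - 2 * N * (κ * Q)) ≤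
      -(2 * κ * (N - 2 - 2 * κ)) * (m * g * x * Q) := by
    have := mul_le_mul_of_nonneg_left h1 hω'
    have h4 : 0 < 2 * κ * (N - 2 - 2 * κ) := by positivity
    nlinarith
  have h4 : 2 * β * s * (κ * Q) ≤ 2 * κ * β * P := by
    rw [hP]
    have : 0 ≤ β * κ * d * Q := by positivity
    nlinarith
  have h5 := mul_le_mul_of_nonneg_left h4 hx
  have h6 : ω * (4 * s * (κ * (κ + 1) * P2) - 2 * N * (κ * Q)) +
      x * ((α - N * β) * P + 2 * β * s * (κ * Q)) ≤ -(a * (x * (C * g * Q - P))) := by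
    have e1 : a * (x * (C * g * Q - P)) = (a * C) * (g * x * Q) - a * x * P := by ring
    rw [e1, ha1]
    nth_rw 1 [ha2]
    nlinarith
  have := mul_le_mul_of_nonneg_left h6 hX
  nlinarith

theorem kato_error_le {N κ β A c s d R x ω P Q X1 X2 : ℝ} (hN : 0 ≤ N) (hκ : 0 < κ)
    (hβ : 0 < β) (hA : 0 < A) (hs : 0 ≤ s) (hd : 0 < d) (hP : P = (s + d) * Q) (hQ : 0 < Q)
    (hx : 0 ≤ x) (hω' : 0 ≤ ω) (hω : ω ≤ A * (1 + s) * x) (hR : 1 ≤ R) (hsR : s ≤ 2 * R ^ 2)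
    (hX1 : |X1| ≤ c / R ^ 2) (hX2 : |X2| ≤ c / R ^ 4) :
    ω * (4 * s * (P * X2 - 2 * (κ * Q) * X1) + 2 * N * (P * X1)) - 2 * β * x * s * (P * X1) ≤
      (A * c * (24 * κ + 24 + 6 * N) + 4 * β * c) * (x * P) := by
  have hR2 : 1 ≤ R ^ 2 := one_le_pow₀ hR
  have hP0 : 0 < P := by rw [hP]; positivity
  have hsQ : s * Q ≤ P := by rw [hP]; nlinarith
  have hc1 : R ^ 2 * |X1| ≤ c := by rwa [le_div_iff₀ (by positivity), mul_comm] at hX1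
  have hc2 : R ^ 4 * |X2| ≤ c := by rwa [le_div_iff₀ (by positivity), mul_comm] at hX2
  have h1 : (1 + s) * |X1| ≤ 3 * c := by nlinarith [abs_nonneg X1]
  have h2 : (1 + s) * (s * |X2|) ≤ 6 * c := by
    have e : (1 + s) * s ≤ 6 * R ^ 4 := by nlinarith
    nlinarith [abs_nonneg X2]
  have h3 : s * |X1| ≤ 2 * c := by nlinarith [abs_nonneg X1]
  have h4 : 4 * s * (P * X2 - 2 * (κ * Q) * X1) + 2 * N * (P * X1) ≤
      P * (4 * (s * |X2|) + (8 * κ + 2 * N) * |X1|) := by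
    have a1 : s * P * X2 ≤ s * P * |X2| := mul_le_mul_of_nonneg_left (le_abs_self _) (by positivity)
    have a2 : s * Q * κ * (-X1) ≤ P * κ * |X1| := by
      refine (mul_le_mul_of_nonneg_left (neg_le_abs X1) (by positivity)).trans ?_
      gcongr
    have a3 : N * P * X1 ≤ N * P * |X1| := mul_le_mul_of_nonneg_left (le_abs_self _) (by positivity)
    linarith
  have h5 : -(2 * β * x * s * (P * X1)) ≤ 4 * β * c * (x * P) := by
    have a1 : s * -X1 ≤ 2 * c :=
      (mul_le_mul_of_nonneg_left (neg_le_abs X1) hs).trans h3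
    have := mul_le_mul_of_nonneg_left a1 (show 0 ≤ 2 * β * x * P by positivity)
    linarith
  have h6 : ω * (P * (4 * (s * |X2|) + (8 * κ + 2 * N) * |X1|)) ≤
      A * c * (24 * κ + 24 + 6 * N) * (x * P) := by
    have a0 : 0 ≤ P * (4 * (s * |X2|) + (8 * κ + 2 * N) * |X1|) := by positivity
    refine (mul_le_mul_of_nonneg_right hω a0).trans ?_
    have a1 : (1 + s) * (4 * (s * |X2|) + (8 * κ + 2 * N) * |X1|) ≤ c * (24 * κ + 24 + 6 * N) := by
      have := mul_le_mul_of_nonneg_left h1 (show 0 ≤ 8 * κ + 2 * N by positivity)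
      linarith
    have := mul_le_mul_of_nonneg_left a1 (show 0 ≤ A * x * P by positivity)
    linarith
  have := mul_le_mul_of_nonneg_left h4 hω'
  linarith

/-- The regularised and truncated power weight. -/
noncomputable def testFun (n : ℕ) (κ R d : ℝ) (y : EuclideanSpace ℝ (Fin n)) : ℝ :=
  (‖y‖ ^ 2 + d) ^ (-κ) * cutoff (‖y‖ ^ 2 / R ^ 2)

section TestFun

variable {n : ℕ} {κ R d : ℝ}

theorem testFun_nonneg (hd : 0 < d) (y : EuclideanSpace ℝ (Fin n)) : 0 ≤ testFun n κ R d y :=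
  mul_nonneg (by positivity) (cutoff_nonneg _)

theorem contDiff_testFun (hd : 0 < d) : ContDiff ℝ 2 (testFun n κ R d) := by
  unfold testFun
  refine ContDiff.mul (ContDiff.rpow_const_of_ne ((contDiff_norm_sq ℝ).add contDiff_const)
    fun y => by positivity) (contDiff_cutoff.comp ((contDiff_norm_sq ℝ).div_const _))

theorem cutoff_eq_zero_of_notMem_closedBall (hR : 0 < R) {y : EuclideanSpace ℝ (Fin n)}
    (hy : y ∉ Metric.closedBall 0 (2 * R)) : cutoff (‖y‖ ^ 2 / R ^ 2) = 0 := by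
  rw [mem_closedBall_zero_iff, not_le] at hy
  apply cutoff_eq_zero
  rw [le_div_iff₀ (by positivity)]
  nlinarith

theorem hasCompactSupport_testFun (hR : 0 < R) : HasCompactSupport (testFun n κ R d) :=
  HasCompactSupport.intro (isCompact_closedBall 0 (2 * R)) fun y hy => by
    unfold testFun
    rw [cutoff_eq_zero_of_notMem_closedBall hR hy, mul_zero]

theorem hasDerivAt_weight (hd : 0 < d) {s : ℝ} (hs : 0 ≤ s) :
    HasDerivAt (fun s => (s + d) ^ (-κ) * cutoff (s / R ^ 2))
      (-κ * (s + d) ^ (-κ - 1) * cutoff (s / R ^ 2) +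
        (s + d) ^ (-κ) * (deriv cutoff (s / R ^ 2) / R ^ 2)) s :=
  (hasDerivAt_shift_rpow (by linarith)).mul (hasDerivAt_rescaled_cutoff R s)

theorem hasDerivAt_deriv_weight (hd : 0 < d) {s : ℝ} (hs : 0 ≤ s) :
    HasDerivAt (fun s => -κ * (s + d) ^ (-κ - 1) * cutoff (s / R ^ 2) +
        (s + d) ^ (-κ) * (deriv cutoff (s / R ^ 2) / R ^ 2))
      (κ * (κ + 1) * (s + d) ^ (-κ - 2) * cutoff (s / R ^ 2) -
        2 * κ * (s + d) ^ (-κ - 1) * (deriv cutoff (s / R ^ 2) / R ^ 2) +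
        (s + d) ^ (-κ) * (deriv (deriv cutoff) (s / R ^ 2) / R ^ 4)) s := by
  have hsd : 0 < s + d := by linarith
  have h1 := ((hasDerivAt_shift_rpow (p := -κ - 1) hsd).const_mul (-κ)).mul
    (hasDerivAt_rescaled_cutoff R s)
  have h2 := (hasDerivAt_shift_rpow (p := -κ) hsd).mul (hasDerivAt_deriv_rescaled_cutoff R s)
  refine (h1.add h2).congr_deriv ?_
  rw [show -κ - 1 - 1 = -κ - 2 by ring]
  ring

theorem fderiv_testFun (hd : 0 < d) (y : EuclideanSpace ℝ (Fin n)) :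
    fderiv ℝ (testFun n κ R d) y y = 2 * ‖y‖ ^ 2 *
      (-κ * (‖y‖ ^ 2 + d) ^ (-κ - 1) * cutoff (‖y‖ ^ 2 / R ^ 2) +
        (‖y‖ ^ 2 + d) ^ (-κ) * (deriv cutoff (‖y‖ ^ 2 / R ^ 2) / R ^ 2)) := by
  have := fderiv_radial (n := n) (fun s hs => hasDerivAt_weight (κ := κ) (R := R) hd hs) y y
  rw [real_inner_self_eq_norm_sq] at this
  rw [show fderiv ℝ (testFun n κ R d) y y = _ from this]
  ring

theorem lap_testFun (hd : 0 < d) (y : EuclideanSpace ℝ (Fin n)) :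
    lap n (testFun n κ R d) y = 4 * ‖y‖ ^ 2 *
      (κ * (κ + 1) * (‖y‖ ^ 2 + d) ^ (-κ - 2) * cutoff (‖y‖ ^ 2 / R ^ 2) -
        2 * κ * (‖y‖ ^ 2 + d) ^ (-κ - 1) * (deriv cutoff (‖y‖ ^ 2 / R ^ 2) / R ^ 2) +
        (‖y‖ ^ 2 + d) ^ (-κ) * (deriv (deriv cutoff) (‖y‖ ^ 2 / R ^ 2) / R ^ 4)) + 2 * n *
      (-κ * (‖y‖ ^ 2 + d) ^ (-κ - 1) * cutoff (‖y‖ ^ 2 / R ^ 2) +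
        (‖y‖ ^ 2 + d) ^ (-κ) * (deriv cutoff (‖y‖ ^ 2 / R ^ 2) / R ^ 2)) :=
  lap_radial (fun _ hs => hasDerivAt_weight (κ := κ) (R := R) hd hs)
    (fun _ hs => hasDerivAt_deriv_weight (κ := κ) (R := R) hd hs) y

end TestFun

/-- The region where the rescaled cutoff is not constant. -/
def annulus (n : ℕ) (R : ℝ) : Set (EuclideanSpace ℝ (Fin n)) :=
  {y | R ^ 2 ≤ ‖y‖ ^ 2 ∧ ‖y‖ ^ 2 ≤ 2 * R ^ 2}

theorem isClosed_annulus (n : ℕ) (R : ℝ) : IsClosed (annulus n R) :=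
  (isClosed_le continuous_const (continuous_norm.pow 2)).inter
    (isClosed_le (continuous_norm.pow 2) continuous_const)

/-- The space-time density against the test function is a dissipation term plus an error supported
in an annulus. -/
theorem katoDensity_testFun_le {n : ℕ} {κ α β m C a A : ℝ} (hκ : 0 < κ)
    (hn : 0 < (n : ℝ) - 2 - 2 * κ) (hβ : 0 < β) (hA : 0 < A)
    (ha1 : a * C = 2 * κ * ((n : ℝ) - 2 - 2 * κ) * m) (ha2 : a = α - n * β + 2 * κ * β) :
    ∃ B : ℝ, 0 ≤ B ∧ ∀ (w W : ℝ → EuclideanSpace ℝ (Fin n) → ℝ)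
      (p : ℝ × EuclideanSpace ℝ (Fin n)) (g R d : ℝ), 1 ≤ R → 0 < d →
      m * g * |w p.1 p.2| ≤ |W p.1 p.2| → |W p.1 p.2| ≤ A * (1 + ‖p.2‖ ^ 2) * |w p.1 p.2| →
      IsDifferencePair.katoDensity n α β w W (testFun n κ R d) p ≤
        -(a * (cutoff (‖p.2‖ ^ 2 / R ^ 2) *
          (|w p.1 p.2| * ((‖p.2‖ ^ 2 + d) ^ (-κ) * (C * g / (‖p.2‖ ^ 2 + d) - 1))))) +
        B * (annulus n R).indicator (fun y => |w p.1 y| * (‖y‖ ^ 2 + d) ^ (-κ)) p.2 := by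
  obtain ⟨c, hc0, hc⟩ := exists_cutoff_bound
  refine ⟨A * c * (24 * κ + 24 + 6 * n) + 4 * β * c, by positivity, ?_⟩
  intro w W p g R d hR hd hlow hup
  set y := p.2
  set s := ‖y‖ ^ 2 with hs
  have hs0 : 0 ≤ s := sq_nonneg _
  have hsd : 0 < s + d := by linarith
  have hQ : (s + d) ^ (-κ - 1) = (s + d) * (s + d) ^ (-κ - 2) := by
    rw [show -κ - 1 = 1 + (-κ - 2) by ring, Real.rpow_add hsd, Real.rpow_one]
  have hP : (s + d) ^ (-κ) = (s + d) * (s + d) ^ (-κ - 1) := by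
    rw [show -κ = 1 + (-κ - 1) by ring, Real.rpow_add hsd, Real.rpow_one]; simp
  have hmain := kato_main_le (X := cutoff (s / R ^ 2)) hκ hn hβ hs0 hd hQ hP (by positivity)
    (cutoff_nonneg _) (abs_nonneg (w p.1 y)) (abs_nonneg (W p.1 y)) hlow ha1 ha2
  set X1 := deriv cutoff (s / R ^ 2) / R ^ 2 with hX1
  set X2 := deriv (deriv cutoff) (s / R ^ 2) / R ^ 4 with hX2
  have herr : |W p.1 y| * (4 * s * ((s + d) ^ (-κ) * X2 - 2 * (κ * (s + d) ^ (-κ - 1)) * X1) +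
      2 * n * ((s + d) ^ (-κ) * X1)) - 2 * β * |w p.1 y| * s * ((s + d) ^ (-κ) * X1) ≤
      (A * c * (24 * κ + 24 + 6 * n) + 4 * β * c) *
        (annulus n R).indicator (fun y => |w p.1 y| * (‖y‖ ^ 2 + d) ^ (-κ)) y := by
    by_cases hy : y ∈ annulus n R
    · rw [indicator_of_mem hy]
      refine kato_error_le (Nat.cast_nonneg n) hκ hβ hA hs0 hd hP (by positivity) (abs_nonneg _)
        (abs_nonneg _) hup hR hy.2 ?_ ?_
      · rw [hX1, abs_div, abs_of_nonneg (sq_nonneg R)]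
        gcongr
        exact (hc _).1
      · rw [hX2, abs_div, abs_of_nonneg (show 0 ≤ R ^ 4 by positivity)]
        gcongr
        exact (hc _).2
    · rw [indicator_of_notMem hy]
      have hmem : s / R ^ 2 ∉ Icc (1 : ℝ) 2 := fun h => hy ⟨by
        have := h.1; rwa [le_div_iff₀ (by positivity), one_mul] at this, by
        have := h.2; rwa [div_le_iff₀ (by positivity)] at this⟩
      rw [hX1, hX2, deriv_cutoff_eq_zero hmem, deriv_deriv_cutoff_eq_zero hmem]
      simp
  have hk : IsDifferencePair.katoDensity n α β w W (testFun n κ R d) p =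
      (|W p.1 y| * (cutoff (s / R ^ 2) * (4 * s * (κ * (κ + 1) * (s + d) ^ (-κ - 2)) -
          2 * n * (κ * (s + d) ^ (-κ - 1)))) +
        |w p.1 y| * (cutoff (s / R ^ 2) * ((α - n * β) * (s + d) ^ (-κ) +
          2 * β * s * (κ * (s + d) ^ (-κ - 1))))) +
      (|W p.1 y| * (4 * s * ((s + d) ^ (-κ) * X2 - 2 * (κ * (s + d) ^ (-κ - 1)) * X1) +
      2 * n * ((s + d) ^ (-κ) * X1)) - 2 * β * |w p.1 y| * s * ((s + d) ^ (-κ) * X1)) := by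
    unfold IsDifferencePair.katoDensity
    rw [lap_testFun hd, fderiv_testFun hd]
    unfold testFun
    ring
  rw [hk]
  exact add_le_add hmain herr

theorem integrableOn_sq_norm_rpow_neg {n : ℕ} (hn : 1 ≤ n) {q : ℝ} (hq : 2 * q < n) (ρ : ℝ) :
    IntegrableOn (fun y : EuclideanSpace ℝ (Fin n) => (‖y‖ ^ 2) ^ (-q))
      (Metric.closedBall 0 ρ) := by
  have : Nonempty (Fin n) := ⟨⟨0, by omega⟩⟩
  rw [← integrable_indicator_iff Metric.isClosed_closedBall.measurableSet]
  have e : (Metric.closedBall 0 ρ).indicator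
      (fun y : EuclideanSpace ℝ (Fin n) => (‖y‖ ^ 2) ^ (-q)) =
      fun y => (Iic ρ).indicator (fun r : ℝ => (r ^ 2) ^ (-q)) ‖y‖ := by
    funext y
    by_cases hy : ‖y‖ ≤ ρ
    · rw [indicator_of_mem (by simpa using hy), indicator_of_mem (by simpa using hy)]
    · rw [indicator_of_notMem (by simpa using hy), indicator_of_notMem (by simpa using hy)]
  rw [e, integrable_fun_norm_addHaar volume, finrank_euclideanSpace_fin]
  have h1 : IntegrableOn (fun r : ℝ => r ^ ((n : ℝ) - 1 - 2 * q)) (Ioc 0 ρ) := by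
    rcases le_or_gt ρ 0 with h | h
    · simp [Ioc_eq_empty_of_le h]
    · exact (intervalIntegrable_iff_integrableOn_Ioc_of_le h.le).1
        (intervalIntegral.intervalIntegrable_rpow' (by linarith))
  have h2 : IntegrableOn (fun r : ℝ => r ^ (n - 1) • (Iic ρ).indicator
      (fun r : ℝ => (r ^ 2) ^ (-q)) r) (Ioc 0 ρ) := by
    refine h1.congr_fun (fun r hr => ?_) measurableSet_Ioc
    rw [indicator_of_mem (mem_Iic.2 hr.2), smul_eq_mul, ← Real.rpow_natCast r (n - 1),
      ← Real.rpow_natCast r 2, ← Real.rpow_mul hr.1.le, ← Real.rpow_add hr.1]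
    change r ^ ((n : ℝ) - 1 - 2 * q) = _
    rw [Nat.cast_sub hn]
    congr 1
    push_cast
    ring
  refine h2.of_forall_sdiff_eq_zero measurableSet_Ioi fun r hr => ?_
  have hr' : r ∉ Iic ρ := fun h => hr.2 ⟨hr.1, h⟩
  rw [indicator_of_notMem hr', smul_zero]

theorem ae_ne_zero {n : ℕ} (hn : 1 ≤ n) : ∀ᵐ y : EuclideanSpace ℝ (Fin n), y ≠ 0 := by
  have : Nonempty (Fin n) := ⟨⟨0, by omega⟩⟩
  exact Measure.ae_ne volume 0

theorem ae_slab_snd {n : ℕ} {P : EuclideanSpace ℝ (Fin n) → Prop} (h : ∀ᵐ y, P y) (s t : ℝ) :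
    ∀ᵐ p ∂slab n s t, P p.2 :=
  Measure.quasiMeasurePreserving_snd.ae h

/-- The dissipation weight: the power weight times the relative gap of the profile below the
singular one. -/
noncomputable def dissWeight (n : ℕ) (κ C : ℝ) (g : EuclideanSpace ℝ (Fin n) → ℝ)
    (y : EuclideanSpace ℝ (Fin n)) : ℝ := (‖y‖ ^ 2) ^ (-κ) * (C * g y / ‖y‖ ^ 2 - 1)

/-- A difference pair with the quantitative bounds used in the contraction argument. -/
structure IsControlledPair (n : ℕ) (κ α β m C a A F : ℝ) (g : EuclideanSpace ℝ (Fin n) → ℝ)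
    (w W : ℝ → EuclideanSpace ℝ (Fin n) → ℝ) : Prop extends IsDifferencePair n α β w W where
  exponent_pos : 0 < κ
  exponent_gap : 0 < (n : ℝ) - 2 - 2 * κ
  drift_pos : 0 < β
  upper_pos : 0 < A
  bound_pos : 0 < F
  rate_pos : 0 < a
  rate_mul : a * C = 2 * κ * ((n : ℝ) - 2 - 2 * κ) * m
  rate_eq : a = α - n * β + 2 * κ * β
  continuous_diffusion : Continuous g
  diffusion_gt : ∀ y, ‖y‖ ^ 2 < C * g y
  lower : ∀ τ y, m * g y * |w τ y| ≤ |W τ y|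
  upper : ∀ τ y, |W τ y| ≤ A * (1 + ‖y‖ ^ 2) * |w τ y|
  bound : ∀ τ y, |w τ y| ≤ F

namespace IsControlledPair

variable {n : ℕ} {κ α β m C a A F : ℝ} {g : EuclideanSpace ℝ (Fin n) → ℝ}
  {w W : ℝ → EuclideanSpace ℝ (Fin n) → ℝ}

theorem one_le_dim (h : IsControlledPair n κ α β m C a A F g w W) : 1 ≤ n := by
  have h1 := h.exponent_gap
  have h2 := h.exponent_pos
  by_contra! hn
  have : n = 0 := by omega
  subst this
  norm_num at h1
  linarith

theorem dissWeight_pos (h : IsControlledPair n κ α β m C a A F g w W)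
    {y : EuclideanSpace ℝ (Fin n)} (hy : y ≠ 0) : 0 < dissWeight n κ C g y := by
  have hy' : 0 < ‖y‖ ^ 2 := by positivity
  have : 1 < C * g y / ‖y‖ ^ 2 := by rw [lt_div_iff₀ hy']; linarith [h.diffusion_gt y]
  exact mul_pos (by positivity) (by linarith)

theorem dissWeight_nonneg (h : IsControlledPair n κ α β m C a A F g w W)
    (y : EuclideanSpace ℝ (Fin n)) : 0 ≤ dissWeight n κ C g y := by
  rcases eq_or_ne y 0 with rfl | hy
  · simp [dissWeight, Real.zero_rpow (neg_ne_zero.2 h.exponent_pos.ne')]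
  · exact (h.dissWeight_pos hy).le

theorem exists_dominating (h : IsControlledPair n κ α β m C a A F g w W) (R : ℝ) :
    ∃ k : EuclideanSpace ℝ (Fin n) → ℝ, Integrable k ∧
      (∀ y ∈ Metric.closedBall 0 (2 * R), ∀ d, 0 ≤ d → y ≠ 0 →
        F * (‖y‖ ^ 2 + d) ^ (-κ) ≤ k y ∧
        F * ((‖y‖ ^ 2 + d) ^ (-κ) * |C * g y / (‖y‖ ^ 2 + d) - 1|) ≤ k y) ∧ ∀ y, 0 ≤ k y := by
  have hF := h.bound_pos
  obtain ⟨M, hM⟩ := (isCompact_closedBall (0 : EuclideanSpace ℝ (Fin n))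
    (2 * R)).exists_bound_of_continuousOn (continuous_const.mul h.continuous_diffusion
      (f := fun _ => C)).continuousOn
  have hn := h.one_le_dim
  have hκ := h.exponent_pos
  have hgap := h.exponent_gap
  have i1 := integrableOn_sq_norm_rpow_neg hn (q := κ) (by linarith) (2 * R)
  have i2 := integrableOn_sq_norm_rpow_neg hn (q := κ + 1) (by linarith) (2 * R)
  refine ⟨(Metric.closedBall 0 (2 * R)).indicator
    fun y => F * (|M| * (‖y‖ ^ 2) ^ (-(κ + 1)) + (‖y‖ ^ 2) ^ (-κ)), ?_, ?_, ?_⟩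
  · rw [integrable_indicator_iff Metric.isClosed_closedBall.measurableSet]
    exact ((i2.const_mul |M|).add i1).const_mul F
  · intro y hy d hd hy0
    rw [indicator_of_mem hy]
    have hs : 0 < ‖y‖ ^ 2 := by positivity
    have hsd : 0 < ‖y‖ ^ 2 + d := by linarith
    have e1 : (‖y‖ ^ 2 + d) ^ (-κ) ≤ (‖y‖ ^ 2) ^ (-κ) :=
      Real.rpow_le_rpow_of_nonpos hs (by linarith) (by linarith)
    have e2 : (‖y‖ ^ 2 + d) ^ (-(κ + 1)) ≤ (‖y‖ ^ 2) ^ (-(κ + 1)) :=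
      Real.rpow_le_rpow_of_nonpos hs (by linarith) (by linarith)
    have e3 : 0 ≤ |M| * (‖y‖ ^ 2) ^ (-(κ + 1)) := by positivity
    refine ⟨mul_le_mul_of_nonneg_left (by linarith) hF.le, mul_le_mul_of_nonneg_left ?_ hF.le⟩
    have e4 : (‖y‖ ^ 2 + d) ^ (-κ) = (‖y‖ ^ 2 + d) * (‖y‖ ^ 2 + d) ^ (-(κ + 1)) := by
      rw [show -κ = 1 + -(κ + 1) by ring, Real.rpow_add hsd, Real.rpow_one]
    have e5 : |C * g y| ≤ |M| := (hM y hy).trans (le_abs_self _)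
    calc (‖y‖ ^ 2 + d) ^ (-κ) * |C * g y / (‖y‖ ^ 2 + d) - 1|
        ≤ (‖y‖ ^ 2 + d) ^ (-κ) * (|C * g y| / (‖y‖ ^ 2 + d) + 1) := by
          gcongr
          refine (abs_sub _ _).trans ?_
          rw [abs_div, abs_of_pos hsd, abs_one]
      _ = |C * g y| * (‖y‖ ^ 2 + d) ^ (-(κ + 1)) + (‖y‖ ^ 2 + d) ^ (-κ) := by
          rw [mul_add, mul_one]
          nth_rw 1 [e4]
          field_simp
      _ ≤ _ := by gcongr
  · intro y
    exact indicator_nonneg (fun y _ => by positivity) y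

theorem norm_cutoff_mul_le {R b : ℝ} (hR : 0 < R) {k : EuclideanSpace ℝ (Fin n) → ℝ}
    {y : EuclideanSpace ℝ (Fin n)} (hk : 0 ≤ k y)
    (hb : y ∈ Metric.closedBall 0 (2 * R) → |b| ≤ k y) :
    ‖cutoff (‖y‖ ^ 2 / R ^ 2) * b‖ ≤ k y := by
  by_cases hy : y ∈ Metric.closedBall 0 (2 * R)
  · rw [Real.norm_eq_abs, abs_mul, abs_of_nonneg (cutoff_nonneg _)]
    exact (mul_le_of_le_one_left (abs_nonneg _) (cutoff_le_one _)).trans (hb hy)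
  · rw [cutoff_eq_zero_of_notMem_closedBall hR hy]
    simpa using hk

theorem tendsto_shift_rpow {s : ℝ} (hs : 0 < s) (q : ℝ) :
    Tendsto (fun d => (s + d) ^ q) (𝓝[>] 0) (𝓝 (s ^ q)) := by
  have : ContinuousAt (fun d => (s + d) ^ q) 0 :=
    ContinuousAt.rpow_const (by fun_prop) (Or.inl (by simpa using hs.ne'))
  have h := this.tendsto
  rw [add_zero] at h
  exact h.mono_left nhdsWithin_le_nhds

theorem annulus_subset_closedBall {R : ℝ} (hR : 0 < R) :
    annulus n R ⊆ Metric.closedBall 0 (2 * R) := by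
  intro y hy
  rw [mem_closedBall_zero_iff]
  have := hy.2
  nlinarith [norm_nonneg y]

theorem continuous_shift_rpow {d : ℝ} (hd : 0 < d) (q : ℝ) :
    Continuous fun y : EuclideanSpace ℝ (Fin n) => (‖y‖ ^ 2 + d) ^ q :=
  ((continuous_norm.pow 2).add continuous_const).rpow_const fun _ =>
    Or.inl (add_pos_of_nonneg_of_pos (sq_nonneg _) hd).ne'

theorem continuous_cutoff_norm (R : ℝ) :
    Continuous fun y : EuclideanSpace ℝ (Fin n) => cutoff (‖y‖ ^ 2 / R ^ 2) :=
  contDiff_cutoff.continuous.comp ((continuous_norm.pow 2).div_const _)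

theorem tendsto_integral_testFun (h : IsControlledPair n κ α β m C a A F g w W) {R : ℝ}
    (hR : 0 < R) (t : ℝ) :
    Tendsto (fun d => ∫ y, |w t y| * testFun n κ R d y) (𝓝[>] 0)
      (𝓝 (∫ y, cutoff (‖y‖ ^ 2 / R ^ 2) * (|w t y| * (‖y‖ ^ 2) ^ (-κ)))) := by
  obtain ⟨k, hk, hkb, hk0⟩ := h.exists_dominating R
  refine tendsto_integral_filter_of_dominated_convergence k ?_ ?_ hk ?_
  · filter_upwards [self_mem_nhdsWithin] with d hd
    exact ((h.continuous_slice t).abs.mul (contDiff_testFun hd).continuous).aestronglyMeasurable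
  · filter_upwards [self_mem_nhdsWithin] with d hd
    have hd : 0 < d := hd
    filter_upwards [ae_ne_zero h.one_le_dim] with y hy
    rw [show |w t y| * testFun n κ R d y =
      cutoff (‖y‖ ^ 2 / R ^ 2) * (|w t y| * (‖y‖ ^ 2 + d) ^ (-κ)) by unfold testFun; ring]
    refine norm_cutoff_mul_le hR (hk0 y) fun hyb => (le_trans ?_ (hkb y hyb d hd.le hy).1)
    rw [abs_mul, abs_abs, abs_of_nonneg (show 0 ≤ (‖y‖ ^ 2 + d) ^ (-κ) by positivity)]
    gcongr
    exact h.bound t y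
  · filter_upwards [ae_ne_zero h.one_le_dim] with y hy
    have := (((tendsto_shift_rpow (show 0 < ‖y‖ ^ 2 by positivity) (-κ)).const_mul
      (|w t y|)).const_mul (cutoff (‖y‖ ^ 2 / R ^ 2)))
    refine this.congr fun d => ?_
    unfold testFun
    ring

theorem tendsto_integral_annulus (h : IsControlledPair n κ α β m C a A F g w W) {R : ℝ}
    (hR : 0 < R) (s t : ℝ) :
    Tendsto (fun d => ∫ p, (annulus n R).indicator
        (fun y => |w p.1 y| * (‖y‖ ^ 2 + d) ^ (-κ)) p.2 ∂slab n s t) (𝓝[>] 0)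
      (𝓝 (∫ p, (annulus n R).indicator
        (fun y => |w p.1 y| * (‖y‖ ^ 2) ^ (-κ)) p.2 ∂slab n s t)) := by
  obtain ⟨k, hk, hkb, hk0⟩ := h.exists_dominating R
  have hms : MeasurableSet (Prod.snd ⁻¹' annulus n R : Set (ℝ × EuclideanSpace ℝ (Fin n))) :=
    (isClosed_annulus n R).measurableSet.preimage measurable_snd
  refine tendsto_integral_filter_of_dominated_convergence (fun p => k p.2) ?_ ?_
    (hk.comp_snd _) ?_
  · filter_upwards [self_mem_nhdsWithin] with d hd
    exact (h.continuous_left.abs.mul ((continuous_shift_rpow hd (-κ)).comp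
      continuous_snd)).aestronglyMeasurable.indicator hms
  · filter_upwards [self_mem_nhdsWithin] with d hd
    have hd : 0 < d := hd
    filter_upwards [ae_slab_snd (ae_ne_zero h.one_le_dim) s t] with p hy
    by_cases hp : p.2 ∈ annulus n R
    · rw [indicator_of_mem hp]
      refine le_trans ?_ (hkb p.2 (annulus_subset_closedBall hR hp) d hd.le hy).1
      rw [Real.norm_eq_abs, abs_mul, abs_abs,
        abs_of_nonneg (show 0 ≤ (‖p.2‖ ^ 2 + d) ^ (-κ) by positivity)]
      gcongr
      exact h.bound _ _
    · rw [indicator_of_notMem hp, norm_zero]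
      exact hk0 _
  · filter_upwards [ae_slab_snd (ae_ne_zero h.one_le_dim) s t] with p hy
    by_cases hp : p.2 ∈ annulus n R
    · simp only [indicator_of_mem hp]
      exact (tendsto_shift_rpow (show 0 < ‖p.2‖ ^ 2 by positivity) (-κ)).const_mul _
    · simp only [indicator_of_notMem hp]
      exact tendsto_const_nhds

theorem tendsto_integral_dissipation (h : IsControlledPair n κ α β m C a A F g w W) {R : ℝ}
    (hR : 0 < R) (s t : ℝ) :
    Tendsto (fun d => ∫ p, cutoff (‖p.2‖ ^ 2 / R ^ 2) * (|w p.1 p.2| *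
        ((‖p.2‖ ^ 2 + d) ^ (-κ) * (C * g p.2 / (‖p.2‖ ^ 2 + d) - 1))) ∂slab n s t) (𝓝[>] 0)
      (𝓝 (∫ p, cutoff (‖p.2‖ ^ 2 / R ^ 2) * (|w p.1 p.2| * dissWeight n κ C g p.2)
        ∂slab n s t)) := by
  obtain ⟨k, hk, hkb, hk0⟩ := h.exists_dominating R
  refine tendsto_integral_filter_of_dominated_convergence (fun p => k p.2) ?_ ?_
    (hk.comp_snd _) ?_
  · filter_upwards [self_mem_nhdsWithin] with d hd
    have hd : 0 < d := hd
    refine Continuous.aestronglyMeasurable ?_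
    refine ((continuous_cutoff_norm R).comp continuous_snd).mul (h.continuous_left.abs.mul
      (((continuous_shift_rpow hd (-κ)).comp continuous_snd).mul (Continuous.sub
        (Continuous.div ((continuous_const.mul h.continuous_diffusion).comp continuous_snd)
          (by fun_prop) fun p => by positivity) continuous_const)))
  · filter_upwards [self_mem_nhdsWithin] with d hd
    have hd : 0 < d := hd
    filter_upwards [ae_slab_snd (ae_ne_zero h.one_le_dim) s t] with p hy
    refine norm_cutoff_mul_le hR (hk0 _) fun hyb => (le_trans ?_ (hkb p.2 hyb d hd.le hy).2)
    rw [abs_mul, abs_abs, abs_mul, abs_of_nonneg (show 0 ≤ (‖p.2‖ ^ 2 + d) ^ (-κ) by positivity)]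
    gcongr
    exact h.bound _ _
  · filter_upwards [ae_slab_snd (ae_ne_zero h.one_le_dim) s t] with p hy
    have hs : 0 < ‖p.2‖ ^ 2 := by positivity
    unfold dissWeight
    have h1 : Tendsto (fun d : ℝ => C * g p.2 / (‖p.2‖ ^ 2 + d) - 1) (𝓝[>] 0)
        (𝓝 (C * g p.2 / ‖p.2‖ ^ 2 - 1)) := by
      have : ContinuousAt (fun d : ℝ => C * g p.2 / (‖p.2‖ ^ 2 + d) - 1) 0 :=
        (continuousAt_const.div (by fun_prop) (by simpa using hs.ne')).sub continuousAt_const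
      have h2 := this.tendsto
      rw [add_zero] at h2
      exact h2.mono_left nhdsWithin_le_nhds
    exact (((tendsto_shift_rpow hs (-κ)).mul h1).const_mul _).const_mul _

theorem integrable_annulus (h : IsControlledPair n κ α β m C a A F g w W) {R d : ℝ}
    (hR : 0 < R) (hd : 0 < d) (s t : ℝ) :
    Integrable (fun p => (annulus n R).indicator
        (fun y => |w p.1 y| * (‖y‖ ^ 2 + d) ^ (-κ)) p.2) (slab n s t) := by
  have hms : MeasurableSet (annulus n R) := (isClosed_annulus n R).measurableSet
  have hcl : IsCompact (annulus n R) :=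
    (isCompact_closedBall 0 (2 * R)).of_isClosed_subset (isClosed_annulus n R)
      (annulus_subset_closedBall hR)
  have hi : Integrable ((annulus n R).indicator fun y => F * (‖y‖ ^ 2 + d) ^ (-κ)) := by
    rw [integrable_indicator_iff hms]
    exact (continuous_const.mul (continuous_shift_rpow hd (-κ))).continuousOn.integrableOn_compact
      hcl
  refine (hi.comp_snd (volume.restrict (Ioc s t))).mono' ?_ (Eventually.of_forall fun p => ?_)
  · exact (h.continuous_left.abs.mul ((continuous_shift_rpow hd (-κ)).comp
      continuous_snd)).aestronglyMeasurable.indicator (hms.preimage measurable_snd)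
  · by_cases hp : p.2 ∈ annulus n R
    · rw [indicator_of_mem hp, indicator_of_mem hp, Real.norm_eq_abs, abs_mul, abs_abs,
        abs_of_nonneg (show 0 ≤ (‖p.2‖ ^ 2 + d) ^ (-κ) by positivity)]
      gcongr
      exact h.bound _ _
    · rw [indicator_of_notMem hp, indicator_of_notMem hp, norm_zero]

/-- Localised contraction estimate for the power weight. -/
theorem exists_local_contraction (h : IsControlledPair n κ α β m C a A F g w W) :
    ∃ B : ℝ, 0 ≤ B ∧ ∀ R s t : ℝ, 1 ≤ R → 0 ≤ s → s ≤ t →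
      (∫ y, cutoff (‖y‖ ^ 2 / R ^ 2) * (|w t y| * (‖y‖ ^ 2) ^ (-κ))) +
        a * ∫ p, cutoff (‖p.2‖ ^ 2 / R ^ 2) * (|w p.1 p.2| * dissWeight n κ C g p.2)
          ∂slab n s t ≤
      (∫ y, cutoff (‖y‖ ^ 2 / R ^ 2) * (|w s y| * (‖y‖ ^ 2) ^ (-κ))) +
        B * ∫ p, (annulus n R).indicator (fun y => |w p.1 y| * (‖y‖ ^ 2) ^ (-κ)) p.2
          ∂slab n s t := by
  obtain ⟨B, hB0, hB⟩ := katoDensity_testFun_le (m := m) h.exponent_pos h.exponent_gap h.drift_pos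
    h.upper_pos h.rate_mul h.rate_eq
  refine ⟨B, hB0, fun R s t hR hs hst => ?_⟩
  have hR0 : 0 < R := by linarith
  refine le_of_tendsto_of_tendsto
    ((h.tendsto_integral_testFun hR0 t).add ((h.tendsto_integral_dissipation hR0 s t).const_mul a))
    ((h.tendsto_integral_testFun hR0 s).add ((h.tendsto_integral_annulus hR0 s t).const_mul B)) ?_
  filter_upwards [self_mem_nhdsWithin] with d hd
  have hd : 0 < d := hd
  have h1 := h.integral_abs_mul_sub_le (contDiff_testFun (n := n) (κ := κ) (R := R) hd)
    (hasCompactSupport_testFun hR0) (testFun_nonneg hd) hs hst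
  have iK : Integrable (IsDifferencePair.katoDensity n α β w W (testFun n κ R d)) (slab n s t) :=
    integrable_slab_of_continuousOn (hasCompactSupport_testFun hR0)
      (h.continuous_katoDensity (contDiff_testFun hd)).continuousOn
      IsDifferencePair.katoDensity_eq_zero
  have iT : Integrable (fun p => cutoff (‖p.2‖ ^ 2 / R ^ 2) * (|w p.1 p.2| *
        ((‖p.2‖ ^ 2 + d) ^ (-κ) * (C * g p.2 / (‖p.2‖ ^ 2 + d) - 1)))) (slab n s t) := by
    refine integrable_slab_of_continuousOn (isCompact_closedBall 0 (2 * R))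
      (Continuous.continuousOn ?_) fun p hp => by
        rw [cutoff_eq_zero_of_notMem_closedBall hR0 hp, zero_mul]
    refine ((continuous_cutoff_norm R).comp continuous_snd).mul (h.continuous_left.abs.mul
      (((continuous_shift_rpow hd (-κ)).comp continuous_snd).mul (Continuous.sub
        (Continuous.div ((continuous_const.mul h.continuous_diffusion).comp continuous_snd)
          (by fun_prop) fun p => by positivity) continuous_const)))
  have iA := h.integrable_annulus hR0 hd s t
  have h2 := integral_mono iK ((iT.const_mul a).neg.add (iA.const_mul B)) fun p =>
    hB w W p (g p.2) R d hR hd (h.lower p.1 p.2) (h.upper p.1 p.2)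
  rw [integral_add' (iT.const_mul a).neg (iA.const_mul B), integral_neg', integral_const_mul,
    integral_const_mul] at h2
  linarith

end IsControlledPair

theorem cutoff_norm_eq_one {n : ℕ} {R : ℝ} (hR : 0 < R) {y : EuclideanSpace ℝ (Fin n)}
    (hy : ‖y‖ ≤ R) : cutoff (‖y‖ ^ 2 / R ^ 2) = 1 :=
  cutoff_eq_one (by
    rw [div_le_one (by positivity)]
    exact pow_le_pow_left₀ (norm_nonneg _) hy 2)

/-- A nonnegative function whose smooth truncations have bounded integrals is integrable, and its
integral is the limit of the truncated ones. -/
theorem integrable_and_tendsto_of_cutoff_le {n : ℕ} {X : Type*} [MeasurableSpace X]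
    {μ : Measure X} {q : X → EuclideanSpace ℝ (Fin n)} (hq : Measurable q) {f : X → ℝ}
    (hf0 : ∀ x, 0 ≤ f x)
    (hi : ∀ R, 1 ≤ R → Integrable (fun x => cutoff (‖q x‖ ^ 2 / R ^ 2) * f x) μ) {M : ℝ}
    (hM : ∀ R, 1 ≤ R → ∫ x, cutoff (‖q x‖ ^ 2 / R ^ 2) * f x ∂μ ≤ M) :
    Integrable f μ ∧ Tendsto (fun R => ∫ x, cutoff (‖q x‖ ^ 2 / R ^ 2) * f x ∂μ) atTop
      (𝓝 (∫ x, f x ∂μ)) := by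
  have hms : ∀ N : ℕ, MeasurableSet (q ⁻¹' Metric.closedBall 0 ((N : ℝ) + 1)) := fun N =>
    hq Metric.isClosed_closedBall.measurableSet
  have hcov : AECover μ atTop fun N : ℕ => q ⁻¹' Metric.closedBall 0 ((N : ℝ) + 1) := by
    refine ⟨Eventually.of_forall fun x => ?_, hms⟩
    filter_upwards [eventually_ge_atTop ⌈‖q x‖⌉₊] with N hN
    rw [mem_preimage, mem_closedBall_zero_iff]
    have := (Nat.le_ceil ‖q x‖).trans (Nat.cast_le.2 hN)
    linarith
  have h1 : ∀ N : ℕ, (1 : ℝ) ≤ (N : ℝ) + 1 := fun N => by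
    have := N.cast_nonneg (α := ℝ)
    linarith
  have hN : ∀ N : ℕ, EqOn (fun x => cutoff (‖q x‖ ^ 2 / ((N : ℝ) + 1) ^ 2) * f x) f
      (q ⁻¹' Metric.closedBall 0 ((N : ℝ) + 1)) := fun N x hx => by
    simp only
    rw [cutoff_norm_eq_one (by linarith [h1 N]) (mem_closedBall_zero_iff.1 hx), one_mul]
  have hint : Integrable f μ := by
    refine hcov.integrable_of_integral_bounded_of_nonneg_ae M
      (fun N => ((hi _ (h1 N)).integrableOn.congr_fun (hN N) (hms N)))
      (Eventually.of_forall hf0) (Eventually.of_forall fun N => ?_)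
    rw [← setIntegral_congr_fun (hms N) (hN N)]
    exact (setIntegral_le_integral (hi _ (h1 N)) (Eventually.of_forall fun x =>
      mul_nonneg (cutoff_nonneg _) (hf0 x))).trans (hM _ (h1 N))
  refine ⟨hint, tendsto_integral_filter_of_dominated_convergence f ?_ ?_ hint ?_⟩
  · filter_upwards [eventually_ge_atTop 1] with R hR using (hi R hR).aestronglyMeasurable
  · refine Eventually.of_forall fun R => Eventually.of_forall fun x => ?_
    rw [Real.norm_of_nonneg (mul_nonneg (cutoff_nonneg _) (hf0 x))]
    exact mul_le_of_le_one_left (hf0 x) (cutoff_le_one _)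
  · refine Eventually.of_forall fun x => tendsto_const_nhds.congr' ?_
    filter_upwards [eventually_ge_atTop (max 1 ‖q x‖)] with R hR
    rw [cutoff_norm_eq_one (by linarith [le_max_left 1 ‖q x‖])
      ((le_max_right 1 ‖q x‖).trans hR), one_mul]

namespace IsControlledPair

variable {n : ℕ} {κ α β m C a A F : ℝ} {g : EuclideanSpace ℝ (Fin n) → ℝ}
  {w W : ℝ → EuclideanSpace ℝ (Fin n) → ℝ}

theorem measurable_weight (κ : ℝ) :
    Measurable fun y : EuclideanSpace ℝ (Fin n) => (‖y‖ ^ 2) ^ (-κ) := by fun_prop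

theorem measurable_dissWeight (h : IsControlledPair n κ α β m C a A F g w W) :
    Measurable (dissWeight n κ C g) := by
  have := h.continuous_diffusion.measurable
  unfold dissWeight
  fun_prop

theorem integrable_cutoff_slice (h : IsControlledPair n κ α β m C a A F g w W) {R : ℝ}
    (hR : 0 < R) (t : ℝ) :
    Integrable fun y => cutoff (‖y‖ ^ 2 / R ^ 2) * (|w t y| * (‖y‖ ^ 2) ^ (-κ)) := by
  obtain ⟨k, hk, hkb, hk0⟩ := h.exists_dominating R
  refine hk.mono' ?_ ?_
  · exact (continuous_cutoff_norm R).aestronglyMeasurable.mul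
      ((h.continuous_slice t).abs.aestronglyMeasurable.mul
        (measurable_weight κ).aestronglyMeasurable)
  · filter_upwards [ae_ne_zero h.one_le_dim] with y hy
    refine norm_cutoff_mul_le hR (hk0 y) fun hyb => (le_trans ?_ (hkb y hyb 0 le_rfl hy).1)
    rw [add_zero, abs_mul, abs_abs, abs_of_nonneg (show 0 ≤ (‖y‖ ^ 2) ^ (-κ) by positivity)]
    gcongr
    exact h.bound t y

theorem integrable_cutoff_slab (h : IsControlledPair n κ α β m C a A F g w W) {R : ℝ}
    (hR : 0 < R) (s t : ℝ) :
    Integrable (fun p => cutoff (‖p.2‖ ^ 2 / R ^ 2) * (|w p.1 p.2| * (‖p.2‖ ^ 2) ^ (-κ)))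
      (slab n s t) := by
  obtain ⟨k, hk, hkb, hk0⟩ := h.exists_dominating R
  refine (hk.comp_snd (volume.restrict (Ioc s t))).mono' ?_ ?_
  · exact ((continuous_cutoff_norm R).comp continuous_snd).aestronglyMeasurable.mul
      (h.continuous_left.abs.aestronglyMeasurable.mul
        ((measurable_weight κ).comp measurable_snd).aestronglyMeasurable)
  · filter_upwards [ae_slab_snd (ae_ne_zero h.one_le_dim) s t] with p hy
    refine norm_cutoff_mul_le hR (hk0 _) fun hyb => (le_trans ?_ (hkb _ hyb 0 le_rfl hy).1)
    rw [add_zero, abs_mul, abs_abs, abs_of_nonneg (show 0 ≤ (‖p.2‖ ^ 2) ^ (-κ) by positivity)]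
    gcongr
    exact h.bound _ _

theorem integrable_cutoff_dissipation (h : IsControlledPair n κ α β m C a A F g w W) {R : ℝ}
    (hR : 0 < R) (s t : ℝ) :
    Integrable (fun p => cutoff (‖p.2‖ ^ 2 / R ^ 2) * (|w p.1 p.2| * dissWeight n κ C g p.2))
      (slab n s t) := by
  obtain ⟨k, hk, hkb, hk0⟩ := h.exists_dominating R
  refine (hk.comp_snd (volume.restrict (Ioc s t))).mono' ?_ ?_
  · exact ((continuous_cutoff_norm R).comp continuous_snd).aestronglyMeasurable.mul
      (h.continuous_left.abs.aestronglyMeasurable.mul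
        (h.measurable_dissWeight.comp measurable_snd).aestronglyMeasurable)
  · filter_upwards [ae_slab_snd (ae_ne_zero h.one_le_dim) s t] with p hy
    refine norm_cutoff_mul_le hR (hk0 _) fun hyb => (le_trans ?_ (hkb _ hyb 0 le_rfl hy).2)
    rw [add_zero, abs_mul, abs_abs, dissWeight, abs_mul,
      abs_of_nonneg (show 0 ≤ (‖p.2‖ ^ 2) ^ (-κ) by positivity)]
    gcongr
    exact h.bound _ _

/-- Polynomial a priori growth of the truncated mass. -/
theorem exists_mass_growth (h : IsControlledPair n κ α β m C a A F g w W) :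
    ∃ D : ℝ, 0 ≤ D ∧ ∀ R t : ℝ, 1 ≤ R →
      ∫ y, cutoff (‖y‖ ^ 2 / R ^ 2) * (|w t y| * (‖y‖ ^ 2) ^ (-κ)) ≤ D * R ^ n := by
  have hκ := h.exponent_pos
  have hF := h.bound_pos
  have i1 := integrableOn_sq_norm_rpow_neg h.one_le_dim (q := κ)
    (by linarith [h.exponent_gap]) 1
  set V := (volume : Measure (EuclideanSpace ℝ (Fin n))).real (Metric.ball 0 1)
  set I := ∫ y in Metric.closedBall (0 : EuclideanSpace ℝ (Fin n)) 1, (‖y‖ ^ 2) ^ (-κ)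
  have hI : 0 ≤ I := integral_nonneg fun y => by positivity
  have hV : 0 ≤ V := measureReal_nonneg
  refine ⟨F * (I + 2 ^ n * V), by positivity, fun R t hR => ?_⟩
  have hR0 : 0 < R := by linarith
  have i2 : IntegrableOn (fun _ : EuclideanSpace ℝ (Fin n) => (1 : ℝ))
      (Metric.closedBall 0 (2 * R)) :=
    continuousOn_const.integrableOn_compact (isCompact_closedBall _ _)
  have j1 := (integrable_indicator_iff Metric.isClosed_closedBall.measurableSet).2 i1
  have j2 := (integrable_indicator_iff Metric.isClosed_closedBall.measurableSet).2 i2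
  have h1 := integral_mono (h.integrable_cutoff_slice hR0 t) ((j1.add j2).const_mul F)
    fun y => ?_
  · refine h1.trans ?_
    rw [integral_const_mul, integral_add' j1 j2,
      integral_indicator Metric.isClosed_closedBall.measurableSet,
      integral_indicator Metric.isClosed_closedBall.measurableSet, setIntegral_const,
      Measure.addHaar_real_closedBall _ _ (by linarith), finrank_euclideanSpace_fin, mul_assoc]
    have : 1 ≤ R ^ n := one_le_pow₀ hR
    gcongr
    rw [smul_eq_mul, mul_one, mul_pow, add_mul]
    have : I * 1 ≤ I * R ^ n := by gcongr
    change I + _ * V ≤ _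
    linarith
  · have hx : 0 ≤ (‖y‖ ^ 2) ^ (-κ) := by positivity
    by_cases hy : y ∈ Metric.closedBall 0 (2 * R)
    · calc cutoff (‖y‖ ^ 2 / R ^ 2) * (|w t y| * (‖y‖ ^ 2) ^ (-κ))
          ≤ |w t y| * (‖y‖ ^ 2) ^ (-κ) :=
            mul_le_of_le_one_left (by positivity) (cutoff_le_one _)
        _ ≤ F * (‖y‖ ^ 2) ^ (-κ) := mul_le_mul_of_nonneg_right (h.bound t y) hx
        _ ≤ _ := by
          refine mul_le_mul_of_nonneg_left ?_ hF.le
          rw [Pi.add_apply, indicator_of_mem hy]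
          by_cases hy1 : y ∈ Metric.closedBall 0 1
          · rw [indicator_of_mem hy1]; linarith
          · rw [indicator_of_notMem hy1, zero_add]
            have : 1 < ‖y‖ := by simpa using hy1
            exact Real.rpow_le_one_of_one_le_of_nonpos (one_le_pow₀ this.le) (by linarith)
    · simp only
      rw [cutoff_eq_zero_of_notMem_closedBall hR0 hy, zero_mul]
      refine mul_nonneg hF.le (add_nonneg ?_ ?_)
      · exact indicator_nonneg (fun y _ => by positivity) y
      · exact indicator_nonneg (fun y _ => by positivity) y

theorem integral_annulus_le (h : IsControlledPair n κ α β m C a A F g w W) {R s t M : ℝ}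
    (hR : 0 < R) (hst : s ≤ t)
    (hM : ∀ τ ∈ Ioc s t, ∫ y, cutoff (‖y‖ ^ 2 / (2 * R) ^ 2) * (|w τ y| * (‖y‖ ^ 2) ^ (-κ)) ≤ M) :
    ∫ p, (annulus n R).indicator (fun y => |w p.1 y| * (‖y‖ ^ 2) ^ (-κ)) p.2 ∂slab n s t ≤
      (t - s) * M := by
  have i := h.integrable_cutoff_slab (show 0 < 2 * R by linarith) s t
  calc ∫ p, (annulus n R).indicator (fun y => |w p.1 y| * (‖y‖ ^ 2) ^ (-κ)) p.2 ∂slab n s t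
      ≤ ∫ p, cutoff (‖p.2‖ ^ 2 / (2 * R) ^ 2) * (|w p.1 p.2| * (‖p.2‖ ^ 2) ^ (-κ))
          ∂slab n s t := by
        refine integral_mono_of_nonneg (Eventually.of_forall fun p => ?_) i
          (Eventually.of_forall fun p => ?_)
        · exact indicator_nonneg (fun y _ => by positivity) _
        · simp only
          by_cases hp : p.2 ∈ annulus n R
          · rw [indicator_of_mem hp, cutoff_norm_eq_one (by linarith)
              (mem_closedBall_zero_iff.1 (annulus_subset_closedBall hR hp)), one_mul]
          · rw [indicator_of_notMem hp]
            exact mul_nonneg (cutoff_nonneg _) (by positivity)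
    _ = ∫ τ in Ioc s t, ∫ y, cutoff (‖y‖ ^ 2 / (2 * R) ^ 2) *
          (|w τ y| * (‖y‖ ^ 2) ^ (-κ)) := integral_prod _ i
    _ ≤ ∫ _ in Ioc s t, M := setIntegral_mono_on i.integral_prod_left (by simp)
          measurableSet_Ioc hM
    _ = (t - s) * M := by simp [hst]

theorem exists_step (h : IsControlledPair n κ α β m C a A F g w W) :
    ∃ δ : ℝ, 0 < δ ∧ ∀ s I : ℝ, 0 ≤ s → 0 ≤ I →
      (∀ R, 1 ≤ R → ∫ y, cutoff (‖y‖ ^ 2 / R ^ 2) * (|w s y| * (‖y‖ ^ 2) ^ (-κ)) ≤ I) →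
      ∀ t ∈ Icc s (s + δ), ∀ R, 1 ≤ R →
        ∫ y, cutoff (‖y‖ ^ 2 / R ^ 2) * (|w t y| * (‖y‖ ^ 2) ^ (-κ)) ≤ 2 * I := by
  obtain ⟨B, hB0, hB⟩ := h.exists_local_contraction
  obtain ⟨D, hD0, hD⟩ := h.exists_mass_growth
  have ha := h.rate_pos
  set δ := 1 / (2 ^ n * (2 * (B + 1)))
  have hδ : 0 < δ := by positivity
  have hδB : B * δ * 2 ^ n ≤ 1 / 2 := by
    have : B * δ * 2 ^ n = B / (2 * (B + 1)) := by simp only [δ]; field_simp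
    rw [this, div_le_iff₀ (by positivity)]
    linarith
  have hδB' : B * δ ≤ 1 / 2 :=
    (le_mul_of_one_le_right (by positivity) (one_le_pow₀ (by norm_num))).trans hδB
  refine ⟨δ, hδ, fun s I hs hI hmass => ?_⟩
  have key : ∀ J : ℕ, ∀ t ∈ Icc s (s + δ), ∀ R, 1 ≤ R →
      ∫ y, cutoff (‖y‖ ^ 2 / R ^ 2) * (|w t y| * (‖y‖ ^ 2) ^ (-κ)) ≤
        2 * I + (1 / 2) ^ J * (D * R ^ n) := by
    intro J
    induction J with
    | zero =>
      intro t _ R hR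
      have := hD R t hR
      rw [pow_zero, one_mul]
      linarith
    | succ J ih =>
      intro t ht R hR
      have h1 := hB R s t hR hs ht.1
      have h2 : 0 ≤ ∫ p, cutoff (‖p.2‖ ^ 2 / R ^ 2) * (|w p.1 p.2| * dissWeight n κ C g p.2)
          ∂slab n s t :=
        integral_nonneg fun p => mul_nonneg (cutoff_nonneg _)
          (mul_nonneg (abs_nonneg _) (h.dissWeight_nonneg _))
      have h3 := h.integral_annulus_le (R := R) (by linarith) ht.1 fun τ hτ =>
        ih τ ⟨hτ.1.le, hτ.2.trans ht.2⟩ (2 * R) (by linarith)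
      have h4 := hmass R hR
      have h5 : 0 ≤ a * _ := mul_nonneg ha.le h2
      set Q := (1 / 2 : ℝ) ^ J * (D * R ^ n)
      have hQ : 0 ≤ Q := by positivity
      have hQ2 : (1 / 2 : ℝ) ^ J * (D * (2 * R) ^ n) = 2 ^ n * Q := by
        rw [mul_pow]; simp only [Q]; ring
      have hQ3 : (1 / 2 : ℝ) ^ (J + 1) * (D * R ^ n) = 1 / 2 * Q := by
        rw [pow_succ]; simp only [Q]; ring
      rw [hQ2] at h3
      rw [hQ3]
      have h6 : (t - s) * (2 * I + 2 ^ n * Q) ≤ δ * (2 * I + 2 ^ n * Q) :=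
        mul_le_mul_of_nonneg_right (by linarith [ht.2]) (by positivity)
      have h7 := mul_le_mul_of_nonneg_left (h3.trans h6) hB0
      have h8 : B * δ * (2 * I) ≤ 1 / 2 * (2 * I) := by gcongr
      have h9 : B * δ * 2 ^ n * Q ≤ 1 / 2 * Q := by gcongr
      linarith
  intro t ht R hR
  refine ge_of_tendsto' (f := fun J : ℕ => 2 * I + (1 / 2 : ℝ) ^ J * (D * R ^ n))
    (x := atTop) ?_ fun J => key J t ht R hR
  simpa using ((tendsto_pow_atTop_nhds_zero_of_lt_one (r := (1 / 2 : ℝ)) (by norm_num)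
    (by norm_num)).mul_const (D * R ^ n)).const_add (2 * I)

theorem exists_mass_bound (h : IsControlledPair n κ α β m C a A F g w W)
    (h0 : Integrable fun y => |w 0 y| * (‖y‖ ^ 2) ^ (-κ)) (T : ℝ) :
    ∃ M : ℝ, 0 ≤ M ∧ ∀ t ∈ Icc 0 T, ∀ R, 1 ≤ R →
      ∫ y, cutoff (‖y‖ ^ 2 / R ^ 2) * (|w t y| * (‖y‖ ^ 2) ^ (-κ)) ≤ M := by
  obtain ⟨δ, hδ, hstep⟩ := h.exists_step
  set I := ∫ y, |w 0 y| * (‖y‖ ^ 2) ^ (-κ)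
  have hI : 0 ≤ I := integral_nonneg fun y => by positivity
  have key : ∀ j : ℕ, ∀ t ∈ Icc 0 (j * δ), ∀ R, 1 ≤ R →
      ∫ y, cutoff (‖y‖ ^ 2 / R ^ 2) * (|w t y| * (‖y‖ ^ 2) ^ (-κ)) ≤ 2 ^ j * I := by
    intro j
    induction j with
    | zero =>
      intro t ht R hR
      have ht0 : t = 0 := le_antisymm (by simpa using ht.2) ht.1
      rw [ht0, pow_zero, one_mul]
      exact integral_mono (h.integrable_cutoff_slice (by linarith) 0) h0 fun y =>
        mul_le_of_le_one_left (by positivity) (cutoff_le_one _)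
    | succ j ih =>
      intro t ht R hR
      have hj : 0 ≤ (j : ℝ) * δ := by positivity
      have hpow : (2 : ℝ) ^ j * I ≤ 2 ^ (j + 1) * I := by
        rw [pow_succ]; nlinarith [show 0 ≤ (2 : ℝ) ^ j * I by positivity]
      rcases le_total t (j * δ) with hle | hge
      · exact (ih t ⟨ht.1, hle⟩ R hR).trans hpow
      · have := hstep (j * δ) (2 ^ j * I) hj (by positivity) (ih _ ⟨hj, le_rfl⟩) t
          ⟨hge, by have := ht.2; push_cast at this; linarith⟩ R hR
        rw [pow_succ (2 : ℝ)]
        linarith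
  obtain ⟨j, hj⟩ := exists_nat_ge (T / δ)
  rw [div_le_iff₀ hδ] at hj
  exact ⟨2 ^ j * I, by positivity, fun t ht => key j t ⟨ht.1, ht.2.trans hj⟩⟩

theorem tendsto_annulus_zero {s t : ℝ}
    (hi : Integrable (fun p : ℝ × EuclideanSpace ℝ (Fin n) =>
      |w p.1 p.2| * (‖p.2‖ ^ 2) ^ (-κ)) (slab n s t)) :
    Tendsto (fun R => ∫ p, (annulus n R).indicator
      (fun y => |w p.1 y| * (‖y‖ ^ 2) ^ (-κ)) p.2 ∂slab n s t) atTop (𝓝 0) := by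
  have hms : ∀ R, MeasurableSet (Prod.snd ⁻¹' annulus n R :
      Set (ℝ × EuclideanSpace ℝ (Fin n))) := fun R =>
    (isClosed_annulus n R).measurableSet.preimage measurable_snd
  rw [← integral_zero (ℝ × EuclideanSpace ℝ (Fin n)) ℝ (μ := slab n s t)]
  refine tendsto_integral_filter_of_dominated_convergence
    (fun p => |w p.1 p.2| * (‖p.2‖ ^ 2) ^ (-κ)) ?_ ?_ hi ?_
  · exact Eventually.of_forall fun R => hi.aestronglyMeasurable.indicator (hms R)
  · refine Eventually.of_forall fun R => Eventually.of_forall fun p => ?_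
    have h0 : 0 ≤ |w p.1 p.2| * (‖p.2‖ ^ 2) ^ (-κ) := by positivity
    by_cases hp : p.2 ∈ annulus n R
    · rw [indicator_of_mem hp, Real.norm_of_nonneg h0]
    · rwa [indicator_of_notMem hp, norm_zero]
  · refine Eventually.of_forall fun p => tendsto_const_nhds.congr' ?_
    filter_upwards [eventually_gt_atTop ‖p.2‖] with R hR
    refine (indicator_of_notMem (fun hp => ?_) _).symm
    have := hp.1
    nlinarith [norm_nonneg p.2]

/-- Contraction with dissipation for the full power weight. -/
theorem contraction (h : IsControlledPair n κ α β m C a A F g w W)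
    (h0 : Integrable fun y => |w 0 y| * (‖y‖ ^ 2) ^ (-κ)) {t : ℝ} (ht : 0 ≤ t) :
    Integrable (fun p => |w p.1 p.2| * dissWeight n κ C g p.2) (slab n 0 t) ∧
      (∫ y, |w t y| * (‖y‖ ^ 2) ^ (-κ)) +
        a * ∫ p, |w p.1 p.2| * dissWeight n κ C g p.2 ∂slab n 0 t ≤
      ∫ y, |w 0 y| * (‖y‖ ^ 2) ^ (-κ) := by
  obtain ⟨M, hM0, hM⟩ := h.exists_mass_bound h0 t
  obtain ⟨B, hB0, hB⟩ := h.exists_local_contraction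
  have ha := h.rate_pos
  have hw0 : ∀ τ y, 0 ≤ |w τ y| * (‖y‖ ^ 2) ^ (-κ) := fun τ y => by positivity
  have hd0 : ∀ p : ℝ × EuclideanSpace ℝ (Fin n), 0 ≤ |w p.1 p.2| * dissWeight n κ C g p.2 :=
    fun p => mul_nonneg (abs_nonneg _) (h.dissWeight_nonneg _)
  have hpos : ∀ {R : ℝ}, 1 ≤ R → 0 < R := fun hR => by linarith
  have c0 := (integrable_and_tendsto_of_cutoff_le measurable_id (hw0 0)
    (fun R hR => h.integrable_cutoff_slice (hpos hR) 0) (hM 0 ⟨le_rfl, ht⟩)).2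
  have ct := (integrable_and_tendsto_of_cutoff_le measurable_id (hw0 t)
    (fun R hR => h.integrable_cutoff_slice (hpos hR) t) (hM t ⟨ht, le_rfl⟩)).2
  have is := (integrable_and_tendsto_of_cutoff_le (μ := slab n 0 t) measurable_snd
    (fun p => hw0 p.1 p.2) (fun R hR => h.integrable_cutoff_slab (hpos hR) 0 t)
    (M := ∫ _ in Ioc 0 t, M) fun R hR => by
      have i := h.integrable_cutoff_slab (hpos hR) 0 t
      rw [integral_prod _ i]
      exact setIntegral_mono_on i.integral_prod_left (by simp) measurableSet_Ioc
        fun τ hτ => hM τ ⟨hτ.1.le, hτ.2⟩ R hR).1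
  have cA := tendsto_annulus_zero is
  obtain ⟨id, cd⟩ := integrable_and_tendsto_of_cutoff_le (μ := slab n 0 t) measurable_snd hd0
    (fun R hR => h.integrable_cutoff_dissipation (hpos hR) 0 t)
    (M := (M + B * (t * M)) / a) fun R hR => by
      rw [le_div_iff₀ ha]
      have h1 := hB R 0 t hR le_rfl ht
      have h2 := hM 0 ⟨le_rfl, ht⟩ R hR
      have h3 := h.integral_annulus_le (hpos hR) ht fun τ hτ =>
        hM τ ⟨hτ.1.le, hτ.2⟩ (2 * R) (by linarith)
      have h4 : 0 ≤ ∫ y, cutoff (‖y‖ ^ 2 / R ^ 2) * (|w t y| * (‖y‖ ^ 2) ^ (-κ)) :=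
        integral_nonneg fun y => mul_nonneg (cutoff_nonneg _) (hw0 t y)
      have h5 := mul_le_mul_of_nonneg_left h3 hB0
      rw [sub_zero] at h5
      linarith
  refine ⟨id, le_of_tendsto_of_tendsto (ct.add (cd.const_mul a))
    (by simpa using c0.add (cA.const_mul B)) ?_⟩
  filter_upwards [eventually_ge_atTop 1] with R hR using hB R 0 t hR le_rfl ht

theorem dissipation_pos (h : IsControlledPair n κ α β m C a A F g w W)
    (h0 : w 0 ≠ 0) {t : ℝ} (ht : 0 < t)
    (hi : Integrable (fun p => |w p.1 p.2| * dissWeight n κ C g p.2) (slab n 0 t)) :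
    0 < ∫ p, |w p.1 p.2| * dissWeight n κ C g p.2 ∂slab n 0 t := by
  have hd0 : ∀ p : ℝ × EuclideanSpace ℝ (Fin n), 0 ≤ |w p.1 p.2| * dissWeight n κ C g p.2 :=
    fun p => mul_nonneg (abs_nonneg _) (h.dissWeight_nonneg _)
  refine lt_of_le_of_ne (integral_nonneg hd0) fun hzero => h0 ?_
  have h1 := (integral_eq_zero_iff_of_nonneg hd0 hi).1 hzero.symm
  have h2 : ∀ᵐ p ∂slab n 0 t, w p.1 p.2 = 0 := by
    filter_upwards [h1, ae_slab_snd (ae_ne_zero h.one_le_dim) 0 t] with p hp hp0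
    simpa [(h.dissWeight_pos hp0).ne'] using hp
  rw [slab_eq_restrict] at h2
  have hsub : Ioo 0 t ×ˢ (univ : Set (EuclideanSpace ℝ (Fin n))) ⊆ Ioc 0 t ×ˢ univ :=
    prod_mono_left Ioo_subset_Ioc_self
  have h3 := Measure.eqOn_open_of_ae_eq (f := fun p : ℝ × EuclideanSpace ℝ (Fin n) => w p.1 p.2)
    (g := fun _ => 0) (ae_restrict_of_ae_restrict_of_subset hsub h2)
    (isOpen_Ioo.prod isOpen_univ) h.continuous_left.continuousOn continuousOn_const
  funext y
  have h4 : EqOn (fun τ => w τ y) (fun _ => 0) (Ioo 0 t) := fun τ hτ => h3 (x := (τ, y)) ⟨hτ, mem_univ y⟩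
  refine h4.closure (h.continuous_time y) continuous_const ?_
  rw [closure_Ioo ht.ne]
  exact ⟨le_rfl, ht.le⟩

end IsControlledPair

theorem lap_sub {n : ℕ} {f g : EuclideanSpace ℝ (Fin n) → ℝ} (hf : ContDiff ℝ 2 f)
    (hg : ContDiff ℝ 2 g) (y : EuclideanSpace ℝ (Fin n)) :
    lap n (fun z => f z - g z) y = lap n f y - lap n g y := by
  unfold lap
  rw [← Finset.sum_sub_distrib]
  refine Finset.sum_congr rfl fun i _ => ?_
  have e : (fun z => fderiv ℝ (fun z => f z - g z) z (EuclideanSpace.single i (1 : ℝ))) =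
      fun z => fderiv ℝ f z (EuclideanSpace.single i (1 : ℝ)) -
        fderiv ℝ g z (EuclideanSpace.single i (1 : ℝ)) := by
    funext z
    rw [fderiv_fun_sub (hf.differentiable (by norm_num) z) (hg.differentiable (by norm_num) z)]
    rfl
  rw [e, fderiv_fun_sub ((contDiff_fderiv_apply hf _).differentiable (by norm_num) y)
    ((contDiff_fderiv_apply hg _).differentiable (by norm_num) y)]
  rfl

theorem rpow_sub_bounds_of_lt {a b u v m : ℝ} (ha : 0 < a) (hm0 : 0 < m) (hm1 : m < 1)
    (hu : a ≤ u) (huv : u < v) (hv : v ≤ b) :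
    m * b ^ (m - 1) * (v - u) ≤ v ^ m - u ^ m ∧ v ^ m - u ^ m ≤ m * a ^ (m - 1) * (v - u) := by
  have hd : ∀ x ∈ Ioo u v, HasDerivAt (fun x : ℝ => x ^ m) (m * x ^ (m - 1)) x := fun x hx =>
    Real.hasDerivAt_rpow_const (Or.inl (by linarith [hx.1]))
  obtain ⟨c, hc, e⟩ := exists_hasDerivAt_eq_slope (fun x : ℝ => x ^ m) _ huv
    (Real.continuous_rpow_const hm0.le).continuousOn hd
  rw [eq_div_iff (by linarith)] at e
  have hc0 : 0 < c := by linarith [hc.1]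
  rw [← e]
  have h1 : b ^ (m - 1) ≤ c ^ (m - 1) :=
    Real.rpow_le_rpow_of_nonpos hc0 (by linarith [hc.2]) (by linarith)
  have h2 : c ^ (m - 1) ≤ a ^ (m - 1) :=
    Real.rpow_le_rpow_of_nonpos ha (by linarith [hc.1]) (by linarith)
  have h3 : 0 ≤ v - u := by linarith
  constructor <;> gcongr

theorem rpow_sub_bounds {a b u v m : ℝ} (ha : 0 < a) (hm0 : 0 < m) (hm1 : m < 1)
    (hu : a ≤ u ∧ u ≤ b) (hv : a ≤ v ∧ v ≤ b) :
    m * b ^ (m - 1) * |u - v| ≤ |u ^ m - v ^ m| ∧ |u ^ m - v ^ m| ≤ m * a ^ (m - 1) * |u - v| := by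
  rcases lt_trichotomy u v with h | rfl | h
  · have h1 := Real.rpow_lt_rpow (ha.le.trans hu.1) h hm0
    rw [abs_sub_comm, abs_sub_comm (u ^ m), abs_of_pos (sub_pos.2 h), abs_of_pos (sub_pos.2 h1)]
    exact rpow_sub_bounds_of_lt ha hm0 hm1 hu.1 h hv.2
  · simp
  · have h1 := Real.rpow_lt_rpow (ha.le.trans hv.1) h hm0
    rw [abs_of_pos (sub_pos.2 h), abs_of_pos (sub_pos.2 h1)]
    exact rpow_sub_bounds_of_lt ha hm0 hm1 hv.1 h hu.2

theorem sign_sub_rpow {u v m : ℝ} (hu : 0 < u) (hv : 0 < v) (hm : 0 < m) :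
    (u - v) / |u - v| = (u ^ m - v ^ m) / |u ^ m - v ^ m| := by
  rcases lt_trichotomy u v with h | rfl | h
  · have h1 := sub_neg.2 (Real.rpow_lt_rpow hu.le h hm)
    have h2 := sub_neg.2 h
    rw [abs_of_neg h1, abs_of_neg h2, div_neg, div_neg, div_self h1.ne, div_self h2.ne]
  · simp
  · have h1 := sub_pos.2 (Real.rpow_lt_rpow hv.le h hm)
    have h2 := sub_pos.2 h
    rw [abs_of_pos h1, abs_of_pos h2, div_self h1.ne', div_self h2.ne']

namespace IsRescaledSolution

variable {n : ℕ} {m β α : ℝ} {f₁ f₂ : ℝ → ℝ} {v₀ : EuclideanSpace ℝ (Fin n) → ℝ}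
  {v : EuclideanSpace ℝ (Fin n) → ℝ → ℝ}

theorem sandwich_max (h : IsRescaledSolution n m β α f₁ f₂ v₀ v)
    (h0 : ∀ y, f₁ ‖y‖ ≤ v₀ y ∧ v₀ y ≤ f₂ ‖y‖) (y : EuclideanSpace ℝ (Fin n)) (τ : ℝ) :
    f₁ ‖y‖ ≤ v y (max τ 0) ∧ v y (max τ 0) ≤ f₂ ‖y‖ := by
  rcases le_or_gt τ 0 with hτ | hτ
  · rw [max_eq_right hτ, h.init]
    exact h0 y
  · rw [max_eq_left hτ.le]
    exact h.sandwich y τ hτ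

theorem continuous_max (h : IsRescaledSolution n m β α f₁ f₂ v₀ v) :
    Continuous fun p : ℝ × EuclideanSpace ℝ (Fin n) => v p.2 (max p.1 0) :=
  h.cont.comp_continuous
    (f := fun p : ℝ × EuclideanSpace ℝ (Fin n) => (p.2, max p.1 0)) (by fun_prop)
    fun p => ⟨mem_univ _, mem_Ici.2 (le_max_right p.1 0)⟩

theorem contDiffAt (h : IsRescaledSolution n m β α f₁ f₂ v₀ v) (y : EuclideanSpace ℝ (Fin n))
    {τ : ℝ} (hτ : 0 < τ) :
    ContDiffAt ℝ 2 (fun p : EuclideanSpace ℝ (Fin n) × ℝ => v p.1 p.2) (y, τ) :=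
  h.smooth.contDiffAt ((isOpen_univ.prod isOpen_Ioi).mem_nhds ⟨mem_univ y, hτ⟩)

theorem hasFDerivAt (h : IsRescaledSolution n m β α f₁ f₂ v₀ v) (y : EuclideanSpace ℝ (Fin n))
    {τ : ℝ} (hτ : 0 < τ) :
    HasFDerivAt (fun p : EuclideanSpace ℝ (Fin n) × ℝ => v p.1 p.2)
      (fderiv ℝ (fun p : EuclideanSpace ℝ (Fin n) × ℝ => v p.1 p.2) (y, τ)) (y, τ) :=
  ((h.contDiffAt y hτ).differentiableAt (by norm_num)).hasFDerivAt

theorem contDiff_slice (h : IsRescaledSolution n m β α f₁ f₂ v₀ v) {τ : ℝ} (hτ : 0 < τ) :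
    ContDiff ℝ 2 fun y => v y τ :=
  contDiff_iff_contDiffAt.2 fun y =>
    (h.contDiffAt y hτ).comp y (contDiffAt_id.prodMk contDiffAt_const)

theorem hasDerivAt_time (h : IsRescaledSolution n m β α f₁ f₂ v₀ v)
    (y : EuclideanSpace ℝ (Fin n)) {τ : ℝ} (hτ : 0 < τ) :
    HasDerivAt (v y)
      (fderiv ℝ (fun p : EuclideanSpace ℝ (Fin n) × ℝ => v p.1 p.2) (y, τ) (0, 1)) τ :=
  (h.hasFDerivAt y hτ).comp_hasDerivAt τ ((hasDerivAt_const τ y).prodMk (hasDerivAt_id τ))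

theorem fderiv_slice (h : IsRescaledSolution n m β α f₁ f₂ v₀ v)
    (y z : EuclideanSpace ℝ (Fin n)) {τ : ℝ} (hτ : 0 < τ) :
    fderiv ℝ (fun y => v y τ) y z =
      fderiv ℝ (fun p : EuclideanSpace ℝ (Fin n) × ℝ => v p.1 p.2) (y, τ) (z, 0) := by
  have h1 := HasFDerivAt.comp (f := fun y => (y, τ)) y (h.hasFDerivAt y hτ) ((hasFDerivAt_id y).prodMk (hasFDerivAt_const τ y))
  have h2 := DFunLike.congr_fun h1.fderiv z
  exact h2

theorem continuousOn_fderiv (h : IsRescaledSolution n m β α f₁ f₂ v₀ v) :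
    ContinuousOn (fun p : ℝ × EuclideanSpace ℝ (Fin n) =>
      fderiv ℝ (fun p : EuclideanSpace ℝ (Fin n) × ℝ => v p.1 p.2) (p.2, p.1))
      (Ioi 0 ×ˢ univ) :=
  (h.smooth.continuousOn_fderiv_of_isOpen (isOpen_univ.prod isOpen_Ioi) (by norm_num)).comp
    continuous_swap.continuousOn fun _ hp => ⟨mem_univ _, hp.1⟩

theorem continuousOn_euler (h : IsRescaledSolution n m β α f₁ f₂ v₀ v) :
    ContinuousOn (fun p : ℝ × EuclideanSpace ℝ (Fin n) => fderiv ℝ (fun y => v y p.1) p.2 p.2)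
      (Ioi 0 ×ˢ univ) := by
  refine (h.continuousOn_fderiv.clm_apply
    (g := fun p : ℝ × EuclideanSpace ℝ (Fin n) => (p.2, (0 : ℝ))) (by fun_prop)).congr
      fun p hp => ?_
  exact h.fderiv_slice p.2 p.2 hp.1

theorem lap_rpow (h : IsRescaledSolution n m β α f₁ f₂ v₀ v) (y : EuclideanSpace ℝ (Fin n))
    {τ : ℝ} (hτ : 0 < τ) :
    lap n (fun z => v z τ ^ m) y = deriv (v y) τ - α * v y τ -
      β * fderiv ℝ (fun z => v z τ) y y := by
  rw [h.pde y τ hτ, map_smul, smul_eq_mul]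
  ring

theorem continuousOn_lap (h : IsRescaledSolution n m β α f₁ f₂ v₀ v) :
    ContinuousOn (fun p : ℝ × EuclideanSpace ℝ (Fin n) => lap n (fun z => v z p.1 ^ m) p.2)
      (Ioi 0 ×ˢ univ) := by
  have h1 : ContinuousOn (fun p : ℝ × EuclideanSpace ℝ (Fin n) =>
      fderiv ℝ (fun p : EuclideanSpace ℝ (Fin n) × ℝ => v p.1 p.2) (p.2, p.1) (0, 1))
      (Ioi 0 ×ˢ univ) := h.continuousOn_fderiv.clm_apply continuousOn_const
  have h2 := h.continuous_max.continuousOn (s := Ioi 0 ×ˢ univ)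
  refine ((h1.sub (h2.const_smul α)).sub (h.continuousOn_euler.const_smul β)).congr
    fun p hp => ?_
  have hτ : 0 < p.1 := hp.1
  rw [h.lap_rpow p.2 hτ, (h.hasDerivAt_time p.2 hτ).deriv]
  simp only [Pi.sub_apply, Pi.smul_apply, smul_eq_mul, max_eq_left hτ.le]

theorem contDiff_rpow_slice (h : IsRescaledSolution n m β α f₁ f₂ v₀ v)
    (hf : ∀ r, 0 ≤ r → 0 < f₁ r) {τ : ℝ} (hτ : 0 < τ) : ContDiff ℝ 2 fun y => v y τ ^ m :=
  (h.contDiff_slice hτ).rpow_const_of_ne fun y =>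
    ne_of_gt ((hf _ (norm_nonneg y)).trans_le (h.sandwich y τ hτ).1)

/-- Two solutions trapped between the same profiles, extended constantly to negative times, form a
difference pair. -/
theorem isDifferencePair {u : EuclideanSpace ℝ (Fin n) → ℝ → ℝ}
    {u₀ : EuclideanSpace ℝ (Fin n) → ℝ} (hm : 0 < m) (hf : ∀ r, 0 ≤ r → 0 < f₁ r)
    (hu : IsRescaledSolution n m β α f₁ f₂ u₀ u) (hv : IsRescaledSolution n m β α f₁ f₂ v₀ v)
    (hu0 : ∀ y, f₁ ‖y‖ ≤ u₀ y ∧ u₀ y ≤ f₂ ‖y‖) (hv0 : ∀ y, f₁ ‖y‖ ≤ v₀ y ∧ v₀ y ≤ f₂ ‖y‖) :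
    IsDifferencePair n α β (fun τ y => u y (max τ 0) - v y (max τ 0))
      (fun τ y => u y (max τ 0) ^ m - v y (max τ 0) ^ m) where
  continuous_left := hu.continuous_max.sub hv.continuous_max
  continuous_right := (hu.continuous_max.rpow_const fun _ => Or.inr hm.le).sub
    (hv.continuous_max.rpow_const fun _ => Or.inr hm.le)
  contDiff_left τ hτ := by
    simp only [max_eq_left hτ.le]
    exact ((hu.contDiff_slice hτ).sub (hv.contDiff_slice hτ)).of_le (by norm_num)
  contDiff_right τ hτ := by
    simp only [max_eq_left hτ.le]
    exact (hu.contDiff_rpow_slice hf hτ).sub (hv.contDiff_rpow_slice hf hτ)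
  hasDerivAt y τ hτ := by
    have h1 := (hu.hasDerivAt_time y hτ).differentiableAt.hasDerivAt.sub
      (hv.hasDerivAt_time y hτ).differentiableAt.hasDerivAt
    have h2 : HasDerivAt (fun τ => u y (max τ 0) - v y (max τ 0))
        (deriv (u y) τ - deriv (v y) τ) τ := by
      refine h1.congr_of_eventuallyEq ?_
      filter_upwards [lt_mem_nhds hτ] with s hs
      simp only [max_eq_left hs.le, Pi.sub_apply]
    convert h2 using 1
    simp only [max_eq_left hτ.le]
    rw [lap_sub (hu.contDiff_rpow_slice hf hτ) (hv.contDiff_rpow_slice hf hτ), hu.lap_rpow y hτ,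
      hv.lap_rpow y hτ, fderiv_fun_sub ((hu.contDiff_slice hτ).differentiable (by norm_num) y)
      ((hv.contDiff_slice hτ).differentiable (by norm_num) y), _root_.sub_apply]
    ring
  continuousOn_lap := by
    refine (hu.continuousOn_lap.sub hv.continuousOn_lap).congr fun p hp => ?_
    have hτ : 0 < p.1 := hp.1
    simp only [max_eq_left hτ.le]
    exact lap_sub (hu.contDiff_rpow_slice hf hτ) (hv.contDiff_rpow_slice hf hτ) p.2
  continuousOn_euler := by
    refine (hu.continuousOn_euler.sub hv.continuousOn_euler).congr fun p hp => ?_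
    have hτ : 0 < p.1 := hp.1
    simp only [max_eq_left hτ.le]
    rw [fderiv_fun_sub ((hu.contDiff_slice hτ).differentiable (by norm_num) p.2)
      ((hv.contDiff_slice hτ).differentiable (by norm_num) p.2)]
    rfl
  sign_eq τ y := sign_sub_rpow
    ((hf _ (norm_nonneg y)).trans_le (hu.sandwich_max hu0 y τ).1)
    ((hf _ (norm_nonneg y)).trans_le (hv.sandwich_max hv0 y τ).1) hm

end IsRescaledSolution

section Constants

variable {n : ℕ} {m β : ℝ}

theorem pZero_pos (hn : 3 ≤ n) (hm1 : m < ((n : ℝ) - 2) / n) (h : CondC1 n m β) :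
    0 < pZero n m β := by
  have hm : 0 < 1 - m := by linarith [exponent_lt_one hn hm1]
  have h1 := h.gamma1_lt hn hm1
  have e : pZero n m β = ((n : ℝ) - 2 - n * m - (1 - m) * gamma1 n m β) / 2 := by
    unfold pZero; field_simp; ring
  rw [e]
  linarith

theorem gap_eq (hm : m < 1) : (n : ℝ) - 2 - 2 * (pZero n m β / (1 - m)) =
    gamma1 n m β + 2 * m / (1 - m) := by
  have hm : 1 - m ≠ 0 := by linarith
  unfold pZero
  field_simp
  ring

theorem aStar_pos (hn : 3 ≤ n) (hm0 : 0 < m) (hm1 : m < ((n : ℝ) - 2) / n) (h : CondC1 n m β) :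
    0 < aStar n m β := by
  have hm : 0 < 1 - m := by linarith [exponent_lt_one hn hm1]
  have h1 := h.gamma1_pos hn hm1
  have h2 := pZero_pos hn hm1 h
  have h3 := Cstar_pos hn hm0 hm1
  unfold aStar
  positivity

theorem aStar_mul_Cstar (hn : 3 ≤ n) (hm0 : 0 < m) (hm1 : m < ((n : ℝ) - 2) / n) :
    aStar n m β * Cstar n m = 2 * (pZero n m β / (1 - m)) *
      ((n : ℝ) - 2 - 2 * (pZero n m β / (1 - m))) * m := by
  have hm := exponent_lt_one hn hm1
  have hm' : 1 - m ≠ 0 := by linarith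
  have h3 := (Cstar_pos hn hm0 hm1).ne'
  rw [gap_eq hm]
  unfold aStar
  field_simp

theorem aStar_eq (hn : 3 ≤ n) (hm0 : 0 < m) (hm1 : m < ((n : ℝ) - 2) / n) (h : CondC1 n m β) :
    aStar n m β = (2 * β + 1) / (1 - m) - n * β + 2 * (pZero n m β / (1 - m)) * β := by
  have hm : 0 < 1 - m := by linarith [exponent_lt_one hn hm1]
  have hN := exponent_gap_pos hn hm1
  have hr := h.gamma1_root hn hm1
  have hC := Cstar_pos hn hm0 hm1
  refine mul_right_cancel₀ hC.ne' ?_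
  rw [aStar_mul_Cstar hn hm0 hm1, gap_eq (by linarith)]
  unfold pZero Cstar
  unfold A0 at hr
  field_simp
  linear_combination (m - 1) * hr

theorem singC_rpow_pZero (hC : 0 ≤ Cstar n m) (y : EuclideanSpace ℝ (Fin n)) :
    singC n m y ^ pZero n m β =
      Cstar n m ^ (pZero n m β / (1 - m)) * (‖y‖ ^ 2) ^ (-(pZero n m β / (1 - m))) := by
  unfold singC
  rw [← Real.rpow_mul (by positivity), one_div_mul_eq_div, Real.div_rpow hC (by positivity),
    Real.rpow_neg (by positivity), div_eq_mul_inv]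

theorem singC_div_rpow (hC : 0 ≤ Cstar n m) (hm : m < 1) {a : ℝ} (ha : 0 < a)
    (y : EuclideanSpace ℝ (Fin n)) :
    (singC n m y / a) ^ (1 - m) = Cstar n m * a ^ (m - 1) / ‖y‖ ^ 2 := by
  have hm' : 1 - m ≠ 0 := by linarith
  have h1 : 0 ≤ Cstar n m / ‖y‖ ^ 2 := by positivity
  unfold singC
  rw [Real.div_rpow (by positivity) ha.le, ← Real.rpow_mul h1, one_div_mul_cancel hm',
    Real.rpow_one, ← neg_sub 1 m, Real.rpow_neg ha.le]
  ring

end Constants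

theorem IsRescaledSolution.exists_isControlledPair {n : ℕ} {m β α lam₁ lam₂ : ℝ} {f₁ f₂ : ℝ → ℝ}
    {u₀ v₀ : EuclideanSpace ℝ (Fin n) → ℝ} {u v : EuclideanSpace ℝ (Fin n) → ℝ → ℝ}
    (hn : 3 ≤ n) (hm0 : 0 < m) (hm1 : m < ((n : ℝ) - 2) / n) (hα : α = (2 * β + 1) / (1 - m))
    (hC1 : CondC1 n m β) (hf₁ : IsProfile n m β α lam₁ f₁) (hf₂ : IsProfile n m β α lam₂ f₂)
    (hu0 : ∀ y, f₁ ‖y‖ ≤ u₀ y ∧ u₀ y ≤ f₂ ‖y‖) (hv0 : ∀ y, f₁ ‖y‖ ≤ v₀ y ∧ v₀ y ≤ f₂ ‖y‖)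
    (hu : IsRescaledSolution n m β α f₁ f₂ u₀ u) (hv : IsRescaledSolution n m β α f₁ f₂ v₀ v) :
    ∃ A F, IsControlledPair n (pZero n m β / (1 - m)) α β m (Cstar n m) (aStar n m β) A F
      (fun y => f₂ ‖y‖ ^ (m - 1)) (fun τ y => u y (max τ 0) - v y (max τ 0))
      (fun τ y => u y (max τ 0) ^ m - v y (max τ 0) ^ m) := by
  have hm := exponent_lt_one hn hm1
  have hm' : 0 < 1 - m := by linarith
  have hC := Cstar_pos hn hm0 hm1
  obtain ⟨F, hF, hFb⟩ := hf₂.exists_upper hn hm0 hm1 hα hC1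
  obtain ⟨A, hA, hAb⟩ := hf₁.exists_lower hn hm0 hm1
  have hpos : ∀ y : EuclideanSpace ℝ (Fin n), 0 < f₂ ‖y‖ := fun y => hf₂.pos _ (norm_nonneg y)
  have hbd := fun τ y => rpow_sub_bounds (hf₁.pos _ (norm_nonneg y)) hm0 hm
    (hu.sandwich_max hu0 y τ) (hv.sandwich_max hv0 y τ)
  refine ⟨A, F, ⟨hu.isDifferencePair hm0 hf₁.pos hv hu0 hv0, ?_, ?_, hC1.beta_pos hn hm0 hm1, hA,
    hF, aStar_pos hn hm0 hm1 hC1, aStar_mul_Cstar hn hm0 hm1, ?_, ?_, ?_, ?_, ?_, ?_⟩⟩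
  · exact div_pos (pZero_pos hn hm1 hC1) hm'
  · rw [gap_eq hm]
    have := hC1.gamma1_pos hn hm1
    positivity
  · rw [hα]
    exact aStar_eq hn hm0 hm1 hC1
  · have h1 : Continuous fun y : EuclideanSpace ℝ (Fin n) => f₂ ‖y‖ := by
      simpa [Function.comp_def] using
        hf₂.continuous_abs.comp (continuous_norm (E := EuclideanSpace ℝ (Fin n)))
    exact h1.rpow_const fun y => Or.inl (hpos y).ne'
  · intro y
    have h1 := hf₂.sq_mul_rpow_lt hn hm0 hm1 hα hC1 (norm_nonneg y)
    rw [← neg_sub 1 m, Real.rpow_neg (hpos y).le, ← div_eq_mul_inv, lt_div_iff₀ (by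
      have := hpos y
      positivity)]
    exact h1
  · exact fun τ y => (hbd τ y).1
  · exact fun τ y => (hbd τ y).2.trans
      (mul_le_mul_of_nonneg_right (hAb _ (norm_nonneg y)) (abs_nonneg _))
  · intro τ y
    have h1 := hu.sandwich_max hu0 y τ
    have h2 := hv.sandwich_max hv0 y τ
    have h3 := hf₁.pos _ (norm_nonneg y)
    have h4 := hFb _ (norm_nonneg y)
    rw [abs_le]
    constructor <;> linarith

/-- Weighted `L¹`-contraction principle for rescaled solutions in the monotone case (C1),
including the strict contraction when the initial values differ. -/
theorem weighted_L1_contraction_C1 (n : ℕ) (m β α : ℝ) (hn : 3 ≤ n) (hm0 : 0 < m)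
    (hm1 : m < ((n : ℝ) - 2) / n) (hα : α = (2 * β + 1) / (1 - m)) (hC1 : CondC1 n m β)
    (f : ℝ → ℝ → ℝ) (hf : ∀ lam, 0 < lam → IsProfile n m β α lam (f lam))
    (lam1 lam2 : ℝ) (hlam1 : 0 < lam1) (h12 : lam1 ≤ lam2)
    (u0t v0t : EuclideanSpace ℝ (Fin n) → ℝ)
    (hu0loc : LocallyIntegrable u0t) (hv0loc : LocallyIntegrable v0t)
    (hu0sand : ∀ y, f lam1 ‖y‖ ≤ u0t y ∧ u0t y ≤ f lam2 ‖y‖)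
    (hv0sand : ∀ y, f lam1 ‖y‖ ≤ v0t y ∧ v0t y ≤ f lam2 ‖y‖)
    (hdiff : Integrable (fun y => |u0t y - v0t y| * singC n m y ^ pZero n m β))
    (ut vt : EuclideanSpace ℝ (Fin n) → ℝ → ℝ)
    (hut : IsRescaledSolution n m β α (f lam1) (f lam2) u0t ut)
    (hvt : IsRescaledSolution n m β α (f lam1) (f lam2) v0t vt) :
    (0 < aStar n m β ∧
      ∀ τ : ℝ, 0 < τ →
        (∫ y, |ut y τ - vt y τ| * singC n m y ^ pZero n m β) +
          aStar n m β *
            ∫ s in Set.Ioc (0 : ℝ) τ, ∫ y, |ut y s - vt y s| *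
              |(singC n m y / f lam2 ‖y‖) ^ (1 - m) - 1| * singC n m y ^ pZero n m β ≤
          ∫ y, |u0t y - v0t y| * singC n m y ^ pZero n m β) ∧
    (u0t ≠ v0t →
      ∀ τ : ℝ, 0 < τ →
        (∫ y, |ut y τ - vt y τ| * singC n m y ^ pZero n m β) <
          ∫ y, |u0t y - v0t y| * singC n m y ^ pZero n m β) := by
  have hm := exponent_lt_one hn hm1
  have hC := Cstar_pos hn hm0 hm1
  have ha := aStar_pos hn hm0 hm1 hC1
  obtain ⟨A, F, h⟩ := IsRescaledSolution.exists_isControlledPair hn hm0 hm1 hα hC1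
    (hf lam1 hlam1) (hf lam2 (hlam1.trans_le h12)) hu0sand hv0sand hut hvt
  set κ := pZero n m β / (1 - m)
  have hK : 0 < Cstar n m ^ κ := Real.rpow_pos_of_pos hC _
  have hweight : ∀ y : EuclideanSpace ℝ (Fin n),
      singC n m y ^ pZero n m β = Cstar n m ^ κ * (‖y‖ ^ 2) ^ (-κ) := singC_rpow_pZero hC.le
  have hslice : ∀ τ, 0 < τ → (∫ y, |ut y τ - vt y τ| * singC n m y ^ pZero n m β) =
      Cstar n m ^ κ * ∫ y, |ut y (max τ 0) - vt y (max τ 0)| * (‖y‖ ^ 2) ^ (-κ) := fun τ hτ => by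
    rw [← integral_const_mul]
    refine integral_congr_ae (Eventually.of_forall fun y => ?_)
    simp only [hweight, max_eq_left hτ.le]
    ring
  have hinit : (∫ y, |u0t y - v0t y| * singC n m y ^ pZero n m β) =
      Cstar n m ^ κ * ∫ y, |ut y (max 0 0) - vt y (max 0 0)| * (‖y‖ ^ 2) ^ (-κ) := by
    rw [← integral_const_mul]
    refine integral_congr_ae (Eventually.of_forall fun y => ?_)
    simp only [hweight, max_self, hut.init, hvt.init]
    ring
  have h0 : Integrable fun y => |ut y (max 0 0) - vt y (max 0 0)| * (‖y‖ ^ 2) ^ (-κ) := by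
    refine (hdiff.const_mul (Cstar n m ^ κ)⁻¹).congr (Eventually.of_forall fun y => ?_)
    simp only [hweight, max_self, hut.init, hvt.init]
    field_simp
  have hdiss : ∀ τ, 0 < τ → (∫ s in Ioc (0 : ℝ) τ, ∫ y, |ut y s - vt y s| *
        |(singC n m y / f lam2 ‖y‖) ^ (1 - m) - 1| * singC n m y ^ pZero n m β) =
      Cstar n m ^ κ * ∫ p, |ut p.2 (max p.1 0) - vt p.2 (max p.1 0)| *
        dissWeight n κ (Cstar n m) (fun y => f lam2 ‖y‖ ^ (m - 1)) p.2 ∂slab n 0 τ := by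
    intro τ hτ
    rw [integral_prod _ (h.contraction h0 hτ.le).1, ← integral_const_mul]
    refine setIntegral_congr_fun measurableSet_Ioc fun s hs => ?_
    simp only
    rw [← integral_const_mul]
    refine integral_congr_ae ?_
    filter_upwards [ae_ne_zero h.one_le_dim] with y hy
    have hy' : 0 < ‖y‖ ^ 2 := by positivity
    have h1 : 1 < Cstar n m * f lam2 ‖y‖ ^ (m - 1) / ‖y‖ ^ 2 := by
      rw [lt_div_iff₀ hy', one_mul]
      exact h.diffusion_gt y
    rw [hweight, singC_div_rpow hC.le hm ((hf lam2 (hlam1.trans_le h12)).pos _ (norm_nonneg y)),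
      abs_of_pos (sub_pos.2 h1), max_eq_left hs.1.le, dissWeight]
    ring
  refine ⟨⟨ha, fun τ hτ => ?_⟩, fun hne τ hτ => ?_⟩
  · rw [hslice τ hτ, hinit, hdiss τ hτ]
    have h1 := mul_le_mul_of_nonneg_left (h.contraction h0 hτ.le).2 hK.le
    linarith
  · rw [hslice τ hτ, hinit]
    obtain ⟨h1, h2⟩ := h.contraction h0 hτ.le
    have h3 := h.dissipation_pos (fun hz => hne (funext fun y => ?_)) hτ h1
    · have h4 := mul_pos ha h3
      exact mul_lt_mul_of_pos_left (by linarith) hK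
    · have := congrFun hz y
      simp only [max_self, hut.init, hvt.init, Pi.zero_apply] at this
      linarith
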